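/- Let d ≥ 2, let Ω ⊆ ℝ^d be open, let W : Ω → ℝ be measurable with W_∞ := ‖W‖_∞ < ∞, and suppose B(x₀, r₀) ⊆ Ω for some x₀ ∈ ℝ^d and r₀ > 0. There exist a constant γ_d > 0 depending only on d, a radius r₁ with 0 < r₁ < r₀ depending only on d, W_∞ and r₀, and a constant C ≥ 1 depending only on d, W_∞ and r₁, with the following property. If F is a finite-dimensional linear subspace of real-valued twice continuously differentiable functions on Ω that are square integrable on Ω, and C_F ≥ 0 is such that sup_{x∈B(x₀,r₀)} |−Δψ(x) + W(x)ψ(x)| ≤ C_F · ‖ψ‖_{L²(Ω)} for all ψ ∈ F, then for every N ∈ ℕ there is a linear subspace F_N of F with dim F_N ≥ dim F − γ_d N^{d−1} such that every ψ ∈ F_N satisfies |ψ(x)| ≤ (C^{N²} · |x−x₀|^{N+1} + C_F) · ‖ψ‖_{L²(Ω)} for all x ∈ B(x₀, r₁). -/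

import Mathlib

open MeasureTheory

/-- The Laplacian `Δf = ∑ j ∂²f/∂x_j²` of a function on `ℝ^d`. -/
noncomputable def lap {d : ℕ} (f : EuclideanSpace ℝ (Fin d) → ℝ)
    (x : EuclideanSpace ℝ (Fin d)) : ℝ :=
  ∑ i, fderiv ℝ (fun y => fderiv ℝ f y (EuclideanSpace.single i 1)) x
    (EuclideanSpace.single i 1)

open scoped ContDiff

/-- The partial derivative of `f` in the `i`-th coordinate direction. -/
noncomputable def partialD {d : ℕ} (i : Fin d) (f : EuclideanSpace ℝ (Fin d) → ℝ)
    (x : EuclideanSpace ℝ (Fin d)) : ℝ :=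
  fderiv ℝ f x (EuclideanSpace.single i 1)

theorem lap_eq_sum_partialD {d : ℕ} (f : EuclideanSpace ℝ (Fin d) → ℝ)
    (x : EuclideanSpace ℝ (Fin d)) : lap f x = ∑ i, partialD i (partialD i f) x := rfl

/-- The radial profile, as a function of `s = ‖z‖ ^ 2`, of the Newtonian potential in
dimension `m + 2`; its derivative is `s ^ (-(m + 2) / 2) / 2`. -/
noncomputable def newtonProfile (m : ℕ) (s : ℝ) : ℝ :=
  if m = 0 then Real.log s / 2 else -(s ^ (-(m : ℝ) / 2)) / m

theorem hasDerivAt_newtonProfile (m : ℕ) {s : ℝ} (hs : 0 < s) :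
    HasDerivAt (newtonProfile m) (s ^ (-((m : ℝ) + 2) / 2) / 2) s := by
  unfold newtonProfile
  by_cases hm : m = 0
  · subst hm
    simp only [if_true]
    refine ((Real.hasDerivAt_log hs.ne').div_const 2).congr_deriv ?_
    rw [← Real.rpow_neg_one]; norm_num
  · simp only [hm, if_false]
    have hm' : (m : ℝ) ≠ 0 := by exact_mod_cast hm
    refine (((Real.hasDerivAt_rpow_const (p := -(m : ℝ) / 2) (Or.inl hs.ne')).neg).div_const
      (m : ℝ)).congr_deriv ?_
    rw [show -(m : ℝ) / 2 - 1 = -((m : ℝ) + 2) / 2 by ring]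
    field_simp

theorem contDiffAt_newtonProfile (m : ℕ) {s : ℝ} (hs : 0 < s) :
    ContDiffAt ℝ ω (newtonProfile m) s := by
  unfold newtonProfile
  by_cases hm : m = 0
  · subst hm
    simp only [if_true]
    exact (Real.contDiffAt_log.2 hs.ne').div_const 2
  · simp only [hm, if_false]
    exact ((Real.contDiffAt_rpow_const_of_ne hs.ne').neg).div_const _

theorem abs_newtonProfile_le (m : ℕ) {s : ℝ} (hs : 0 < s) (hs2 : s ≤ 2) :
    |newtonProfile m s| ≤ 2 * s ^ (-((m : ℝ) + 1) / 2) := by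
  unfold newtonProfile
  by_cases hm : m = 0
  · subst hm
    simp only [if_true, abs_div, abs_two, Nat.cast_zero, zero_add]
    have h1 : Real.log s⁻¹ ≤ (s⁻¹) ^ (1 / 2 : ℝ) / (1 / 2) :=
      Real.log_le_rpow_div (by positivity) (by norm_num)
    rw [Real.inv_rpow hs.le, ← Real.rpow_neg hs.le, Real.log_inv] at h1
    have h2 : Real.log s ≤ 1 := by
      have := Real.log_le_sub_one_of_pos hs; linarith
    have h3 : (1 / 2 : ℝ) ≤ s ^ (-1 / 2 : ℝ) := by
      rw [show (-1 / 2 : ℝ) = -(1 / 2) by ring, Real.rpow_neg hs.le, ← Real.sqrt_eq_rpow,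
        one_div]
      gcongr
      exact Real.sqrt_le_iff.2 ⟨by norm_num, by linarith⟩
    rw [show (-(1 / 2) : ℝ) = -1 / 2 by ring] at h1
    rw [div_le_iff₀ (by norm_num), abs_le]
    constructor <;> linarith
  · simp only [hm, if_false]
    have hm' : (1 : ℝ) ≤ m := by exact_mod_cast Nat.one_le_iff_ne_zero.2 hm
    have h0 := Real.rpow_pos_of_pos hs (-(m : ℝ) / 2)
    rw [abs_div, abs_neg, abs_of_pos h0, abs_of_pos (by linarith : (0 : ℝ) < m)]
    have : s ^ (-(m : ℝ) / 2) = s ^ (1 / 2 : ℝ) * s ^ (-((m : ℝ) + 1) / 2) := by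
      rw [← Real.rpow_add hs]; congr 1; ring
    calc s ^ (-(m : ℝ) / 2) / m ≤ s ^ (-(m : ℝ) / 2) := div_le_self h0.le hm'
      _ ≤ 2 * s ^ (-((m : ℝ) + 1) / 2) := by
        rw [this]
        gcongr
        rw [← Real.sqrt_eq_rpow]
        exact Real.sqrt_le_iff.2 ⟨by norm_num, by linarith⟩

/-- The regularized Newtonian potential in dimension `m + 2`. -/
noncomputable def newton (m : ℕ) (ε : ℝ) (z : EuclideanSpace ℝ (Fin (m + 2))) : ℝ :=
  newtonProfile m (‖z‖ ^ 2 + ε ^ 2)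

/-- The kernel `‖z‖ ^ (-(m + 1))`. -/
noncomputable def kap (m : ℕ) (z : EuclideanSpace ℝ (Fin (m + 2))) : ℝ := (‖z‖ ^ (m + 1))⁻¹

theorem kap_nonneg (m : ℕ) (z : EuclideanSpace ℝ (Fin (m + 2))) : 0 ≤ kap m z := by
  unfold kap; positivity

theorem kap_neg (m : ℕ) (z : EuclideanSpace ℝ (Fin (m + 2))) : kap m (-z) = kap m z := by
  simp [kap]

theorem rpow_neg_half_le (k : ℕ) {t s : ℝ} (ht : 0 < t) (hs : t ^ 2 ≤ s) :
    s ^ (-(k : ℝ) / 2) ≤ (t ^ k)⁻¹ := by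
  have h : (t ^ 2) ^ (-(k : ℝ) / 2) = (t ^ k)⁻¹ := by
    rw [← Real.rpow_natCast t 2, ← Real.rpow_mul ht.le, ← Real.rpow_natCast,
      ← Real.rpow_neg ht.le]
    congr 1; push_cast; ring
  rw [← h]
  exact Real.rpow_le_rpow_of_nonpos (by positivity) hs
    (by have : (0 : ℝ) ≤ k := by positivity
        linarith)

theorem abs_newton_le (m : ℕ) {ε : ℝ} (hε : |ε| ≤ 1) {z : EuclideanSpace ℝ (Fin (m + 2))}
    (hz : z ≠ 0) (hz1 : ‖z‖ ≤ 1) : |newton m ε z| ≤ 2 * kap m z := by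
  have h0 : 0 < ‖z‖ := norm_pos_iff.2 hz
  have h1 : ε ^ 2 ≤ 1 := (sq_le_one_iff_abs_le_one ε).2 hε
  refine (abs_newtonProfile_le m (by positivity) (by nlinarith)).trans ?_
  have := rpow_neg_half_le (m + 1) h0 (s := ‖z‖ ^ 2 + ε ^ 2) (by nlinarith)
  unfold kap
  push_cast at this
  linarith

theorem contDiffAt_newton (m : ℕ) {ε : ℝ} {z : EuclideanSpace ℝ (Fin (m + 2))}
    (h : 0 < ‖z‖ ^ 2 + ε ^ 2) : ContDiffAt ℝ ω (newton m ε) z := by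
  unfold newton
  exact (contDiffAt_newtonProfile m h).comp z
    (((contDiff_norm_sq ℝ).add contDiff_const).contDiffAt)

theorem hasFDerivAt_newton (m : ℕ) {ε : ℝ} {z : EuclideanSpace ℝ (Fin (m + 2))}
    (h : 0 < ‖z‖ ^ 2 + ε ^ 2) :
    HasFDerivAt (newton m ε)
      ((‖z‖ ^ 2 + ε ^ 2) ^ (-((m : ℝ) + 2) / 2) • innerSL ℝ z) z := by
  have h1 : HasFDerivAt (fun z : EuclideanSpace ℝ (Fin (m + 2)) => ‖z‖ ^ 2 + ε ^ 2)
      (2 • innerSL ℝ z) z := (hasStrictFDerivAt_norm_sq z).hasFDerivAt.add_const _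
  refine ((hasDerivAt_newtonProfile m h).comp_hasFDerivAt z h1).congr_fderiv ?_
  rw [← Nat.cast_smul_eq_nsmul ℝ, smul_smul]
  congr 1
  push_cast
  ring

theorem partialD_newton (m : ℕ) {ε : ℝ} {z : EuclideanSpace ℝ (Fin (m + 2))}
    (h : 0 < ‖z‖ ^ 2 + ε ^ 2) (i : Fin (m + 2)) :
    partialD i (newton m ε) z = (‖z‖ ^ 2 + ε ^ 2) ^ (-((m : ℝ) + 2) / 2) * z i := by
  unfold partialD
  rw [(hasFDerivAt_newton m h).fderiv]
  simp [EuclideanSpace.inner_single_right]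

theorem isOpen_normSq_add_pos {d : ℕ} (ε : ℝ) :
    IsOpen {z : EuclideanSpace ℝ (Fin d) | 0 < ‖z‖ ^ 2 + ε ^ 2} :=
  isOpen_lt continuous_const (by fun_prop)

theorem partialD_partialD_newton (m : ℕ) {ε : ℝ} {z : EuclideanSpace ℝ (Fin (m + 2))}
    (h : 0 < ‖z‖ ^ 2 + ε ^ 2) (i : Fin (m + 2)) :
    partialD i (partialD i (newton m ε)) z = (‖z‖ ^ 2 + ε ^ 2) ^ (-((m : ℝ) + 2) / 2)
      - (m + 2) * (‖z‖ ^ 2 + ε ^ 2) ^ (-((m : ℝ) + 4) / 2) * z i ^ 2 := by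
  have he : partialD i (newton m ε) =ᶠ[nhds z]
      fun z => (‖z‖ ^ 2 + ε ^ 2) ^ (-((m : ℝ) + 2) / 2) * z i := by
    filter_upwards [(isOpen_normSq_add_pos ε).mem_nhds h] with y hy
    exact partialD_newton m hy i
  rw [partialD, he.fderiv_eq]
  have h1 : HasFDerivAt (fun z : EuclideanSpace ℝ (Fin (m + 2)) => ‖z‖ ^ 2 + ε ^ 2)
      (2 • innerSL ℝ z) z := (hasStrictFDerivAt_norm_sq z).hasFDerivAt.add_const _
  have h2 := h1.rpow_const (p := -((m : ℝ) + 2) / 2) (Or.inl h.ne')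
  have h3 : HasFDerivAt (fun z : EuclideanSpace ℝ (Fin (m + 2)) => z i)
      (EuclideanSpace.proj i : EuclideanSpace ℝ (Fin (m + 2)) →L[ℝ] ℝ) z :=
    (EuclideanSpace.proj i : EuclideanSpace ℝ (Fin (m + 2)) →L[ℝ] ℝ).hasFDerivAt
  rw [(h2.fun_mul h3).fderiv]
  simp [EuclideanSpace.inner_single_right]
  rw [show (-2 + -(m : ℝ)) / 2 - 1 = (-4 + -(m : ℝ)) / 2 by ring]
  ring

theorem lap_newton (m : ℕ) {ε : ℝ} {z : EuclideanSpace ℝ (Fin (m + 2))}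
    (h : 0 < ‖z‖ ^ 2 + ε ^ 2) :
    lap (newton m ε) z = (m + 2) * ε ^ 2 * (‖z‖ ^ 2 + ε ^ 2) ^ (-((m : ℝ) + 4) / 2) := by
  rw [lap_eq_sum_partialD]
  simp_rw [partialD_partialD_newton m h]
  rw [Finset.sum_sub_distrib, ← Finset.mul_sum, ← EuclideanSpace.real_norm_sq_eq]
  have : (‖z‖ ^ 2 + ε ^ 2) ^ (-((m : ℝ) + 2) / 2)
      = (‖z‖ ^ 2 + ε ^ 2) * (‖z‖ ^ 2 + ε ^ 2) ^ (-((m : ℝ) + 4) / 2) := by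
    nth_rewrite 2 [← Real.rpow_one (‖z‖ ^ 2 + ε ^ 2)]
    rw [← Real.rpow_add h]; congr 1; ring
  rw [this]
  simp
  ring

theorem AnalyticAt.exists_norm_iteratedFDeriv_le {E F : Type*} [NormedAddCommGroup E]
    [NormedSpace ℝ E] [NormedAddCommGroup F] [NormedSpace ℝ F] [CompleteSpace F] {f : E → F}
    {x : E} (h : AnalyticAt ℝ f x) :
    ∃ A : ℝ, 1 ≤ A ∧ ∀ j : ℕ, ‖iteratedFDeriv ℝ j f x‖ ≤ A ^ (j + 1) * j.factorial := by
  obtain ⟨p, r, hp⟩ := h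
  obtain ⟨s, hs0, hsr⟩ := ENNReal.lt_iff_exists_nnreal_btwn.1 (hp.r_pos.trans_le hp.r_le)
  have hs : (0 : ℝ) < s := by exact_mod_cast hs0
  obtain ⟨C, hC, hCp⟩ := p.norm_mul_pow_le_of_lt_radius hsr
  refine ⟨max 1 (max C (s : ℝ)⁻¹), le_max_left _ _, fun j => ?_⟩
  set A := max 1 (max C (s : ℝ)⁻¹)
  have hA : 0 ≤ A := zero_le_one.trans (le_max_left _ _)
  have hCA : C ≤ A := (le_max_left _ _).trans (le_max_right _ _)
  have hsA : (s : ℝ)⁻¹ ≤ A := (le_max_right _ _).trans (le_max_right _ _)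
  have hpj : ‖p j‖ ≤ A ^ (j + 1) := by
    have h1 : ‖p j‖ ≤ C * (s : ℝ)⁻¹ ^ j := by
      rw [inv_pow, ← div_eq_mul_inv, le_div_iff₀ (by positivity)]; exact hCp j
    refine h1.trans ?_
    rw [pow_succ']
    gcongr
  refine ContinuousMultilinearMap.opNorm_le_bound (by positivity) fun v => ?_
  rw [hp.iteratedFDeriv_eq_sum_of_completeSpace v]
  calc ‖∑ σ : Equiv.Perm (Fin j), p j (fun i => v (σ i))‖
      ≤ ∑ σ : Equiv.Perm (Fin j), ‖p j (fun i => v (σ i))‖ := norm_sum_le _ _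
    _ ≤ ∑ _σ : Equiv.Perm (Fin j), A ^ (j + 1) * ∏ i, ‖v i‖ := by
      refine Finset.sum_le_sum fun σ _ => ?_
      refine ((p j).le_opNorm _).trans ?_
      rw [Equiv.prod_comp σ (fun i => ‖v i‖)]
      gcongr
    _ = A ^ (j + 1) * j.factorial * ∏ i, ‖v i‖ := by
      simp [Fintype.card_perm]; ring

theorem exists_newton_smul (m : ℕ) {c : ℝ} (hc : 0 < c) : ∃ b : ℝ,
    ∀ z : EuclideanSpace ℝ (Fin (m + 2)), z ≠ 0 →
      newton m 0 (c • z) = (c ^ m)⁻¹ * newton m 0 z + b := by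
  by_cases hm : m = 0
  · subst hm
    refine ⟨Real.log c, fun z hz => ?_⟩
    have h0 : ‖z‖ ≠ 0 := norm_ne_zero_iff.2 hz
    simp [newton, newtonProfile, norm_smul, abs_of_pos hc, Real.log_mul hc.ne' h0]
    ring
  · refine ⟨0, fun z hz => ?_⟩
    simp only [newton, newtonProfile, hm, if_false, norm_smul, Real.norm_eq_abs, abs_of_pos hc]
    have h1 : (c ^ 2) ^ (-(m : ℝ) / 2) = (c ^ m)⁻¹ := by
      rw [← Real.rpow_natCast c 2, ← Real.rpow_mul hc.le, ← Real.rpow_natCast,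
        ← Real.rpow_neg hc.le]
      congr 1; push_cast; ring
    rw [show (c * ‖z‖) ^ 2 + 0 ^ 2 = c ^ 2 * (‖z‖ ^ 2 + 0 ^ 2) by ring,
      Real.mul_rpow (by positivity) (by positivity), h1]
    ring

theorem norm_iteratedFDeriv_comp_smul {E F : Type*} [NormedAddCommGroup E]
    [NormedSpace ℝ E] [NormedAddCommGroup F] [NormedSpace ℝ F] (f : E → F) {c : ℝ} (hc : 0 < c)
    (x : E) (j : ℕ) :
    ‖iteratedFDeriv ℝ j (fun z => f (c • z)) x‖ = c ^ j * ‖iteratedFDeriv ℝ j f (c • x)‖ := by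
  set g : E ≃L[ℝ] E := ContinuousLinearEquiv.smulLeft (Units.mk0 c hc.ne') with hg
  have hgz : ∀ z, g z = c • z := fun z => rfl
  have h := g.iteratedFDerivWithin_comp_right f uniqueDiffOn_univ (Set.mem_univ _) (x := x) j
  simp only [Set.preimage_univ, iteratedFDerivWithin_univ] at h
  have h2 : iteratedFDeriv ℝ j (fun z => f (c • z)) x
      = c ^ j • iteratedFDeriv ℝ j f (c • x) := by
    refine Eq.trans h ?_
    ext v
    simp only [ContinuousMultilinearMap.compContinuousLinearMap_apply,
      ContinuousLinearEquiv.coe_coe, hgz, smul_apply]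
    rw [(iteratedFDeriv ℝ j f (c • x)).map_smul_univ (fun _ => c) v]
    simp
  rw [h2, norm_smul, norm_pow, Real.norm_of_nonneg hc.le]

theorem exists_linearIsometryEquiv_apply_eq {E : Type*} [NormedAddCommGroup E]
    [InnerProductSpace ℝ E] [CompleteSpace E] {x y : E} (h : ‖x‖ = ‖y‖) :
    ∃ R : E ≃ₗᵢ[ℝ] E, R x = y :=
  ⟨_, Submodule.reflection_sub h⟩

theorem iteratedFDeriv_add_const_of_pos {E F : Type*} [NormedAddCommGroup E]
    [NormedSpace ℝ E] [NormedAddCommGroup F] [NormedSpace ℝ F] (f : E → F) (b : F) (x : E)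
    {j : ℕ} (hj : 1 ≤ j) :
    iteratedFDeriv ℝ j (fun z => f z + b) x = iteratedFDeriv ℝ j f x := by
  obtain ⟨k, rfl⟩ := Nat.exists_eq_succ_of_ne_zero (Nat.one_le_iff_ne_zero.1 hj)
  have : (fun z => fderiv ℝ (fun z => f z + b) z) = fun z => fderiv ℝ f z := by
    funext z; rw [fderiv_add_const]
  rw [iteratedFDeriv_succ_eq_comp_right, iteratedFDeriv_succ_eq_comp_right]
  simp only [Function.comp_apply]
  rw [this]

theorem exists_norm_iteratedFDeriv_newton_le (m : ℕ) : ∃ A : ℝ, 1 ≤ A ∧ ∀ j : ℕ, 1 ≤ j →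
    ∀ z : EuclideanSpace ℝ (Fin (m + 2)), z ≠ 0 →
      ‖iteratedFDeriv ℝ j (newton m 0) z‖ ≤ A ^ (j + 1) * j.factorial * (‖z‖ ^ (m + j))⁻¹ := by
  set e : EuclideanSpace ℝ (Fin (m + 2)) := EuclideanSpace.single 0 1 with he
  have he1 : ‖e‖ = 1 := by simp [he]
  have hcd : ContDiffAt ℝ ω (newton m 0) e := contDiffAt_newton m (by rw [he1]; norm_num)
  obtain ⟨A, hA, hb⟩ := hcd.analyticAt.exists_norm_iteratedFDeriv_le
  refine ⟨A, hA, fun j hj z hz => ?_⟩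
  have hn : 0 < ‖z‖ := norm_pos_iff.2 hz
  set c := ‖z‖⁻¹ with hc
  have hc0 : 0 < c := inv_pos.2 hn
  have hcz : ‖c • z‖ = ‖e‖ := by
    rw [norm_smul, Real.norm_of_nonneg hc0.le, he1, hc, inv_mul_cancel₀ hn.ne']
  obtain ⟨R, hR⟩ := exists_linearIsometryEquiv_apply_eq hcz
  have h1 : ‖iteratedFDeriv ℝ j (newton m 0) (c • z)‖ ≤ A ^ (j + 1) * j.factorial := by
    have := R.norm_iteratedFDeriv_comp_right (newton m 0) (c • z) j
    rw [hR] at this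
    have h2 : newton m 0 ∘ R = newton m 0 := by
      funext y; simp [newton]
    rw [h2] at this
    rw [this]; exact hb j
  obtain ⟨b, hbz⟩ := exists_newton_smul m hc0
  have h3 : (fun y => newton m 0 (c • y)) =ᶠ[nhds z]
      fun y => ((c ^ m)⁻¹ • newton m 0) y + b := by
    filter_upwards [isOpen_ne.mem_nhds hz] with y hy
    simpa using hbz y hy
  have h4 := norm_iteratedFDeriv_comp_smul (newton m 0) hc0 z j
  rw [(h3.iteratedFDeriv ℝ j).eq_of_nhds, iteratedFDeriv_add_const_of_pos _ _ _ hj,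
    iteratedFDeriv_const_smul_apply, norm_smul] at h4
  · rw [norm_inv, norm_pow, Real.norm_of_nonneg hc0.le, inv_mul_eq_iff_eq_mul₀ (by positivity)]
      at h4
    rw [h4, ← mul_assoc, ← pow_add, hc, inv_pow, mul_comm]
    gcongr
  · exact (contDiffAt_newton m (by positivity)).of_le le_top

/-- The kernels of the local representation formula: the Newtonian potential and its first
partial derivatives. -/
noncomputable def newtonKer (m : ℕ) :
    Option (Fin (m + 2)) → EuclideanSpace ℝ (Fin (m + 2)) → ℝ
  | none => newton m 0
  | some i => partialD i (newton m 0)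

theorem contDiffAt_partialD {d : ℕ} {i : Fin d} {f : EuclideanSpace ℝ (Fin d) → ℝ}
    {x : EuclideanSpace ℝ (Fin d)} (h : ContDiffAt ℝ ω f x) :
    ContDiffAt ℝ ω (partialD i f) x := by
  unfold partialD
  exact (h.fderiv_right (m := ω) le_top).clm_apply contDiffAt_const

theorem contDiffAt_newtonKer (m : ℕ) (o : Option (Fin (m + 2)))
    {z : EuclideanSpace ℝ (Fin (m + 2))} (hz : z ≠ 0) : ContDiffAt ℝ ω (newtonKer m o) z := by
  have h := contDiffAt_newton m (ε := 0) (z := z) (by positivity)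
  cases o with
  | none => exact h
  | some i => exact contDiffAt_partialD h

theorem norm_iteratedFDeriv_partialD_le {d : ℕ} (i : Fin d) {f : EuclideanSpace ℝ (Fin d) → ℝ}
    {x : EuclideanSpace ℝ (Fin d)} (h : ContDiffAt ℝ ω f x) (j : ℕ) :
    ‖iteratedFDeriv ℝ j (partialD i f) x‖ ≤ ‖iteratedFDeriv ℝ (j + 1) f x‖ := by
  rw [← norm_iteratedFDeriv_fderiv]
  have := norm_iteratedFDeriv_clm_apply_const (𝕜 := ℝ) (f := fderiv ℝ f)
    (c := EuclideanSpace.single i (1 : ℝ)) (x := x) (N := ω) (n := j)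
    (h.fderiv_right (m := ω) le_top) le_top
  rw [show ‖EuclideanSpace.single i (1 : ℝ)‖ = 1 by simp, one_mul] at this
  exact this

theorem exists_norm_iteratedFDeriv_newtonKer_le (m : ℕ) : ∃ A : ℝ, 1 ≤ A ∧
    (∀ j : ℕ, ∀ z : EuclideanSpace ℝ (Fin (m + 2)), z ≠ 0 → ∀ i,
      ‖iteratedFDeriv ℝ j (newtonKer m (some i)) z‖
        ≤ A ^ (j + 1) * j.factorial * (‖z‖ ^ (m + 1 + j))⁻¹) ∧
    (∀ j : ℕ, 1 ≤ j → ∀ z : EuclideanSpace ℝ (Fin (m + 2)), z ≠ 0 →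
      ‖iteratedFDeriv ℝ j (newtonKer m none) z‖
        ≤ A ^ (j + 1) * j.factorial * (‖z‖ ^ (m + j))⁻¹) ∧
    (∀ j : ℕ, ∀ z : EuclideanSpace ℝ (Fin (m + 2)), z ≠ 0 → ‖z‖ ≤ 1 → ∀ o,
      ‖iteratedFDeriv ℝ j (newtonKer m o) z‖
        ≤ A ^ (j + 1) * j.factorial * (‖z‖ ^ (m + 1 + j))⁻¹) := by
  obtain ⟨A, hA, hb⟩ := exists_norm_iteratedFDeriv_newton_le m
  have hA2 : A ≤ 2 * A ^ 2 := by nlinarith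
  have hsome : ∀ j : ℕ, ∀ z : EuclideanSpace ℝ (Fin (m + 2)), z ≠ 0 → ∀ i,
      ‖iteratedFDeriv ℝ j (newtonKer m (some i)) z‖
        ≤ (2 * A ^ 2) ^ (j + 1) * j.factorial * (‖z‖ ^ (m + 1 + j))⁻¹ := by
    intro j z hz i
    refine (norm_iteratedFDeriv_partialD_le i
      (contDiffAt_newtonKer m none hz) j).trans ((hb (j + 1) (by omega) z hz).trans ?_)
    rw [show m + (j + 1) = m + 1 + j by ring]
    gcongr ?_ * _
    have h1 : ((j + 1 : ℕ) : ℝ) ≤ 2 ^ (j + 1) := by exact_mod_cast Nat.lt_two_pow_self.le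
    have h2 : A ^ (j + 1 + 1) ≤ (A ^ 2) ^ (j + 1) := by
      rw [← pow_mul]; exact pow_le_pow_right₀ hA (by omega)
    rw [Nat.factorial_succ, mul_pow]
    push_cast at h1 ⊢
    calc A ^ (j + 1 + 1) * (((j : ℝ) + 1) * j.factorial)
        ≤ (A ^ 2) ^ (j + 1) * (2 ^ (j + 1) * j.factorial) := by gcongr
      _ = _ := by ring
  have hnone : ∀ j : ℕ, 1 ≤ j → ∀ z : EuclideanSpace ℝ (Fin (m + 2)), z ≠ 0 →
      ‖iteratedFDeriv ℝ j (newtonKer m none) z‖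
        ≤ (2 * A ^ 2) ^ (j + 1) * j.factorial * (‖z‖ ^ (m + j))⁻¹ := by
    intro j hj z hz
    refine (hb j hj z hz).trans ?_
    gcongr
  refine ⟨2 * A ^ 2, by nlinarith, hsome, hnone, fun j z hz hz1 o => ?_⟩
  have hn : 0 < ‖z‖ := norm_pos_iff.2 hz
  cases o with
  | some i => exact hsome j z hz i
  | none =>
    rcases Nat.eq_zero_or_pos j with rfl | hj
    · rw [norm_iteratedFDeriv_zero, Real.norm_eq_abs]
      refine (abs_newton_le m (by simp) hz hz1).trans ?_
      have := kap_nonneg m z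
      simp only [kap] at this ⊢
      simp only [zero_add, pow_one, Nat.factorial_zero, Nat.cast_one, mul_one, add_zero]
      gcongr
      nlinarith
    · refine (hnone j hj z hz).trans ?_
      gcongr ?_ * ?_
      exact inv_anti₀ (by positivity) (pow_le_pow_of_le_one hn.le hz1 (by omega))

theorem integrableOn_kap_ball (m : ℕ) (R : ℝ) :
    IntegrableOn (kap m) (Metric.ball 0 R) := by
  refine (integrableOn_fun_norm_addHaar volume (f := fun s : ℝ => (s ^ (m + 1))⁻¹)).2 ?_
  have : IntegrableOn (fun _ : ℝ => (1 : ℝ)) (Set.Ioo 0 R) := by simp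
  refine this.congr_fun (fun y hy => ?_) measurableSet_Ioo
  have : (y ^ (m + 1)) ≠ 0 := pow_ne_zero _ hy.1.ne'
  simp [this]

theorem exists_setIntegral_kap_ball_eq (m : ℕ) : ∃ S : ℝ, 0 < S ∧ ∀ R : ℝ, 0 < R →
    ∫ y in Metric.ball (0 : EuclideanSpace ℝ (Fin (m + 2))) R, kap m y = S * R := by
  refine ⟨(m + 2) * (volume : Measure (EuclideanSpace ℝ (Fin (m + 2)))).real
    (Metric.ball 0 1), ?_, fun R hR => ?_⟩
  · have : 0 < (volume : Measure (EuclideanSpace ℝ (Fin (m + 2)))).real (Metric.ball 0 1) :=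
      ENNReal.toReal_pos (Metric.measure_ball_pos _ _ one_pos).ne' measure_ball_lt_top.ne
    positivity
  · rw [← integral_indicator measurableSet_ball]
    have h := integral_fun_norm_addHaar (volume : Measure (EuclideanSpace ℝ (Fin (m + 2))))
      ((Set.Iio R).indicator fun s : ℝ => (s ^ (m + 1))⁻¹)
    have h1 : (fun x : EuclideanSpace ℝ (Fin (m + 2)) =>
        (Set.Iio R).indicator (fun s : ℝ => (s ^ (m + 1))⁻¹) ‖x‖)
        = (Metric.ball 0 R).indicator (kap m) := by
      funext x; simp [Set.indicator, kap]
    rw [h1] at h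
    rw [h]
    have h2 : ∫ y in Set.Ioi (0 : ℝ), y ^ (Module.finrank ℝ (EuclideanSpace ℝ (Fin (m + 2))) - 1) •
        (Set.Iio R).indicator (fun s : ℝ => (s ^ (m + 1))⁻¹) y = R := by
      have h3 : ∫ y in Set.Ioi (0 : ℝ), (Set.Iio R).indicator (fun _ : ℝ => (1 : ℝ)) y = R := by
        rw [integral_indicator measurableSet_Iio, Measure.restrict_restrict measurableSet_Iio,
          Set.inter_comm, Set.Ioi_inter_Iio]
        simp [hR.le]
      refine (setIntegral_congr_fun measurableSet_Ioi fun y (hy : 0 < y) => ?_).trans h3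
      have : (y ^ (m + 1)) ≠ 0 := pow_ne_zero _ hy.ne'
      by_cases hyR : y < R <;> simp [hyR, this]
    rw [h2]
    simp
    ring

theorem integrableOn_kap_sub (m : ℕ) (x : EuclideanSpace ℝ (Fin (m + 2))) (R : ℝ) :
    IntegrableOn (fun y => kap m (x - y)) (Metric.ball x R) := by
  have h := ((Measure.measurePreserving_sub_left volume x).integrableOn_comp_preimage
    (MeasurableEquiv.subLeft x).measurableEmbedding (f := kap m) (s := Metric.ball 0 R)).2
    (integrableOn_kap_ball m R)
  have h2 : (fun y => x - y) ⁻¹' Metric.ball 0 R = Metric.ball x R := by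
    ext y; simp [dist_eq_norm, norm_sub_rev]
  rwa [h2] at h

theorem setIntegral_kap_sub (m : ℕ) (x : EuclideanSpace ℝ (Fin (m + 2))) (R : ℝ) :
    ∫ y in Metric.ball x R, kap m (x - y) = ∫ y in Metric.ball 0 R, kap m y := by
  have h := (Measure.measurePreserving_sub_left volume x).setIntegral_preimage_emb
    (MeasurableEquiv.subLeft x).measurableEmbedding (kap m) (Metric.ball 0 R)
  have h2 : (fun y => x - y) ⁻¹' Metric.ball 0 R = Metric.ball x R := by
    ext y; simp [dist_eq_norm, norm_sub_rev]
  rwa [h2] at h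

theorem ae_ne {d : ℕ} (x : EuclideanSpace ℝ (Fin (d + 1))) :
    ∀ᵐ y : EuclideanSpace ℝ (Fin (d + 1)), y ≠ x := by
  simp [ae_iff]

/-- The number of times the value `a` is attained by `l`. -/
def fiberCount {k : ℕ} {α : Type*} [DecidableEq α] (l : Fin k → α) (a : α) : ℕ :=
  ∑ i, if l i = a then 1 else 0

theorem fiberCount_snoc {k : ℕ} {α : Type*} [DecidableEq α] (l : Fin k → α) (i a : α) :
    fiberCount (Fin.snoc (α := fun _ => α) l i) a
      = fiberCount l a + if i = a then 1 else 0 := by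
  unfold fiberCount
  rw [Fin.sum_univ_castSucc]
  simp only [Fin.snoc_castSucc, Fin.snoc_last]

theorem fiberCount_comp_perm {k : ℕ} {α : Type*} [DecidableEq α] (l : Fin k → α)
    (σ : Equiv.Perm (Fin k)) (a : α) : fiberCount (l ∘ σ) a = fiberCount l a :=
  Equiv.sum_comp σ fun i => if l i = a then 1 else 0

theorem fiberCount_le {k : ℕ} {α : Type*} [DecidableEq α] (l : Fin k → α) (a : α) :
    fiberCount l a ≤ k := by
  unfold fiberCount
  calc _ ≤ ∑ _i : Fin k, 1 := Finset.sum_le_sum fun i _ => by split_ifs <;> simp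
    _ = k := by simp

theorem sum_fiberCount {k : ℕ} {α : Type*} [DecidableEq α] [Fintype α] (l : Fin k → α) :
    ∑ a, fiberCount l a = k := by
  unfold fiberCount
  rw [Finset.sum_comm]
  simp

theorem exists_perm_of_fiberCount_eq {k : ℕ} {α : Type*} [DecidableEq α] {l l' : Fin k → α}
    (h : ∀ a, fiberCount l a = fiberCount l' a) : ∃ σ : Equiv.Perm (Fin k), l' ∘ σ = l := by
  have hc : ∀ a, Fintype.card {i // l i = a} = Fintype.card {i // l' i = a} := fun a => by
    have := h a
    simp only [fiberCount, ← Finset.card_filter] at this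
    rw [Fintype.card_subtype, Fintype.card_subtype, this]
  refine ⟨Equiv.ofFiberEquiv (f := l) (g := l') fun a => Fintype.equivOfCardEq (hc a), ?_⟩
  funext i
  exact Equiv.ofFiberEquiv_map _ i

theorem exists_perm_comp_eq_snoc {k : ℕ} {α : Type*} [DecidableEq α] (l : Fin k → α) (a : α)
    (h : 2 ≤ fiberCount l a) : ∃ k' : ℕ, ∃ hk : k = k' + 2, ∃ σ : Equiv.Perm (Fin k),
      ∃ l' : Fin k' → α, l ∘ σ = fun i => Fin.snoc (α := fun _ => α)
        (Fin.snoc (α := fun _ => α) l' a) a (Fin.cast hk i) := by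
  have hk : 2 ≤ k := h.trans (fiberCount_le l a)
  obtain ⟨k', rfl⟩ := Nat.exists_eq_add_of_le' hk
  simp only [fiberCount, ← Finset.card_filter] at h
  obtain ⟨p, hp, q, hq, hpq⟩ := Finset.one_lt_card.1 h
  simp only [Finset.mem_filter, Finset.mem_univ, true_and] at hp hq
  set z : Fin (k' + 2) := Fin.last _ with hz
  set o : Fin (k' + 2) := (Fin.last k').castSucc with ho
  have hzo : z ≠ o := by simp [hz, ho, Fin.ext_iff]
  set q' := Equiv.swap z p q with hq'
  have hzq' : z ≠ q' := by
    intro e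
    have e2 : Equiv.swap z p p = Equiv.swap z p q := by rw [Equiv.swap_apply_right]; exact e
    exact hpq ((Equiv.swap z p).injective e2)
  set σ : Equiv.Perm (Fin (k' + 2)) := (Equiv.swap o q').trans (Equiv.swap z p) with hσ
  have h1 : l (σ z) = a := by
    simp [hσ, Equiv.swap_apply_of_ne_of_ne hzo hzq', hp]
  have h2 : l (σ o) = a := by
    simp [hσ, hq', hq]
  refine ⟨k', rfl, σ, Fin.init (α := fun _ => α) (Fin.init (α := fun _ => α) (l ∘ σ)), ?_⟩
  have e1 := Fin.snoc_init_self (α := fun _ => α) (Fin.init (α := fun _ => α) (l ∘ σ))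
  have e2 := Fin.snoc_init_self (α := fun _ => α) (l ∘ σ)
  have e3 : Fin.init (α := fun _ => α) (l ∘ σ) (Fin.last k') = a := h2
  have e4 : (l ∘ σ) (Fin.last (k' + 1)) = a := h1
  rw [e3] at e1
  rw [e4, ← e1] at e2
  exact e2.symm

/-- A symmetric traceless tensor of order `k` in dimension `m + 2` is determined by
`2 * (k + 1) ^ m` of its entries. -/
theorem exists_determining_entries (m k : ℕ) :
    ∃ rep : (Fin m → Fin (k + 1)) × Fin 2 → (Fin k → Fin (m + 2)),
      ∀ c : (Fin k → Fin (m + 2)) → ℝ, (∀ l (σ : Equiv.Perm (Fin k)), c (l ∘ σ) = c l) →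
        (∀ (k' : ℕ) (hk : k = k' + 2) (l : Fin k' → Fin (m + 2)),
          ∑ a, c (fun i => Fin.snoc (α := fun _ => Fin (m + 2))
            (Fin.snoc (α := fun _ => Fin (m + 2)) l a) a (Fin.cast hk i)) = 0) →
        (∀ κ, c (rep κ) = 0) → ∀ l, c l = 0 := by
  classical
  set P : (Fin m → Fin (k + 1)) × Fin 2 → (Fin k → Fin (m + 2)) → Prop := fun κ l =>
    (∀ j : Fin m, fiberCount l j.castSucc.castSucc = κ.1 j) ∧
      fiberCount l (Fin.last (m + 1)) = κ.2 with hP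
  refine ⟨fun κ => if h : ∃ l, P κ l then h.choose else fun _ => 0, fun c hs ht h0 => ?_⟩
  have key : ∀ n : ℕ, ∀ l, fiberCount l (Fin.last (m + 1)) = n → c l = 0 := by
    intro n
    induction n using Nat.strong_induction_on with
    | _ n ih =>
      intro l hl
      rcases lt_or_ge n 2 with hn | hn
      · set κ : (Fin m → Fin (k + 1)) × Fin 2 :=
          (fun j => ⟨fiberCount l j.castSucc.castSucc, Nat.lt_succ_of_le (fiberCount_le _ _)⟩,
            ⟨n, hn⟩) with hκ
        have hex : ∃ l, P κ l := ⟨l, fun j => rfl, hl⟩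
        have h1 := h0 κ
        simp only [dif_pos hex] at h1
        have h2 : P κ hex.choose := hex.choose_spec
        have h3 : P κ l := ⟨fun j => rfl, hl⟩
        have hmid : ∀ j : Fin m, fiberCount l j.castSucc.castSucc
            = fiberCount hex.choose j.castSucc.castSucc := fun j => (h3.1 j).trans (h2.1 j).symm
        have hlast := h3.2.trans h2.2.symm
        have hall : ∀ a, fiberCount l a = fiberCount hex.choose a := by
          have s1 := sum_fiberCount l
          have s2 := sum_fiberCount hex.choose
          rw [Fin.sum_univ_castSucc, Fin.sum_univ_castSucc] at s1 s2
          rw [Finset.sum_congr rfl fun j _ => hmid j, hlast] at s1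
          have hr : fiberCount l (Fin.last m).castSucc
            = fiberCount hex.choose (Fin.last m).castSucc := by omega
          intro a
          refine Fin.lastCases hlast (fun b => ?_) a
          exact Fin.lastCases hr hmid b
        obtain ⟨σ, hσ⟩ := exists_perm_of_fiberCount_eq hall
        rw [← hσ, hs]; exact h1
      · obtain ⟨k', hk, σ, l', hl'⟩ := exists_perm_comp_eq_snoc l _ (hn.trans hl.ge)
        have h1 := ht k' hk l'
        rw [Fin.sum_univ_castSucc, ← hl', hs] at h1
        subst hk
        have h2 := fiberCount_comp_perm l σ (Fin.last (m + 1))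
        rw [hl', hl] at h2
        simp only [Fin.cast_eq_self, fiberCount_snoc, if_true] at h2
        rw [Finset.sum_eq_zero] at h1
        · simpa using h1
        · intro b _
          refine ih (n - 2) (by omega) _ ?_
          simp only [Fin.cast_eq_self, fiberCount_snoc, (Fin.castSucc_lt_last b).ne, if_false]
          omega
  exact fun l => key _ l rfl

theorem iteratedFDeriv_succ_apply_snoc_single {d k : ℕ} {f : EuclideanSpace ℝ (Fin d) → ℝ}
    {x : EuclideanSpace ℝ (Fin d)} (hf : ContDiffAt ℝ ω f x) (l : Fin k → Fin d) (a : Fin d) :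
    iteratedFDeriv ℝ (k + 1) f x (fun i => EuclideanSpace.single
      (Fin.snoc (α := fun _ => Fin d) l a i) 1) =
    iteratedFDeriv ℝ k (partialD a f) x (fun i => EuclideanSpace.single (l i) 1) := by
  rw [iteratedFDeriv_succ_apply_right]
  have h := (ContinuousLinearMap.apply ℝ ℝ (EuclideanSpace.single a (1 : ℝ))).iteratedFDeriv_comp_left
    (hf.fderiv_right (m := ω) le_top) (i := k) (by exact le_top)
  have h2 : partialD a f = (ContinuousLinearMap.apply ℝ ℝ (EuclideanSpace.single a (1 : ℝ))) ∘
    fderiv ℝ f := rfl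
  rw [h2, h]
  simp only [ContinuousLinearMap.compContinuousMultilinearMap_coe, Function.comp_apply,
    ContinuousLinearMap.apply_apply, Fin.snoc_last]
  congr 3
  funext i
  simp [Fin.init]

theorem sum_iteratedFDeriv_snoc_snoc_eq {d k : ℕ} {f : EuclideanSpace ℝ (Fin d) → ℝ}
    {x : EuclideanSpace ℝ (Fin d)} (hf : ContDiffAt ℝ ω f x) (l : Fin k → Fin d) :
    ∑ a, iteratedFDeriv ℝ (k + 2) f x (fun i => EuclideanSpace.single
      (Fin.snoc (α := fun _ => Fin d) (Fin.snoc (α := fun _ => Fin d) l a) a i) 1) =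
    iteratedFDeriv ℝ k (lap f) x (fun i => EuclideanSpace.single (l i) 1) := by
  have h : lap f = fun x => ∑ a, partialD a (partialD a f) x := rfl
  rw [h, iteratedFDeriv_fun_sum_apply
    fun a _ => (contDiffAt_partialD (contDiffAt_partialD hf)).of_le le_top, sum_apply]
  refine Finset.sum_congr rfl fun a _ => ?_
  rw [iteratedFDeriv_succ_apply_snoc_single hf,
    iteratedFDeriv_succ_apply_snoc_single (contDiffAt_partialD hf)]

theorem partialD_congr {d : ℕ} {f g : EuclideanSpace ℝ (Fin d) → ℝ}
    {x : EuclideanSpace ℝ (Fin d)} (h : f =ᶠ[nhds x] g) (i : Fin d) :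
    partialD i f x = partialD i g x := by
  rw [partialD, partialD, h.fderiv_eq]

theorem partialD_comm {d : ℕ} {f : EuclideanSpace ℝ (Fin d) → ℝ}
    {x : EuclideanSpace ℝ (Fin d)} (hf : ContDiffAt ℝ 2 f x) (i j : Fin d) :
    partialD i (partialD j f) x = partialD j (partialD i f) x := by
  have hd : DifferentiableAt ℝ (fderiv ℝ f) x :=
    (hf.fderiv_right (m := 1) (by norm_num)).differentiableAt (by norm_num)
  have h : ∀ i j, partialD i (partialD j f) x = fderiv ℝ (fderiv ℝ f) x
      (EuclideanSpace.single i 1) (EuclideanSpace.single j 1) := by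
    intro i j
    unfold partialD
    rw [fderiv_clm_apply hd (differentiableAt_const _)]
    simp
  rw [h, h]
  exact (hf.isSymmSndFDerivAt (by simp)).eq _ _

theorem lap_partialD {d : ℕ} {f : EuclideanSpace ℝ (Fin d) → ℝ}
    {x : EuclideanSpace ℝ (Fin d)} (hf : ContDiffAt ℝ ω f x) (i : Fin d) :
    lap (partialD i f) x = partialD i (lap f) x := by
  have h : lap f = fun x => ∑ a, partialD a (partialD a f) x := rfl
  have h2 : partialD i (lap f) x = ∑ a, partialD i (partialD a (partialD a f)) x := by
    unfold partialD at h ⊢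
    rw [h, fderiv_fun_sum]
    · simp
    · intro a _
      exact (contDiffAt_partialD (contDiffAt_partialD hf)).differentiableAt (by simp)
  rw [h2, lap_eq_sum_partialD]
  refine Finset.sum_congr rfl fun a _ => ?_
  rw [partialD_comm ((contDiffAt_partialD hf).of_le le_top) i a]
  refine partialD_congr ?_ a
  filter_upwards [(hf.of_le (m := 2) le_top).eventually (by simp)] with y hy
  exact partialD_comm hy a i

theorem lap_newtonKer (m : ℕ) (o : Option (Fin (m + 2))) {z : EuclideanSpace ℝ (Fin (m + 2))}
    (hz : z ≠ 0) : lap (newtonKer m o) z = 0 := by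
  have h : ∀ y : EuclideanSpace ℝ (Fin (m + 2)), y ≠ 0 → lap (newton m 0) y = 0 := by
    intro y hy
    rw [lap_newton m (by positivity)]; simp
  cases o with
  | none => exact h z hz
  | some i =>
    refine (lap_partialD (contDiffAt_newtonKer m none hz) i).trans ?_
    have : lap (newtonKer m none) =ᶠ[nhds z] fun _ => 0 := by
      filter_upwards [isOpen_ne.mem_nhds hz] with y hy using h y hy
    rw [partialD_congr this]
    simp [partialD]

/-- The entries of the `k`-th derivative tensor of a representation kernel at `z`. -/
noncomputable def kerEntry (m : ℕ) (o : Option (Fin (m + 2))) {k : ℕ}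
    (l : Fin k → Fin (m + 2)) (z : EuclideanSpace ℝ (Fin (m + 2))) : ℝ :=
  iteratedFDeriv ℝ k (newtonKer m o) z fun i => EuclideanSpace.single (l i) 1

theorem kerEntry_comp_perm (m : ℕ) (o : Option (Fin (m + 2))) {k : ℕ}
    (l : Fin k → Fin (m + 2)) (σ : Equiv.Perm (Fin k)) {z : EuclideanSpace ℝ (Fin (m + 2))}
    (hz : z ≠ 0) : kerEntry m o (l ∘ σ) z = kerEntry m o l z :=
  (contDiffAt_newtonKer m o hz).iteratedFDeriv_comp_perm
    (fun i => EuclideanSpace.single (l i) 1) σ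

theorem sum_kerEntry_snoc_snoc (m : ℕ) (o : Option (Fin (m + 2))) {k : ℕ}
    (l : Fin k → Fin (m + 2)) {z : EuclideanSpace ℝ (Fin (m + 2))} (hz : z ≠ 0) :
    ∑ a, kerEntry m o (Fin.snoc (α := fun _ => Fin (m + 2))
      (Fin.snoc (α := fun _ => Fin (m + 2)) l a) a) z = 0 := by
  refine (sum_iteratedFDeriv_snoc_snoc_eq (contDiffAt_newtonKer m o hz) l).trans ?_
  have : lap (newtonKer m o) =ᶠ[nhds z] fun _ => 0 := by
    filter_upwards [isOpen_ne.mem_nhds hz] with y hy using lap_newtonKer m o hy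
  rw [(this.iteratedFDeriv ℝ k).eq_of_nhds]
  cases k with
  | zero => simp
  | succ k => rw [iteratedFDeriv_const_of_ne (by simp)]; rfl

theorem iteratedFDeriv_newtonKer_diag (m : ℕ) (o : Option (Fin (m + 2))) (k : ℕ)
    (x z : EuclideanSpace ℝ (Fin (m + 2))) :
    iteratedFDeriv ℝ k (newtonKer m o) z (fun _ => x)
      = ∑ l : Fin k → Fin (m + 2), (∏ i, x (l i)) * kerEntry m o l z := by
  have hx : x = ∑ a, x a • EuclideanSpace.single a (1 : ℝ) := by
    ext b; simp [Finset.sum_apply, Pi.single_apply]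
  conv_lhs => rw [hx]
  rw [ContinuousMultilinearMap.map_sum]
  refine Finset.sum_congr rfl fun l _ => ?_
  rw [ContinuousMultilinearMap.map_smul_univ]
  rfl

theorem abs_kerEntry_le (m : ℕ) (o : Option (Fin (m + 2))) {k : ℕ}
    (l : Fin k → Fin (m + 2)) (z : EuclideanSpace ℝ (Fin (m + 2))) :
    |kerEntry m o l z| ≤ ‖iteratedFDeriv ℝ k (newtonKer m o) z‖ := by
  refine ((iteratedFDeriv ℝ k (newtonKer m o) z).le_opNorm _).trans ?_
  simp

theorem ContinuousOn.aestronglyMeasurable_comp_sub {d : ℕ}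
    {G : EuclideanSpace ℝ (Fin (d + 1)) → ℝ} (h : ContinuousOn G {0}ᶜ)
    (x : EuclideanSpace ℝ (Fin (d + 1))) :
    AEStronglyMeasurable (fun y => G (x - y)) volume := by
  have h1 : ContinuousOn (fun y => G (x - y)) {x}ᶜ :=
    h.comp (by fun_prop) fun y hy => by simpa [sub_eq_zero, eq_comm] using hy
  have h2 := h1.aestronglyMeasurable (measurableSet_singleton x).compl (μ := volume)
  rwa [restrict_compl_singleton] at h2

theorem continuousOn_newtonKer (m : ℕ) (o : Option (Fin (m + 2))) :
    ContinuousOn (newtonKer m o) {0}ᶜ := fun _ hz =>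
  (contDiffAt_newtonKer m o hz).continuousAt.continuousWithinAt

theorem continuousOn_kerEntry (m : ℕ) (o : Option (Fin (m + 2))) {k : ℕ}
    (l : Fin k → Fin (m + 2)) : ContinuousOn (kerEntry m o l) {0}ᶜ := by
  intro _ hz
  have h1 : ContDiffAt ℝ (k : WithTop ℕ∞) (newtonKer m o) _ :=
    (contDiffAt_newtonKer m o hz).of_le le_top
  have h := h1.continuousAt_iteratedFDeriv le_rfl
  exact (ContinuousAt.eval_const h _).continuousWithinAt

/-- The integral of the kernel `kap m` over the unit ball. -/
noncomputable def kapMass (m : ℕ) : ℝ :=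
  ∫ y in Metric.ball (0 : EuclideanSpace ℝ (Fin (m + 2))) 1, kap m y

theorem setIntegral_kap_ball (m : ℕ) {R : ℝ} (hR : 0 ≤ R) :
    ∫ y in Metric.ball (0 : EuclideanSpace ℝ (Fin (m + 2))) R, kap m y = kapMass m * R := by
  obtain ⟨S, -, h⟩ := exists_setIntegral_kap_ball_eq m
  rcases hR.eq_or_lt with rfl | hR
  · simp
  · rw [h R hR, kapMass, h 1 one_pos, mul_one]

theorem kapMass_pos (m : ℕ) : 0 < kapMass m := by
  obtain ⟨S, hS, h⟩ := exists_setIntegral_kap_ball_eq m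
  rw [kapMass, h 1 one_pos, mul_one]; exact hS

theorem ball_zero_subset_ball {E : Type*} [SeminormedAddCommGroup E] (x : E) (R : ℝ) :
    Metric.ball 0 R ⊆ Metric.ball x (R + ‖x‖) := by
  intro y hy
  rw [mem_ball_zero_iff] at hy
  rw [mem_ball_iff_norm]
  linarith [norm_sub_le y x]

theorem integrableOn_kap_sub_ball_zero (m : ℕ) (x : EuclideanSpace ℝ (Fin (m + 2))) (R : ℝ) :
    IntegrableOn (fun y => kap m (x - y)) (Metric.ball 0 R) :=
  (integrableOn_kap_sub m x (R + ‖x‖)).mono_set (ball_zero_subset_ball x R)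

theorem setIntegral_kap_sub_ball_zero_le (m : ℕ) (x : EuclideanSpace ℝ (Fin (m + 2))) {R : ℝ}
    (hR : 0 ≤ R) :
    ∫ y in Metric.ball 0 R, kap m (x - y) ≤ kapMass m * (R + ‖x‖) := by
  rw [← setIntegral_kap_ball m (by positivity : 0 ≤ R + ‖x‖), ← setIntegral_kap_sub m x]
  exact setIntegral_mono_set (integrableOn_kap_sub m x _)
    (Filter.Eventually.of_forall fun y => kap_nonneg m _)
    (ball_zero_subset_ball x R).eventuallyLE

/-- The moments of `f` against the entries of the derivative tensors of the kernels. -/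
noncomputable def kerMoment (m : ℕ) (o : Option (Fin (m + 2)))
    (f : EuclideanSpace ℝ (Fin (m + 2)) → ℝ) {k : ℕ} (l : Fin k → Fin (m + 2)) : ℝ :=
  ∫ y, kerEntry m o l (0 - y) * f y

theorem integrable_of_abs_le_kap {m : ℕ} {f : EuclideanSpace ℝ (Fin (m + 2)) → ℝ}
    (hf : AEStronglyMeasurable f volume) (x : EuclideanSpace ℝ (Fin (m + 2))) (C R : ℝ)
    (h : ∀ y, y ≠ x → |f y| ≤ C * kap m (x - y))
    (hR : ∀ y, R ≤ ‖y‖ → f y = 0) : Integrable f := by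
  have hs : Function.support f ⊆ Metric.ball 0 R := by
    intro y hy
    by_contra h'
    exact hy (hR y (by simpa using h'))
  rw [← integrableOn_iff_integrable_of_support_subset hs]
  refine Integrable.mono' ((integrableOn_kap_sub_ball_zero m x R).const_mul C) hf.restrict ?_
  filter_upwards [ae_restrict_of_ae (ae_ne x)] with y hy using h y hy

section Expansion

variable {m k : ℕ} {o : Option (Fin (m + 2))} {f : EuclideanSpace ℝ (Fin (m + 2)) → ℝ}
  {A M B ρ : ℝ}

theorem integrable_kerEntry_mul (hA : 1 ≤ A)
    (hbd : ∀ j : ℕ, ∀ z : EuclideanSpace ℝ (Fin (m + 2)), z ≠ 0 → ‖z‖ ≤ 1 →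
      ‖iteratedFDeriv ℝ j (newtonKer m o) z‖
        ≤ A ^ (j + 1) * j.factorial * (‖z‖ ^ (m + 1 + j))⁻¹)
    (hfm : AEStronglyMeasurable f volume) (hρ : ρ ≤ 1 / 2) (hM : 0 ≤ M)
    (hf : ∀ y, |f y| ≤ M * ‖y‖ ^ k) (hf0 : ∀ y, ρ ≤ ‖y‖ → f y = 0)
    {j : ℕ} (hj : j ≤ k) (l : Fin j → Fin (m + 2)) :
    Integrable fun y => kerEntry m o l (0 - y) * f y := by
  refine integrable_of_abs_le_kap
    (((continuousOn_kerEntry m o l).aestronglyMeasurable_comp_sub 0).mul hfm) 0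
    (A ^ (j + 1) * j.factorial * M) ρ (fun y hy => ?_) fun y hy => by rw [hf0 y hy, mul_zero]
  rcases le_or_gt ρ ‖y‖ with h | h
  · rw [hf0 y h, mul_zero, abs_zero]
    have := kap_nonneg m (0 - y)
    positivity
  have hn : 0 < ‖y‖ := norm_pos_iff.2 hy
  have h1 := (abs_kerEntry_le m o l (0 - y)).trans
    (hbd j (0 - y) (by simpa using hy) (by simp; linarith))
  rw [abs_mul]
  refine (mul_le_mul h1 (hf y) (abs_nonneg _) (by positivity)).trans ?_
  rw [zero_sub, norm_neg, kap_neg, kap, pow_add ‖y‖, mul_inv]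
  have h2 : (‖y‖ ^ j)⁻¹ * ‖y‖ ^ k ≤ 1 := by
    rw [inv_mul_le_iff₀ (by positivity), mul_one]
    exact pow_le_pow_of_le_one hn.le (by linarith) hj
  calc A ^ (j + 1) * j.factorial * ((‖y‖ ^ (m + 1))⁻¹ * (‖y‖ ^ j)⁻¹) * (M * ‖y‖ ^ k)
      = A ^ (j + 1) * j.factorial * M * (‖y‖ ^ (m + 1))⁻¹ * ((‖y‖ ^ j)⁻¹ * ‖y‖ ^ k) := by ring
    _ ≤ A ^ (j + 1) * j.factorial * M * (‖y‖ ^ (m + 1))⁻¹ * 1 := by gcongr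
    _ = _ := mul_one _

theorem integrable_newtonKer_mul 
    (hbd : ∀ j : ℕ, ∀ z : EuclideanSpace ℝ (Fin (m + 2)), z ≠ 0 → ‖z‖ ≤ 1 →
      ‖iteratedFDeriv ℝ j (newtonKer m o) z‖
        ≤ A ^ (j + 1) * j.factorial * (‖z‖ ^ (m + 1 + j))⁻¹)
    (hA : 1 ≤ A) (hfm : AEStronglyMeasurable f volume) (hρ : ρ ≤ 1 / 2) (hM : 0 ≤ M)
    (hf : ∀ y, |f y| ≤ M) (hf0 : ∀ y, ρ ≤ ‖y‖ → f y = 0)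
    {x : EuclideanSpace ℝ (Fin (m + 2))} (hx : ‖x‖ ≤ ρ) :
    Integrable fun y => newtonKer m o (x - y) * f y := by
  refine integrable_of_abs_le_kap
    (((continuousOn_newtonKer m o).aestronglyMeasurable_comp_sub x).mul hfm) x
    (A * M) ρ (fun y hy => ?_) fun y hy => by rw [hf0 y hy, mul_zero]
  rcases le_or_gt ρ ‖y‖ with h | h
  · rw [hf0 y h, mul_zero, abs_zero]
    have := kap_nonneg m (x - y)
    positivity
  have h1 := hbd 0 (x - y) (sub_ne_zero.2 hy.symm) (by linarith [norm_sub_le x y])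
  simp only [norm_iteratedFDeriv_zero, Real.norm_eq_abs] at h1
  rw [abs_mul]
  refine (mul_le_mul h1 (hf y) (abs_nonneg _) (by positivity)).trans (le_of_eq ?_)
  simp [kap]; ring

theorem abs_newtonKer_sub_taylor_le_near (hA : 1 ≤ A)
    (hbd : ∀ j : ℕ, ∀ z : EuclideanSpace ℝ (Fin (m + 2)), z ≠ 0 → ‖z‖ ≤ 1 →
      ‖iteratedFDeriv ℝ j (newtonKer m o) z‖
        ≤ A ^ (j + 1) * j.factorial * (‖z‖ ^ (m + 1 + j))⁻¹)
    (hM : 0 ≤ M) (hf : ∀ y, |f y| ≤ M * ‖y‖ ^ k)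
    {x y : EuclideanSpace ℝ (Fin (m + 2))} (hx : ‖x‖ ≤ 1 / 2) (hy1 : ‖y‖ ≤ 1 / 2)
    (hy : y ≠ 0) (hyx : y ≠ x) (h : ‖y‖ < 2 * ‖x‖) :
    |newtonKer m o (x - y) * f y - ∑ j ∈ Finset.range (k + 1), (j.factorial : ℝ)⁻¹ *
      (iteratedFDeriv ℝ j (newtonKer m o) (0 - y) (fun _ => x) * f y)|
      ≤ A ^ (k + 1) * 4 ^ k * M * ‖x‖ ^ k * (kap m (x - y) + kap m y) := by
  have hn : 0 < ‖y‖ := norm_pos_iff.2 hy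
  have hfy : |f y| ≤ M * (2 ^ k * ‖x‖ ^ k) := by
    refine (hf y).trans ?_
    rw [← mul_pow]
    gcongr
  have e1 : |newtonKer m o (x - y) * f y| ≤ A ^ (k + 1) * 4 ^ k * M * ‖x‖ ^ k * kap m (x - y) := by
    have h1 := hbd 0 (x - y) (sub_ne_zero.2 hyx.symm) (by linarith [norm_sub_le x y])
    simp only [norm_iteratedFDeriv_zero, Real.norm_eq_abs] at h1
    have h2 : |newtonKer m o (x - y)| ≤ A ^ (k + 1) * kap m (x - y) := by
      refine h1.trans ?_
      have : A ≤ A ^ (k + 1) := le_self_pow₀ hA (by omega)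
      have := kap_nonneg m (x - y)
      simp only [zero_add, pow_one, Nat.factorial_zero, Nat.cast_one, mul_one, add_zero]
      rw [kap] at *
      gcongr
    rw [abs_mul]
    calc |newtonKer m o (x - y)| * |f y|
        ≤ (A ^ (k + 1) * kap m (x - y)) * (M * (2 ^ k * ‖x‖ ^ k)) := by
          have := kap_nonneg m (x - y)
          gcongr
      _ ≤ (A ^ (k + 1) * kap m (x - y)) * (M * (4 ^ k * ‖x‖ ^ k)) := by
          have := kap_nonneg m (x - y)
          gcongr
          norm_num
      _ = _ := by ring
  have e2 : ∀ j ∈ Finset.range (k + 1), |(j.factorial : ℝ)⁻¹ *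
      (iteratedFDeriv ℝ j (newtonKer m o) (0 - y) (fun _ => x) * f y)|
      ≤ A ^ (k + 1) * 2 ^ k * M * ‖x‖ ^ k * kap m y := by
    intro j hj
    have hjk : j ≤ k := by simpa [Nat.lt_succ_iff] using hj
    have hfac : (0 : ℝ) < j.factorial := by exact_mod_cast j.factorial_pos
    have h1 : |iteratedFDeriv ℝ j (newtonKer m o) (0 - y) (fun _ => x)| ≤
        A ^ (j + 1) * j.factorial * (‖y‖ ^ (m + 1 + j))⁻¹ * ‖x‖ ^ j := by
      refine ((iteratedFDeriv ℝ j (newtonKer m o) (0 - y)).le_opNorm _).trans ?_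
      have := hbd j (0 - y) (by simpa using hy) (by simp; linarith)
      rw [zero_sub, norm_neg] at this
      simp only [Finset.prod_const, Finset.card_univ, Fintype.card_fin, zero_sub]
      gcongr
    have h3 : (‖y‖ ^ j)⁻¹ * ‖y‖ ^ k * ‖x‖ ^ j ≤ 2 ^ k * ‖x‖ ^ k := by
      obtain ⟨i, rfl⟩ := Nat.exists_eq_add_of_le hjk
      rw [pow_add ‖y‖, inv_mul_cancel_left₀ (by positivity)]
      calc ‖y‖ ^ i * ‖x‖ ^ j ≤ (2 * ‖x‖) ^ i * ‖x‖ ^ j := by gcongr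
        _ = 2 ^ i * ‖x‖ ^ (j + i) := by ring
        _ ≤ 2 ^ (j + i) * ‖x‖ ^ (j + i) := by
          gcongr
          · norm_num
          · exact Nat.le_add_left i j
    rw [abs_mul, abs_mul, abs_inv, Nat.abs_cast]
    calc (j.factorial : ℝ)⁻¹ *
          (|iteratedFDeriv ℝ j (newtonKer m o) (0 - y) (fun _ => x)| * |f y|)
        ≤ (j.factorial : ℝ)⁻¹ * (A ^ (j + 1) * j.factorial * (‖y‖ ^ (m + 1 + j))⁻¹ * ‖x‖ ^ j
          * (M * ‖y‖ ^ k)) := by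
          have := hf y
          gcongr
      _ = A ^ (j + 1) * M * kap m y * ((‖y‖ ^ j)⁻¹ * ‖y‖ ^ k * ‖x‖ ^ j) := by
          rw [kap, pow_add ‖y‖ (m + 1) j]; field_simp
      _ ≤ A ^ (k + 1) * M * kap m y * (2 ^ k * ‖x‖ ^ k) := by
          have := kap_nonneg m y
          gcongr
      _ = _ := by ring
  have e3 : |∑ j ∈ Finset.range (k + 1), (j.factorial : ℝ)⁻¹ *
      (iteratedFDeriv ℝ j (newtonKer m o) (0 - y) (fun _ => x) * f y)|
      ≤ A ^ (k + 1) * 4 ^ k * M * ‖x‖ ^ k * kap m y := by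
    refine (Finset.abs_sum_le_sum_abs _ _).trans ((Finset.sum_le_sum e2).trans ?_)
    rw [Finset.sum_const, Finset.card_range, nsmul_eq_mul]
    have h4 : ((k + 1 : ℕ) : ℝ) ≤ 2 ^ k := by exact_mod_cast Nat.lt_two_pow_self
    have := kap_nonneg m y
    calc ((k + 1 : ℕ) : ℝ) * (A ^ (k + 1) * 2 ^ k * M * ‖x‖ ^ k * kap m y)
        ≤ 2 ^ k * (A ^ (k + 1) * 2 ^ k * M * ‖x‖ ^ k * kap m y) := by gcongr
      _ = A ^ (k + 1) * (2 ^ k * 2 ^ k) * M * ‖x‖ ^ k * kap m y := by ring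
      _ = _ := by rw [← mul_pow]; norm_num
  rw [mul_add]
  exact (abs_sub _ _).trans (add_le_add e1 e3)

theorem abs_newtonKer_sub_taylor_le_far (hB : 0 ≤ B)
    (hf1 : ∀ y z : EuclideanSpace ℝ (Fin (m + 2)), z ≠ 0 → ‖z‖ ≤ 1 → ‖y‖ ≤ 2 * ‖z‖ → y ≠ 0 →
      ‖iteratedFDeriv ℝ (k + 1) (newtonKer m o) z‖ * |f y| ≤ B * (k + 1).factorial * kap m y)
    {x y : EuclideanSpace ℝ (Fin (m + 2))} (hx : ‖x‖ ≤ 1 / 2) (hy1 : ‖y‖ ≤ 1 / 2)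
    (hy : y ≠ 0) (h : 2 * ‖x‖ ≤ ‖y‖) :
    |newtonKer m o (x - y) * f y - ∑ j ∈ Finset.range (k + 1), (j.factorial : ℝ)⁻¹ *
      (iteratedFDeriv ℝ j (newtonKer m o) (0 - y) (fun _ => x) * f y)|
      ≤ 2 ^ (k + 1) * B * ‖x‖ ^ (k + 1) * kap m y := by
  have hn : 0 < ‖y‖ := norm_pos_iff.2 hy
  have hfac : (0 : ℝ) < k.factorial := by exact_mod_cast k.factorial_pos
  have hseg : ∀ t ∈ Set.Icc (0 : ℝ) 1, ‖y‖ ≤ 2 * ‖(0 - y) + t • x‖ ∧ ‖(0 - y) + t • x‖ ≤ 1 := by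
    intro t ht
    have h1 : ‖t • x‖ ≤ ‖x‖ := by
      rw [norm_smul, Real.norm_of_nonneg ht.1]
      exact mul_le_of_le_one_left (norm_nonneg _) ht.2
    have h2 := norm_sub_norm_le y (t • x)
    have h3 := norm_sub_le y (t • x)
    have h4 : ‖(0 - y) + t • x‖ = ‖y - t • x‖ := by
      rw [← norm_neg]; congr 1; abel
    rw [h4]
    constructor <;> linarith
  have hne : ∀ t ∈ Set.Icc (0 : ℝ) 1, (0 - y) + t • x ≠ 0 := by
    intro t ht h0
    have := (hseg t ht).1
    rw [h0, norm_zero] at this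
    linarith
  have ht := map_add_eq_sum_add_integral_iteratedFDeriv (f := newtonKer m o) (x := 0 - y) (y := x)
    (n := k) fun t ht => (contDiffAt_newtonKer m o (hne t ht)).of_le le_top
  rw [show (0 - y) + x = x - y by abel] at ht
  have e : newtonKer m o (x - y) * f y - ∑ j ∈ Finset.range (k + 1), (j.factorial : ℝ)⁻¹ *
      (iteratedFDeriv ℝ j (newtonKer m o) (0 - y) (fun _ => x) * f y)
      = (k.factorial : ℝ)⁻¹ * (∫ t in (0 : ℝ)..1, (1 - t) ^ k •
        iteratedFDeriv ℝ (k + 1) (newtonKer m o) ((0 - y) + t • x) (fun _ => x)) * f y := by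
    rw [ht, add_mul, Finset.sum_mul]
    simp only [smul_eq_mul, mul_assoc]
    ring
  rw [e]
  by_cases hfy : f y = 0
  · rw [hfy, mul_zero, abs_zero]
    have := kap_nonneg m y
    positivity
  have hfy' : 0 < |f y| := abs_pos.2 hfy
  have hintg : ‖∫ t in (0 : ℝ)..1, (1 - t) ^ k •
        iteratedFDeriv ℝ (k + 1) (newtonKer m o) ((0 - y) + t • x) (fun _ => x)‖
      ≤ (B * (k + 1).factorial * kap m y / |f y| * ‖x‖ ^ (k + 1)) * |1 - 0| := by
    refine intervalIntegral.norm_integral_le_of_norm_le_const fun t ht => ?_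
    rw [Set.uIoc_of_le zero_le_one] at ht
    have ht' : t ∈ Set.Icc (0 : ℝ) 1 := ⟨ht.1.le, ht.2⟩
    have h1 := hf1 y _ (hne t ht') (hseg t ht').2 (hseg t ht').1 hy
    rw [← le_div_iff₀ hfy'] at h1
    rw [norm_smul]
    have h2 : ‖(1 - t) ^ k‖ ≤ 1 := by
      rw [norm_pow, Real.norm_of_nonneg (by linarith [ht'.2])]
      exact pow_le_one₀ (by linarith [ht'.2]) (by linarith [ht'.1])
    have h3 := (iteratedFDeriv ℝ (k + 1) (newtonKer m o) ((0 - y) + t • x)).le_opNorm (fun _ => x)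
    simp only [Finset.prod_const, Finset.card_univ, Fintype.card_fin] at h3
    calc _ ≤ 1 * (‖iteratedFDeriv ℝ (k + 1) (newtonKer m o) ((0 - y) + t • x)‖ * ‖x‖ ^ (k + 1)) :=
          mul_le_mul h2 h3 (norm_nonneg _) zero_le_one
      _ ≤ _ := by rw [one_mul]; gcongr
  rw [sub_zero, abs_one, mul_one, Real.norm_eq_abs] at hintg
  rw [abs_mul, abs_mul, abs_inv, Nat.abs_cast]
  have h4 : ((k + 1 : ℕ) : ℝ) ≤ 2 ^ (k + 1) := by exact_mod_cast Nat.lt_two_pow_self.le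
  have := kap_nonneg m y
  calc _ ≤ (k.factorial : ℝ)⁻¹ *
        (B * (k + 1).factorial * kap m y / |f y| * ‖x‖ ^ (k + 1)) * |f y| := by
        gcongr
    _ = ((k + 1 : ℕ) : ℝ) * B * ‖x‖ ^ (k + 1) * kap m y := by
        rw [Nat.factorial_succ]; push_cast; field_simp
    _ ≤ _ := by gcongr

end Expansion

theorem abs_integral_newtonKer_sub_moments_le {m k : ℕ} {o : Option (Fin (m + 2))}
    {f : EuclideanSpace ℝ (Fin (m + 2)) → ℝ} {A M B ρ : ℝ} (hA : 1 ≤ A)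
    (hbd : ∀ j : ℕ, ∀ z : EuclideanSpace ℝ (Fin (m + 2)), z ≠ 0 → ‖z‖ ≤ 1 →
      ‖iteratedFDeriv ℝ j (newtonKer m o) z‖
        ≤ A ^ (j + 1) * j.factorial * (‖z‖ ^ (m + 1 + j))⁻¹)
    (hfm : AEStronglyMeasurable f volume) (hρ : ρ ≤ 1 / 2) (hM : 0 ≤ M) (hB : 0 ≤ B)
    (hf : ∀ y, |f y| ≤ M * ‖y‖ ^ k) (hf0 : ∀ y, ρ ≤ ‖y‖ → f y = 0)
    (hf1 : ∀ y z : EuclideanSpace ℝ (Fin (m + 2)), z ≠ 0 → ‖z‖ ≤ 1 → ‖y‖ ≤ 2 * ‖z‖ → y ≠ 0 →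
      ‖iteratedFDeriv ℝ (k + 1) (newtonKer m o) z‖ * |f y| ≤ B * (k + 1).factorial * kap m y)
    {x : EuclideanSpace ℝ (Fin (m + 2))} (hx : ‖x‖ ≤ ρ) :
    |(∫ y, newtonKer m o (x - y) * f y) - ∑ j ∈ Finset.range (k + 1), (j.factorial : ℝ)⁻¹ *
      ∑ l : Fin j → Fin (m + 2), (∏ i, x (l i)) * kerMoment m o f l|
      ≤ kapMass m * (8 * A) ^ (k + 1) * (M + B) * ‖x‖ ^ (k + 1) := by
  have hρ0 : 0 ≤ ρ := (norm_nonneg x).trans hx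
  have hfM : ∀ y, |f y| ≤ M := by
    intro y
    rcases le_or_gt ρ ‖y‖ with h | h
    · rw [hf0 y h, abs_zero]; exact hM
    · exact (hf y).trans (mul_le_of_le_one_right hM
        (pow_le_one₀ (norm_nonneg y) (by linarith)))
  have hi1 := integrable_newtonKer_mul hbd hA hfm hρ hM hfM hf0 hx
  have hi2 : ∀ j ∈ Finset.range (k + 1), ∀ l : Fin j → Fin (m + 2),
      Integrable fun y => kerEntry m o l (0 - y) * f y := fun j hj l =>
    integrable_kerEntry_mul hA hbd hfm hρ hM hf hf0 (by simpa [Nat.lt_succ_iff] using hj) l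
  have hdiag : ∀ j y, iteratedFDeriv ℝ j (newtonKer m o) (0 - y) (fun _ => x) * f y
      = ∑ l : Fin j → Fin (m + 2), (∏ i, x (l i)) * (kerEntry m o l (0 - y) * f y) := by
    intro j y
    rw [iteratedFDeriv_newtonKer_diag, Finset.sum_mul]
    exact Finset.sum_congr rfl fun l _ => mul_assoc _ _ _
  have hi3 : ∀ j ∈ Finset.range (k + 1), Integrable fun y => (j.factorial : ℝ)⁻¹ *
      (iteratedFDeriv ℝ j (newtonKer m o) (0 - y) (fun _ => x) * f y) := by
    intro j hj
    simp only [hdiag]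
    exact (integrable_finsetSum _ fun l _ => (hi2 j hj l).const_mul _).const_mul _
  have heq : (∫ y, newtonKer m o (x - y) * f y) - ∑ j ∈ Finset.range (k + 1),
      (j.factorial : ℝ)⁻¹ * ∑ l : Fin j → Fin (m + 2), (∏ i, x (l i)) * kerMoment m o f l
      = ∫ y, (newtonKer m o (x - y) * f y - ∑ j ∈ Finset.range (k + 1), (j.factorial : ℝ)⁻¹ *
      (iteratedFDeriv ℝ j (newtonKer m o) (0 - y) (fun _ => x) * f y)) := by
    rw [integral_sub hi1 (integrable_finsetSum _ hi3), integral_finsetSum _ hi3]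
    congr 1
    refine Finset.sum_congr rfl fun j hj => ?_
    rw [integral_const_mul]
    simp only [hdiag]
    rw [integral_finsetSum _ fun l _ => (hi2 j hj l).const_mul _]
    simp only [integral_const_mul]
    rfl
  rw [heq]
  set C1 := A ^ (k + 1) * 4 ^ k * M * ‖x‖ ^ k with hC1
  set C2 := 2 ^ (k + 1) * B * ‖x‖ ^ (k + 1) with hC2
  have hC1' : 0 ≤ C1 := by positivity
  have hC2' : 0 ≤ C2 := by positivity
  have hk1 := integrableOn_kap_sub_ball_zero m x (2 * ‖x‖)
  have hk2 := integrableOn_kap_ball m (2 * ‖x‖)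
  have hk3 := integrableOn_kap_ball m ρ
  have hg1 : Integrable ((Metric.ball 0 (2 * ‖x‖)).indicator
      fun y => C1 * (kap m (x - y) + kap m y)) :=
    (integrable_indicator_iff measurableSet_ball).2 ((hk1.add hk2).const_mul C1)
  have hg2 : Integrable ((Metric.ball 0 ρ).indicator fun y => C2 * kap m y) :=
    (integrable_indicator_iff measurableSet_ball).2 (hk3.const_mul C2)
  rw [← Real.norm_eq_abs]
  refine (norm_integral_le_of_norm_le (hg1.add hg2) ?_).trans ?_
  · filter_upwards [ae_ne (0 : EuclideanSpace ℝ (Fin (m + 1 + 1))), ae_ne x] with y hy hyx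
    have p1 := kap_nonneg m y
    have p2 := kap_nonneg m (x - y)
    rw [Real.norm_eq_abs, Pi.add_apply]
    rcases le_or_gt ρ ‖y‖ with h | h
    · rw [hf0 y h]
      simp only [mul_zero, Finset.sum_const_zero, sub_zero, abs_zero]
      exact add_nonneg (Set.indicator_nonneg (fun y _ => mul_nonneg hC1'
        (add_nonneg (kap_nonneg _ _) (kap_nonneg _ _))) _)
        (Set.indicator_nonneg (fun y _ => mul_nonneg hC2' (kap_nonneg _ _)) _)
    · have h2 : y ∈ Metric.ball (0 : EuclideanSpace ℝ (Fin (m + 2))) ρ := by simpa using h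
      rw [Set.indicator_of_mem h2]
      rcases lt_or_ge ‖y‖ (2 * ‖x‖) with h1 | h1
      · rw [Set.indicator_of_mem (by simpa using h1)]
        have := abs_newtonKer_sub_taylor_le_near hA hbd hM hf (by linarith) (by linarith) hy hyx h1
        have h3 := mul_nonneg hC2' p1
        linarith
      · rw [Set.indicator_of_notMem (by simpa using h1), zero_add]
        exact abs_newtonKer_sub_taylor_le_far hB hf1 (by linarith) (by linarith) hy h1
  · have hS := kapMass_pos m
    have hx0 := norm_nonneg x
    have i1 : ∫ y, (Metric.ball 0 (2 * ‖x‖)).indicator (fun y => C1 * (kap m (x - y) + kap m y)) y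
        ≤ C1 * (kapMass m * (5 * ‖x‖)) := by
      rw [integral_indicator measurableSet_ball, integral_const_mul, integral_add hk1 hk2,
        setIntegral_kap_ball m (by positivity)]
      have := setIntegral_kap_sub_ball_zero_le m x (R := 2 * ‖x‖) (by positivity)
      gcongr
      linarith
    have i2 : ∫ y, (Metric.ball 0 ρ).indicator (fun y => C2 * kap m y) y
        ≤ C2 * (kapMass m * 1) := by
      rw [integral_indicator measurableSet_ball, integral_const_mul, setIntegral_kap_ball m hρ0]
      gcongr
      linarith
    rw [integral_add' hg1 hg2]
    refine (add_le_add i1 i2).trans ?_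
    have hA1 : 1 ≤ A ^ (k + 1) := one_le_pow₀ hA
    have h2 : (2 : ℝ) ^ (k + 1) ≤ 8 ^ (k + 1) * A ^ (k + 1) := by
      calc (2 : ℝ) ^ (k + 1) ≤ 8 ^ (k + 1) * 1 := by rw [mul_one]; gcongr; norm_num
        _ ≤ _ := by gcongr
    have h3 : (5 : ℝ) * 4 ^ k ≤ 8 ^ (k + 1) := by
      rw [pow_succ, mul_comm]; gcongr <;> norm_num
    calc C1 * (kapMass m * (5 * ‖x‖)) + C2 * (kapMass m * 1)
        = kapMass m * ‖x‖ ^ (k + 1) * ((5 * 4 ^ k) * A ^ (k + 1) * M + 2 ^ (k + 1) * B) := by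
          rw [hC1, hC2]; ring
      _ ≤ kapMass m * ‖x‖ ^ (k + 1) * (8 ^ (k + 1) * A ^ (k + 1) * M
          + 8 ^ (k + 1) * A ^ (k + 1) * B) := by gcongr
      _ = _ := by rw [mul_pow]; ring

section Calculus

variable {d : ℕ} {f g : EuclideanSpace ℝ (Fin d) → ℝ}

theorem ContDiff.partialD {n : WithTop ℕ∞} (hf : ContDiff ℝ (n + 1) f) (i : Fin d) :
    ContDiff ℝ n (partialD i f) :=
  (hf.fderiv_right le_rfl).clm_apply contDiff_const

theorem HasCompactSupport.partialD (hf : HasCompactSupport f) (i : Fin d) :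
    HasCompactSupport (partialD i f) :=
  hf.fderiv_apply (𝕜 := ℝ) _

theorem ContDiff.continuous_lap (hf : ContDiff ℝ 2 f) : Continuous (lap f) := by
  refine continuous_finsetSum _ fun i _ => ?_
  exact (((ContDiff.partialD (n := 1) (by simpa [one_add_one_eq_two] using hf) i).partialD (n := 0)
    i)).continuous

theorem partialD_mul {x : EuclideanSpace ℝ (Fin d)} (hf : DifferentiableAt ℝ f x)
    (hg : DifferentiableAt ℝ g x) (i : Fin d) :
    partialD i (fun y => f y * g y) x = f x * partialD i g x + g x * partialD i f x := by
  simp [partialD, fderiv_fun_mul hf hg]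

theorem partialD_add {x : EuclideanSpace ℝ (Fin d)} (hf : DifferentiableAt ℝ f x)
    (hg : DifferentiableAt ℝ g x) (i : Fin d) :
    partialD i (fun y => f y + g y) x = partialD i f x + partialD i g x := by
  simp [partialD, fderiv_fun_add hf hg]

theorem lap_mul (hf : ContDiff ℝ 2 f) (hg : ContDiff ℝ 2 g) (x : EuclideanSpace ℝ (Fin d)) :
    lap (fun y => f y * g y) x =
      f x * lap g x + 2 * ∑ i, partialD i f x * partialD i g x + g x * lap f x := by
  have hfd := hf.differentiable (by norm_num)
  have hgd := hg.differentiable (by norm_num)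
  have hf1 := fun i => (ContDiff.partialD (n := 1) (by simpa [one_add_one_eq_two] using hf)
    i).differentiable (by norm_num)
  have hg1 := fun i => (ContDiff.partialD (n := 1) (by simpa [one_add_one_eq_two] using hg)
    i).differentiable (by norm_num)
  have h : ∀ i, partialD i (fun y => f y * g y)
      = fun y => f y * partialD i g y + g y * partialD i f y := fun i =>
    funext fun y => partialD_mul (hfd y) (hgd y) i
  simp only [lap_eq_sum_partialD, Finset.mul_sum, ← Finset.sum_add_distrib]
  refine Finset.sum_congr rfl fun i _ => ?_
  rw [h i]
  rw [partialD_add ((hfd x).fun_mul (hg1 i x)) ((hgd x).fun_mul (hf1 i x)),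
    partialD_mul (hfd x) (hg1 i x), partialD_mul (hgd x) (hf1 i x)]
  ring

theorem partialD_comp_sub (x : EuclideanSpace ℝ (Fin d)) (i : Fin d)
    (f : EuclideanSpace ℝ (Fin d) → ℝ) :
    partialD i (fun y => f (x - y)) = fun y => -partialD i f (x - y) := by
  funext y
  have h : (fun y => f (x - y)) = fun y => (fun z => f (-z)) (y - x) := by
    funext y; simp
  rw [h]
  simp only [partialD]
  rw [fderiv_comp_sub (f := fun z => f (-z))]
  have := (ContinuousLinearEquiv.neg ℝ (M := EuclideanSpace ℝ (Fin d))).comp_right_fderiv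
    (f := f) (x := y - x)
  have h2 : (fun z => f (-z)) = f ∘ (ContinuousLinearEquiv.neg ℝ) := rfl
  rw [h2, this]
  simp

theorem lap_comp_sub (x : EuclideanSpace ℝ (Fin d)) (f : EuclideanSpace ℝ (Fin d) → ℝ)
    (y : EuclideanSpace ℝ (Fin d)) : lap (fun y => f (x - y)) y = lap f (x - y) := by
  simp only [lap_eq_sum_partialD]
  refine Finset.sum_congr rfl fun i _ => ?_
  rw [partialD_comp_sub, ← neg_neg (partialD i (partialD i f) (x - y))]
  have := congrFun (partialD_comp_sub x i (partialD i f)) y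
  rw [← this]
  simp only [partialD, fderiv_fun_neg]
  rfl

theorem integral_mul_partialD (hf : ContDiff ℝ 1 f) (hg : ContDiff ℝ 1 g)
    (hfc : HasCompactSupport f) (i : Fin d) :
    ∫ y, f y * partialD i g y = -∫ y, partialD i f y * g y := by
  have hf1 := (hf.partialD (n := 0) i).continuous
  have hg1 := (hg.partialD (n := 0) i).continuous
  exact integral_mul_fderiv_eq_neg_fderiv_mul_of_integrable
    ((hf1.mul hg.continuous).integrable_of_hasCompactSupport ((hfc.partialD i).mul_right))
    ((hf.continuous.mul hg1).integrable_of_hasCompactSupport hfc.mul_right)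
    ((hf.continuous.mul hg.continuous).integrable_of_hasCompactSupport hfc.mul_right)
    (fun x _ => hf.differentiable (by norm_num) x) (fun x _ => hg.differentiable (by norm_num) x)

theorem integral_mul_lap (hf : ContDiff ℝ 2 f) (hg : ContDiff ℝ 2 g)
    (hfc : HasCompactSupport f) : ∫ y, f y * lap g y = ∫ y, lap f y * g y := by
  have hf1 := fun i => ContDiff.partialD (n := 1) (by simpa [one_add_one_eq_two] using hf) i
  have hg1 := fun i => ContDiff.partialD (n := 1) (by simpa [one_add_one_eq_two] using hg) i
  have hf2 := fun i => ((hf1 i).partialD (n := 0) i).continuous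
  have hg2 := fun i => ((hg1 i).partialD (n := 0) i).continuous
  simp only [lap_eq_sum_partialD, Finset.mul_sum, Finset.sum_mul]
  have i1 : ∀ i, Integrable fun y => f y * partialD i (partialD i g) y := fun i =>
    (hf.continuous.mul (hg2 i)).integrable_of_hasCompactSupport hfc.mul_right
  have i2 : ∀ i, Integrable fun y => partialD i (partialD i f) y * g y := fun i =>
    ((hf2 i).mul hg.continuous).integrable_of_hasCompactSupport
      ((hfc.partialD i).partialD i).mul_right
  rw [integral_finsetSum _ fun i _ => i1 i, integral_finsetSum _ fun i _ => i2 i]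
  refine Finset.sum_congr rfl fun i _ => ?_
  rw [integral_mul_partialD (hf.of_le (by norm_num)) (hg1 i) hfc,
    integral_mul_partialD (hf1 i) (hg.of_le (by norm_num)) (hfc.partialD i), neg_neg]

end Calculus

theorem tendsto_integral_kernel_mul {m : ℕ} {G : ℝ → EuclideanSpace ℝ (Fin (m + 2)) → ℝ}
    {f : EuclideanSpace ℝ (Fin (m + 2)) → ℝ} {x : EuclideanSpace ℝ (Fin (m + 2))} {B : ℝ}
    (hGc : ∀ ε, ContinuousOn (G ε) {0}ᶜ)
    (hG : ∀ ε z, |ε| ≤ 1 → z ≠ 0 → ‖z‖ ≤ 1 → |G ε z| ≤ 2 * kap m z)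
    (hG0 : ∀ z, z ≠ 0 → ContinuousAt (fun ε => G ε z) 0)
    (hfm : AEStronglyMeasurable f volume) (hf : ∀ y, |f y| ≤ B)
    (hf0 : ∀ y, 1 < ‖x - y‖ → f y = 0) :
    Filter.Tendsto (fun c : ℝ => ∫ y, G c⁻¹ (x - y) * f y) Filter.atTop
      (nhds (∫ y, G 0 (x - y) * f y)) := by
  have hB : 0 ≤ B := (abs_nonneg _).trans (hf 0)
  refine tendsto_integral_filter_of_dominated_convergence
    ((Metric.ball x 2).indicator fun y => 2 * B * kap m (x - y)) ?_ ?_ ?_ ?_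
  · exact Filter.Eventually.of_forall fun c =>
      ((hGc c⁻¹).aestronglyMeasurable_comp_sub x).mul hfm
  · filter_upwards [Filter.eventually_ge_atTop 1] with c hc
    filter_upwards [ae_ne x] with y hy
    have hz : x - y ≠ 0 := sub_ne_zero.2 hy.symm
    rcases lt_or_ge 1 ‖x - y‖ with h | h
    · rw [hf0 y h, mul_zero, norm_zero]
      exact Set.indicator_nonneg (fun y _ => mul_nonneg (by positivity) (kap_nonneg _ _)) _
    · rw [Set.indicator_of_mem (by rw [mem_ball_iff_norm']; linarith), norm_mul,
        Real.norm_eq_abs, Real.norm_eq_abs]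
      have h1 := hG c⁻¹ (x - y) (by rw [abs_of_nonneg (by positivity)]; exact inv_le_one_of_one_le₀ hc)
        hz h
      have h2 := kap_nonneg m (x - y)
      calc _ ≤ 2 * kap m (x - y) * B := mul_le_mul h1 (hf y) (abs_nonneg _) (by positivity)
        _ = _ := by ring
  · exact (integrable_indicator_iff measurableSet_ball).2
      ((integrableOn_kap_sub m x 2).const_mul (2 * B))
  · filter_upwards [ae_ne x] with y hy
    exact ((hG0 _ (sub_ne_zero.2 hy.symm)).tendsto.comp tendsto_inv_atTop_zero).mul_const _

/-- The total mass of the Laplacian of the regularised Newtonian potential. -/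
noncomputable def newtonMass (m : ℕ) : ℝ :=
  ∫ z : EuclideanSpace ℝ (Fin (m + 2)), (1 + ‖z‖ ^ 2) ^ (-((m : ℝ) + 4) / 2)

theorem integrable_one_add_normSq_rpow (m : ℕ) :
    Integrable fun z : EuclideanSpace ℝ (Fin (m + 2)) =>
      (1 + ‖z‖ ^ 2) ^ (-((m : ℝ) + 4) / 2) :=
  integrable_rpow_neg_one_add_norm_sq (by simp; norm_num)

theorem newtonMass_pos (m : ℕ) : 0 < newtonMass m := by
  unfold newtonMass
  have hp : ∀ z : EuclideanSpace ℝ (Fin (m + 2)), 0 < (1 + ‖z‖ ^ 2) ^ (-((m : ℝ) + 4) / 2) :=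
    fun z => by positivity
  rw [integral_pos_iff_support_of_nonneg (fun z => (hp z).le) (integrable_one_add_normSq_rpow m)]
  rw [Function.support_eq_univ fun z => (hp z).ne']
  exact Measure.measure_univ_pos.2 (NeZero.ne _)

theorem lap_newton_inv (m : ℕ) {c : ℝ} (hc : 0 < c) (z : EuclideanSpace ℝ (Fin (m + 2))) :
    lap (newton m c⁻¹) z
      = (m + 2) * (c ^ (m + 2) * (1 + ‖c • z‖ ^ 2) ^ (-((m : ℝ) + 4) / 2)) := by
  rw [lap_newton m (by positivity), norm_smul, Real.norm_eq_abs, abs_of_pos hc]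
  have h : ‖z‖ ^ 2 + c⁻¹ ^ 2 = c⁻¹ ^ 2 * (1 + (c * ‖z‖) ^ 2) := by field_simp; ring
  rw [h, Real.mul_rpow (by positivity) (by positivity)]
  have h2 : (c⁻¹ ^ 2) ^ (-((m : ℝ) + 4) / 2) = c ^ (m + 4) := by
    rw [inv_pow, Real.inv_rpow (by positivity), ← Real.rpow_natCast c 2, ← Real.rpow_mul hc.le,
      ← Real.rpow_neg hc.le, ← Real.rpow_natCast]
    congr 1; push_cast; ring
  rw [h2]
  have h3 : c⁻¹ ^ 2 * c ^ (m + 4) = c ^ (m + 2) := by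
    rw [pow_add c m 4, pow_add c m 2]; field_simp
  rw [← h3]; ring

theorem tendsto_integral_lap_newton_mul {m : ℕ} {h : EuclideanSpace ℝ (Fin (m + 2)) → ℝ}
    {x : EuclideanSpace ℝ (Fin (m + 2))} (hh : Integrable h) (hc : ContinuousAt h x) :
    Filter.Tendsto (fun c : ℝ => ∫ y, lap (newton m c⁻¹) (x - y) * h y) Filter.atTop
      (nhds ((m + 2) * newtonMass m * h x)) := by
  have hM := newtonMass_pos m
  have key := tendsto_integral_comp_smul_smul_of_integrable' (μ := volume) (x₀ := x) (g := h)
    (φ := fun z : EuclideanSpace ℝ (Fin (m + 2)) =>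
      (newtonMass m)⁻¹ * (1 + ‖z‖ ^ 2) ^ (-((m : ℝ) + 4) / 2))
    (fun z => by positivity)
    (by rw [integral_const_mul]; exact inv_mul_cancel₀ hM.ne') ?_ hh hc
  · refine (key.const_mul ((m + 2) * newtonMass m)).congr' ?_
    filter_upwards [Filter.eventually_gt_atTop 0] with c hc
    rw [← integral_const_mul]
    refine integral_congr_ae (Filter.Eventually.of_forall fun y => ?_)
    simp only [lap_newton_inv m hc, finrank_euclideanSpace, Fintype.card_fin, smul_eq_mul]
    field_simp
  · have h0 : Filter.Tendsto (fun z : EuclideanSpace ℝ (Fin (m + 2)) =>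
        (newtonMass m)⁻¹ * (‖z‖ ^ 2)⁻¹) (Bornology.cobounded _) (nhds 0) := by
      have := ((Filter.tendsto_pow_atTop (α := ℝ) two_ne_zero).inv_tendsto_atTop.comp
        (tendsto_norm_cobounded_atTop (E := EuclideanSpace ℝ (Fin (m + 2))))).const_mul
        (newtonMass m)⁻¹
      simpa using this
    refine squeeze_zero' (Filter.Eventually.of_forall fun z => by positivity) ?_ h0
    filter_upwards [(tendsto_norm_cobounded_atTop
      (E := EuclideanSpace ℝ (Fin (m + 2)))).eventually_gt_atTop 0] with z hz
    have h1 := rpow_neg_half_le (m + 4) hz (show ‖z‖ ^ 2 ≤ 1 + ‖z‖ ^ 2 by linarith)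
    push_cast at h1
    rw [finrank_euclideanSpace, Fintype.card_fin]
    calc _ ≤ ‖z‖ ^ (m + 2) * ((newtonMass m)⁻¹ * (‖z‖ ^ (m + 4))⁻¹) := by gcongr
      _ = _ := by
        rw [pow_add ‖z‖ m 4, pow_add ‖z‖ m 2]; field_simp

theorem abs_apply_le_norm {d : ℕ} (z : EuclideanSpace ℝ (Fin d)) (i : Fin d) : |z i| ≤ ‖z‖ :=
  PiLp.norm_apply_le z i

theorem abs_partialD_newton_le (m : ℕ) (ε : ℝ) {z : EuclideanSpace ℝ (Fin (m + 2))} (hz : z ≠ 0)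
    (i : Fin (m + 2)) : |partialD i (newton m ε) z| ≤ kap m z := by
  have hn : 0 < ‖z‖ := norm_pos_iff.2 hz
  rw [partialD_newton m (by positivity), abs_mul, abs_of_nonneg (by positivity)]
  have h1 := rpow_neg_half_le (m + 2) hn (show ‖z‖ ^ 2 ≤ ‖z‖ ^ 2 + ε ^ 2 by nlinarith [sq_nonneg ε])
  push_cast at h1
  calc _ ≤ (‖z‖ ^ (m + 2))⁻¹ * ‖z‖ := by gcongr; exact abs_apply_le_norm z i
    _ = _ := by rw [kap, pow_succ ‖z‖ (m + 1)]; field_simp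

theorem abs_newtonKer_le (m : ℕ) (o : Option (Fin (m + 2))) {z : EuclideanSpace ℝ (Fin (m + 2))}
    (hz : z ≠ 0) (hz1 : ‖z‖ ≤ 1) : |newtonKer m o z| ≤ 2 * kap m z := by
  rcases o with _ | i
  · exact abs_newton_le m (by simp) hz hz1
  · exact (abs_partialD_newton_le m 0 hz i).trans (by linarith [kap_nonneg m z])

theorem continuousOn_newton (m : ℕ) (ε : ℝ) : ContinuousOn (newton m ε) {0}ᶜ := fun z hz =>
  (contDiffAt_newton m (by
    have : 0 < ‖z‖ := norm_pos_iff.2 hz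
    positivity)).continuousAt.continuousWithinAt

theorem continuousOn_partialD_newton (m : ℕ) (ε : ℝ) (i : Fin (m + 2)) :
    ContinuousOn (partialD i (newton m ε)) {0}ᶜ := by
  intro z hz
  have : 0 < ‖z‖ := norm_pos_iff.2 hz
  exact (contDiffAt_partialD (i := i) (contDiffAt_newton m (by positivity))).continuousAt.continuousWithinAt

theorem continuousAt_newton_param (m : ℕ) {z : EuclideanSpace ℝ (Fin (m + 2))} (hz : z ≠ 0) :
    ContinuousAt (fun ε => newton m ε z) 0 := by
  have : 0 < ‖z‖ := norm_pos_iff.2 hz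
  have h := (contDiffAt_newtonProfile m (s := ‖z‖ ^ 2 + 0 ^ 2) (by positivity)).continuousAt
  exact ContinuousAt.comp (f := fun ε : ℝ => ‖z‖ ^ 2 + ε ^ 2) h (by fun_prop)

theorem continuousAt_partialD_newton_param (m : ℕ) {z : EuclideanSpace ℝ (Fin (m + 2))}
    (hz : z ≠ 0) (i : Fin (m + 2)) : ContinuousAt (fun ε => partialD i (newton m ε) z) 0 := by
  have : 0 < ‖z‖ := norm_pos_iff.2 hz
  have h : (fun ε => partialD i (newton m ε) z)
      = fun ε => (‖z‖ ^ 2 + ε ^ 2) ^ (-((m : ℝ) + 2) / 2) * z i :=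
    funext fun ε => partialD_newton m (by positivity) i
  rw [h]
  refine ContinuousAt.mul (ContinuousAt.rpow_const (by fun_prop) (Or.inl ?_)) continuousAt_const
  positivity

theorem lap_congr {d : ℕ} {f g : EuclideanSpace ℝ (Fin d) → ℝ}
    {x : EuclideanSpace ℝ (Fin d)} (h : f =ᶠ[nhds x] g) : lap f x = lap g x := by
  simp only [lap_eq_sum_partialD]
  exact Finset.sum_congr rfl fun i _ =>
    partialD_congr (h.eventuallyEq_nhds.mono fun y hy => partialD_congr hy i) i

theorem partialD_const {d : ℕ} (a : ℝ) (i : Fin d) :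
    partialD i (fun _ : EuclideanSpace ℝ (Fin d) => a) = fun _ => 0 := by
  funext x; simp [partialD]

theorem lap_const {d : ℕ} (a : ℝ) (x : EuclideanSpace ℝ (Fin d)) :
    lap (fun _ : EuclideanSpace ℝ (Fin d) => a) x = 0 := by
  simp [lap_eq_sum_partialD, partialD_const]

theorem newton_representation {m : ℕ} {χ ψ : EuclideanSpace ℝ (Fin (m + 2)) → ℝ}
    (hχ : ContDiff ℝ 2 χ) (hψ : ContDiff ℝ 2 ψ) (hχc : HasCompactSupport χ)
    {x : EuclideanSpace ℝ (Fin (m + 2))} (hχx : ∀ y, 1 ≤ ‖x - y‖ → χ y = 0) :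
    (m + 2) * newtonMass m * (χ x * ψ x) =
      (∫ y, newtonKer m none (x - y) * (χ y * lap ψ y - lap χ y * ψ y))
      + ∑ i, ∫ y, newtonKer m (some i) (x - y) * (2 * partialD i χ y * ψ y) := by
  have hχ1 := fun i => ContDiff.partialD (n := 1) (by simpa [one_add_one_eq_two] using hχ) i
  have hχ0 := hχ.continuous
  have hψ0 := hψ.continuous
  have hlχ := hχ.continuous_lap
  have hlψ := hψ.continuous_lap
  have hlc : HasCompactSupport (lap χ) := by
    refine HasCompactSupport.of_support_subset_isCompact hχc fun y hy => ?_
    by_contra h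
    exact hy ((lap_congr (notMem_tsupport_iff_eventuallyEq.1 h)).trans (lap_const 0 y))
  have hev : ∀ y, 1 < ‖x - y‖ → χ =ᶠ[nhds y] fun _ => 0 := fun y hy =>
    (isOpen_lt (f := fun _ => (1 : ℝ)) (by fun_prop)
      (by fun_prop : Continuous fun y => ‖x - y‖)).mem_nhds hy |> fun h =>
      Filter.mem_of_superset h fun z (hz : 1 < ‖x - z‖) => hχx z hz.le
  have hF0 : Continuous fun y => χ y * lap ψ y - lap χ y * ψ y := by fun_prop
  have hFc : HasCompactSupport fun y => χ y * lap ψ y - lap χ y * ψ y :=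
    (hχc.mul_right (f' := lap ψ)).sub (hlc.mul_right (f' := ψ))
  have hG0 : ∀ i, Continuous fun y => 2 * partialD i χ y * ψ y := fun i => by
    have := (hχ1 i).continuous
    fun_prop
  have hGc : ∀ i, HasCompactSupport fun y => 2 * partialD i χ y * ψ y := fun i =>
    ((hχc.partialD i).mul_left (f := fun _ => (2 : ℝ))).mul_right
  obtain ⟨BF, hBF⟩ := hFc.exists_bound_of_continuous hF0
  have t1 := tendsto_integral_kernel_mul (m := m) (x := x) (G := newton m) (continuousOn_newton m)
    (fun ε z h1 h2 h3 => abs_newton_le m h1 h2 h3) (fun z hz => continuousAt_newton_param m hz)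
    hF0.aestronglyMeasurable hBF (fun y hy => by
      rw [hχx y hy.le, lap_congr (hev y hy), lap_const]; ring)
  have t2 : ∀ i, Filter.Tendsto (fun c : ℝ => ∫ y, partialD i (newton m c⁻¹) (x - y) *
      (2 * partialD i χ y * ψ y)) Filter.atTop
      (nhds (∫ y, partialD i (newton m 0) (x - y) * (2 * partialD i χ y * ψ y))) := by
    intro i
    obtain ⟨B, hB⟩ := (hGc i).exists_bound_of_continuous (hG0 i)
    exact tendsto_integral_kernel_mul (m := m) (x := x) (G := fun ε => partialD i (newton m ε))
      (fun ε => continuousOn_partialD_newton m ε i)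
      (fun ε z h1 h2 h3 => (abs_partialD_newton_le m ε h2 i).trans
        (by linarith [kap_nonneg m z]))
      (fun z hz => continuousAt_partialD_newton_param m hz i)
      (hG0 i).aestronglyMeasurable hB (fun y hy => by
        rw [partialD_congr (hev y hy), partialD_const]; ring)
  have hcc : HasCompactSupport fun y => χ y * ψ y := hχc.mul_right
  have t3 := tendsto_integral_lap_newton_mul (x := x) (h := fun y => χ y * ψ y)
    ((hχ0.mul hψ0).integrable_of_hasCompactSupport hcc) (hχ0.mul hψ0).continuousAt
  refine tendsto_nhds_unique t3 ((t1.add (tendsto_finsetSum _ fun i _ => t2 i)).congr' ?_)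
  filter_upwards [Filter.eventually_gt_atTop 0] with c hc
  have hN : ContDiff ℝ ω (newton m c⁻¹) := contDiff_iff_contDiffAt.2 fun z =>
    contDiffAt_newton m (by positivity)
  have hN2 : ContDiff ℝ 2 (newton m c⁻¹) := hN.of_le le_top
  have hN1 := fun i => ContDiff.partialD (n := 1) (by simpa [one_add_one_eq_two] using hN2) i
  have hNl := hN2.continuous_lap
  have hq : ContDiff ℝ 2 fun y => newton m c⁻¹ (x - y) :=
    hN2.comp (contDiff_const.sub contDiff_id)
  have hqχ : ContDiff ℝ 2 fun y => newton m c⁻¹ (x - y) * χ y := hq.mul hχ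
  have hqχc : HasCompactSupport fun y => newton m c⁻¹ (x - y) * χ y := hχc.mul_left
  have green := integral_mul_lap hqχ hψ hqχc
  have i1 : Integrable fun y => newton m c⁻¹ (x - y) * (χ y * lap ψ y - lap χ y * ψ y) :=
    Continuous.integrable_of_hasCompactSupport (hq.continuous.mul hF0) hFc.mul_left
  have i2 : ∀ i, Integrable fun y => partialD i (newton m c⁻¹) (x - y)
      * (2 * partialD i χ y * ψ y) := fun i => Continuous.integrable_of_hasCompactSupport
    (((hN1 i).continuous.comp (by fun_prop)).mul (hG0 i)) (hGc i).mul_left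
  have i3 : Integrable fun y => lap (newton m c⁻¹) (x - y) * (χ y * ψ y) :=
    Continuous.integrable_of_hasCompactSupport
      ((hNl.comp (by fun_prop : Continuous fun y => x - y)).mul (hχ0.mul hψ0)) hcc.mul_left
  have i4 : Integrable fun y => newton m c⁻¹ (x - y) * χ y * lap ψ y :=
    Continuous.integrable_of_hasCompactSupport (hqχ.continuous.mul hlψ) hqχc.mul_right
  have i12 : Integrable fun y => newton m c⁻¹ (x - y) * (χ y * lap ψ y - lap χ y * ψ y)
      + ∑ i, partialD i (newton m c⁻¹) (x - y) * (2 * partialD i χ y * ψ y) :=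
    i1.add (integrable_finsetSum _ fun i _ => i2 i)
  rw [← integral_finsetSum _ fun i _ => i2 i,
    ← integral_add i1 (integrable_finsetSum _ fun i _ => i2 i),
    ← sub_eq_zero, ← integral_sub i12 i3]
  have hD : ∀ y, (newton m c⁻¹ (x - y) * (χ y * lap ψ y - lap χ y * ψ y)
      + ∑ i, partialD i (newton m c⁻¹) (x - y) * (2 * partialD i χ y * ψ y))
      - lap (newton m c⁻¹) (x - y) * (χ y * ψ y)
      = newton m c⁻¹ (x - y) * χ y * lap ψ y
        - lap (fun y => newton m c⁻¹ (x - y) * χ y) y * ψ y := by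
    intro y
    rw [lap_mul hq hχ, lap_comp_sub]
    simp only [partialD_comp_sub]
    have : ∑ i, partialD i (newton m c⁻¹) (x - y) * (2 * partialD i χ y * ψ y)
        = 2 * (∑ i, partialD i (newton m c⁻¹) (x - y) * partialD i χ y) * ψ y := by
      rw [Finset.mul_sum, Finset.sum_mul]
      exact Finset.sum_congr rfl fun i _ => by ring
    rw [this]
    simp only [neg_mul, Finset.sum_neg_distrib]
    ring
  have i5 : Integrable fun y => lap (fun y => newton m c⁻¹ (x - y) * χ y) y * ψ y := by
    have h : (fun y => lap (fun y => newton m c⁻¹ (x - y) * χ y) y * ψ y) = fun y =>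
      newton m c⁻¹ (x - y) * χ y * lap ψ y
      - ((newton m c⁻¹ (x - y) * (χ y * lap ψ y - lap χ y * ψ y)
      + ∑ i, partialD i (newton m c⁻¹) (x - y) * (2 * partialD i χ y * ψ y))
      - lap (newton m c⁻¹) (x - y) * (χ y * ψ y)) := by
      funext y; rw [hD]; ring
    rw [h]
    exact i4.sub (i12.sub i3)
  calc _ = ∫ y, (newton m c⁻¹ (x - y) * χ y * lap ψ y
        - lap (fun y => newton m c⁻¹ (x - y) * χ y) y * ψ y) := by
        congr 1; funext y; exact hD y
    _ = 0 := by rw [integral_sub i4 i5, green, sub_self]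

/-- A smooth cutoff, equal to `1` on the ball of radius `1 / 2` and to `0` off the ball of
radius `3 / 4`. -/
noncomputable def cutoff {d : ℕ} (y : EuclideanSpace ℝ (Fin d)) : ℝ :=
  (⟨1 / 2, 3 / 4, by norm_num, by norm_num⟩ : ContDiffBump (0 : EuclideanSpace ℝ (Fin d))) y

/-- The cutoff adapted to the ball of centre `x` and radius `δ`. -/
noncomputable def cutoffAt {d : ℕ} (x : EuclideanSpace ℝ (Fin d)) (δ : ℝ)
    (y : EuclideanSpace ℝ (Fin d)) : ℝ := cutoff (δ⁻¹ • (y - x))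

section Cutoff

variable {d : ℕ}

theorem contDiff_cutoff : ContDiff ℝ 2 (cutoff : EuclideanSpace ℝ (Fin d) → ℝ) :=
  ContDiffBump.contDiff _

theorem cutoff_nonneg (y : EuclideanSpace ℝ (Fin d)) : 0 ≤ cutoff y := ContDiffBump.nonneg _

theorem cutoff_le_one (y : EuclideanSpace ℝ (Fin d)) : cutoff y ≤ 1 := ContDiffBump.le_one _

theorem cutoff_eq_one {y : EuclideanSpace ℝ (Fin d)} (hy : ‖y‖ ≤ 1 / 2) : cutoff y = 1 :=
  ContDiffBump.one_of_mem_closedBall _ (by simpa using hy)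

theorem cutoff_eq_zero {y : EuclideanSpace ℝ (Fin d)} (hy : 3 / 4 ≤ ‖y‖) : cutoff y = 0 :=
  ContDiffBump.zero_of_le_dist _ (by simpa using hy)

theorem hasCompactSupport_cutoff :
    HasCompactSupport (cutoff : EuclideanSpace ℝ (Fin d) → ℝ) :=
  ContDiffBump.hasCompactSupport _

theorem cutoff_eventuallyEq_const {y : EuclideanSpace ℝ (Fin d)}
    (hy : ‖y‖ < 1 / 2 ∨ 1 ≤ ‖y‖) : ∃ a : ℝ, cutoff =ᶠ[nhds y] fun _ => a := by
  rcases hy with hy | hy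
  · exact ⟨1, Filter.mem_of_superset ((isOpen_lt continuous_norm continuous_const).mem_nhds hy)
      fun z (hz : ‖z‖ < 1 / 2) => cutoff_eq_one hz.le⟩
  · exact ⟨0, Filter.mem_of_superset ((isOpen_lt (f := fun _ => (3 / 4 : ℝ)) continuous_const
      continuous_norm).mem_nhds (show 3 / 4 < ‖y‖ by linarith))
      fun z (hz : 3 / 4 < ‖z‖) => cutoff_eq_zero hz.le⟩

theorem exists_cutoff_bound (d : ℕ) : ∃ Q : ℝ, 1 ≤ Q ∧
    (∀ i (y : EuclideanSpace ℝ (Fin d)), |partialD i cutoff y| ≤ Q) ∧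
    ∀ y : EuclideanSpace ℝ (Fin d), |lap cutoff y| ≤ Q := by
  have h1 : ∀ i : Fin d, ∃ C, ∀ y, ‖partialD i cutoff y‖ ≤ C := fun i =>
    (hasCompactSupport_cutoff.partialD i).exists_bound_of_continuous
      ((contDiff_cutoff.of_le (m := 1) (by norm_num)).partialD (n := 0) i).continuous
  have h2 : HasCompactSupport (lap (cutoff : EuclideanSpace ℝ (Fin d) → ℝ)) := by
    refine HasCompactSupport.of_support_subset_isCompact hasCompactSupport_cutoff fun y hy => ?_
    by_contra h
    exact hy ((lap_congr (notMem_tsupport_iff_eventuallyEq.1 h)).trans (lap_const 0 y))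
  choose C hC using h1
  obtain ⟨C', hC'⟩ := h2.exists_bound_of_continuous contDiff_cutoff.continuous_lap
  have hC0 : ∀ i, 0 ≤ C i := fun i => (norm_nonneg _).trans (hC i 0)
  have hC0' : 0 ≤ C' := (norm_nonneg _).trans (hC' 0)
  have hs := Finset.sum_nonneg fun i (_ : i ∈ Finset.univ) => hC0 i
  refine ⟨1 + ∑ i, C i + C', by linarith, fun i y => (hC i y).trans ?_, fun y =>
    (hC' y).trans (by linarith)⟩
  linarith [Finset.single_le_sum (fun i _ => hC0 i) (Finset.mem_univ i)]

theorem partialD_comp_affine (a : ℝ) (x : EuclideanSpace ℝ (Fin d))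
    {f : EuclideanSpace ℝ (Fin d) → ℝ} (hf : Differentiable ℝ f) (i : Fin d) :
    partialD i (fun y => f (a • (y - x))) = fun y => a * partialD i f (a • (y - x)) := by
  funext y
  have h : HasFDerivAt (fun y => a • (y - x)) (a • ContinuousLinearMap.id ℝ _) y :=
    ((hasFDerivAt_id y).sub_const x).const_smul a
  have h2 := (hf (a • (y - x))).hasFDerivAt.comp y h
  simp only [partialD]
  rw [show (fun y => f (a • (y - x))) = f ∘ fun y => a • (y - x) from rfl, h2.fderiv]
  simp

theorem lap_comp_affine (a : ℝ) (x : EuclideanSpace ℝ (Fin d))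
    {f : EuclideanSpace ℝ (Fin d) → ℝ} (hf : ContDiff ℝ 2 f) (y : EuclideanSpace ℝ (Fin d)) :
    lap (fun y => f (a • (y - x))) y = a ^ 2 * lap f (a • (y - x)) := by
  have hf1 := fun i => (ContDiff.partialD (n := 1) (by simpa [one_add_one_eq_two] using hf)
    i).differentiable (by norm_num)
  simp only [lap_eq_sum_partialD, Finset.mul_sum]
  refine Finset.sum_congr rfl fun i _ => ?_
  rw [partialD_comp_affine a x (hf.differentiable (by norm_num))]
  have h := congrFun (partialD_comp_affine a x (hf1 i) i) y
  have h2 : partialD i (fun y => a * partialD i f (a • (y - x))) y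
      = a * partialD i (fun y => partialD i f (a • (y - x))) y := by
    have hd : DifferentiableAt ℝ (fun y => partialD i f (a • (y - x))) y :=
      ((hf1 i).comp (g := partialD i f) (by fun_prop : Differentiable ℝ fun y => a • (y - x))) y
    have := fderiv_const_mul hd a
    simp only [partialD] at this ⊢
    rw [this]; rfl
  rw [h2, h]; ring

variable {x y : EuclideanSpace ℝ (Fin d)} {δ : ℝ}

theorem contDiff_cutoffAt (x : EuclideanSpace ℝ (Fin d)) (δ : ℝ) : ContDiff ℝ 2 (cutoffAt x δ) :=
  contDiff_cutoff.comp (by fun_prop)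

theorem cutoffAt_nonneg (x : EuclideanSpace ℝ (Fin d)) (δ : ℝ) (y) : 0 ≤ cutoffAt x δ y :=
  cutoff_nonneg _

theorem cutoffAt_le_one (x : EuclideanSpace ℝ (Fin d)) (δ : ℝ) (y) : cutoffAt x δ y ≤ 1 :=
  cutoff_le_one _

theorem norm_inv_smul_sub (hδ : 0 < δ) : ‖δ⁻¹ • (y - x)‖ = ‖y - x‖ / δ := by
  rw [norm_smul, Real.norm_eq_abs, abs_of_pos (by positivity)]; ring

theorem cutoffAt_eq_one (hδ : 0 < δ) (hy : ‖y - x‖ ≤ δ / 2) : cutoffAt x δ y = 1 :=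
  cutoff_eq_one (by rw [norm_inv_smul_sub hδ, div_le_iff₀ hδ]; linarith)

theorem cutoffAt_eq_zero (hδ : 0 < δ) (hy : 3 / 4 * δ ≤ ‖y - x‖) : cutoffAt x δ y = 0 :=
  cutoff_eq_zero (by rw [norm_inv_smul_sub hδ, le_div_iff₀ hδ]; exact hy)

theorem hasCompactSupport_cutoffAt (hδ : 0 < δ) : HasCompactSupport (cutoffAt x δ) := by
  refine HasCompactSupport.of_support_subset_isCompact (isCompact_closedBall x δ) fun y hy => ?_
  by_contra h
  rw [mem_closedBall_iff_norm, not_le] at h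
  exact hy (cutoffAt_eq_zero hδ (by linarith))

theorem partialD_cutoffAt (i : Fin d) :
    partialD i (cutoffAt x δ) y = δ⁻¹ * partialD i cutoff (δ⁻¹ • (y - x)) :=
  congrFun (partialD_comp_affine _ _ (contDiff_cutoff.differentiable (by norm_num)) i) y

theorem lap_cutoffAt : lap (cutoffAt x δ) y = δ⁻¹ ^ 2 * lap cutoff (δ⁻¹ • (y - x)) :=
  lap_comp_affine _ _ contDiff_cutoff y

theorem partialD_cutoffAt_eq_zero (hδ : 0 < δ) (hy : ‖y - x‖ < δ / 2 ∨ δ ≤ ‖y - x‖) (i : Fin d) :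
    partialD i (cutoffAt x δ) y = 0 := by
  obtain ⟨a, ha⟩ := cutoff_eventuallyEq_const (y := δ⁻¹ • (y - x)) (by
    rw [norm_inv_smul_sub hδ, div_lt_iff₀ hδ, le_div_iff₀ hδ]
    exact hy.imp (fun h => by linarith) fun h => by linarith)
  rw [partialD_cutoffAt, partialD_congr ha, partialD_const, mul_zero]

theorem lap_cutoffAt_eq_zero (hδ : 0 < δ) (hy : ‖y - x‖ < δ / 2 ∨ δ ≤ ‖y - x‖) :
    lap (cutoffAt x δ) y = 0 := by
  obtain ⟨a, ha⟩ := cutoff_eventuallyEq_const (y := δ⁻¹ • (y - x)) (by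
    rw [norm_inv_smul_sub hδ, div_lt_iff₀ hδ, le_div_iff₀ hδ]
    exact hy.imp (fun h => by linarith) fun h => by linarith)
  rw [lap_cutoffAt, lap_congr ha, lap_const, mul_zero]

end Cutoff

theorem abs_integral_newtonKer_mul_le {m : ℕ} (o : Option (Fin (m + 2)))
    {f g : EuclideanSpace ℝ (Fin (m + 2)) → ℝ} {x : EuclideanSpace ℝ (Fin (m + 2))}
    {δ B B' : ℝ} (hδ : 0 < δ) (hδ1 : δ ≤ 1) (hB : 0 ≤ B) (hB' : 0 ≤ B')
    (hg : IntegrableOn g (Metric.ball x δ))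
    (hf0 : ∀ y, δ ≤ ‖y - x‖ → f y = 0) (hf1 : ∀ y, ‖y - x‖ < δ / 2 → |f y| ≤ B)
    (hf2 : ∀ y, ‖y - x‖ < δ → |f y| ≤ B + B' * |g y|) :
    |∫ y, newtonKer m o (x - y) * f y| ≤
      2 * kapMass m * δ * B + 2 * (2 / δ) ^ (m + 1) * B' * ∫ y in Metric.ball x δ, |g y| := by
  have h1 : IntegrableOn (fun y => 2 * B * kap m (x - y)) (Metric.ball x δ) :=
    (integrableOn_kap_sub m x δ).const_mul _
  have h2 : IntegrableOn (fun y => 2 * (2 / δ) ^ (m + 1) * B' * |g y|) (Metric.ball x δ) :=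
    hg.abs.const_mul _
  have hv : (∫ y, (Metric.ball x δ).indicator (fun y => 2 * B * kap m (x - y)
      + 2 * (2 / δ) ^ (m + 1) * B' * |g y|) y) = 2 * kapMass m * δ * B
        + 2 * (2 / δ) ^ (m + 1) * B' * ∫ y in Metric.ball x δ, |g y| := by
    rw [integral_indicator measurableSet_ball, integral_add h1 h2, integral_const_mul,
      integral_const_mul, setIntegral_kap_sub, setIntegral_kap_ball m hδ.le]
    ring
  rw [← hv, ← Real.norm_eq_abs]
  refine norm_integral_le_of_norm_le ((integrable_indicator_iff measurableSet_ball).2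
    (h1.add h2)) ?_
  filter_upwards [ae_ne x] with y hy
  have hz : x - y ≠ 0 := sub_ne_zero.2 hy.symm
  rw [Real.norm_eq_abs]
  rcases le_or_gt δ ‖y - x‖ with h | h
  · rw [hf0 y h, mul_zero, abs_zero]
    refine Set.indicator_nonneg (fun y _ => add_nonneg (mul_nonneg (by positivity)
      (kap_nonneg _ _)) (by positivity)) _
  · rw [Set.indicator_of_mem (mem_ball_iff_norm.2 h), abs_mul]
    have hk := abs_newtonKer_le m o hz (by rw [norm_sub_rev]; linarith)
    have hk0 := kap_nonneg m (x - y)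
    rcases lt_or_ge ‖y - x‖ (δ / 2) with h3 | h3
    · calc _ ≤ 2 * kap m (x - y) * B := by gcongr; exact hf1 y h3
        _ ≤ 2 * B * kap m (x - y) + 0 := by linarith
        _ ≤ _ := by gcongr; positivity
    · have hk2 : kap m (x - y) ≤ (2 / δ) ^ (m + 1) := by
        rw [kap, norm_sub_rev, ← inv_div δ 2, inv_pow]
        gcongr
      calc _ ≤ 2 * kap m (x - y) * (B + B' * |g y|) := by gcongr; exact hf2 y h
        _ = 2 * B * kap m (x - y) + 2 * kap m (x - y) * B' * |g y| := by ring
        _ ≤ _ := by gcongr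

theorem exists_local_bound (m : ℕ) : ∃ Q : ℝ, 1 ≤ Q ∧
    ∀ Ψ : EuclideanSpace ℝ (Fin (m + 2)) → ℝ, ContDiff ℝ 2 Ψ → ∀ x δ L, 0 < δ → δ ≤ 1 → 0 ≤ L →
      (∀ y, ‖y - x‖ < δ → |lap Ψ y| ≤ L) →
      (m + 2) * newtonMass m * |Ψ x| ≤ 2 * kapMass m * δ * L
        + Q * (δ ^ (m + 3))⁻¹ * ∫ y in Metric.ball x δ, |Ψ y| := by
  obtain ⟨Q, hQ, hQ1, hQ2⟩ := exists_cutoff_bound (m + 2)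
  refine ⟨(m + 3) * 2 ^ (m + 3) * Q, ?_, ?_⟩
  · have : (1 : ℝ) ≤ 2 ^ (m + 3) := one_le_pow₀ (by norm_num)
    have h3 : (1 : ℝ) ≤ m + 3 := by linarith [(Nat.cast_nonneg m : (0 : ℝ) ≤ m)]
    exact one_le_mul_of_one_le_of_one_le (one_le_mul_of_one_le_of_one_le h3 this) hQ
  intro Ψ hΨ x δ L hδ hδ1 hL hlap
  set χ := cutoffAt x δ with hχ
  have hintg : IntegrableOn Ψ (Metric.ball x δ) :=
    (hΨ.continuous.continuousOn.integrableOn_compact (isCompact_closedBall x δ)).mono_set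
      Metric.ball_subset_closedBall
  have hrep := newton_representation (contDiff_cutoffAt x δ) hΨ (hasCompactSupport_cutoffAt hδ)
    (x := x) (fun y hy => cutoffAt_eq_zero hδ (by rw [norm_sub_rev]; linarith))
  rw [cutoffAt_eq_one hδ (by simp; positivity), one_mul, ← hχ] at hrep
  have hχ1 : ∀ y, |χ y| ≤ 1 := fun y => by
    rw [abs_of_nonneg (cutoffAt_nonneg x δ y)]; exact cutoffAt_le_one x δ y
  set I := ∫ y in Metric.ball x δ, |Ψ y| with hI
  have hI0 : 0 ≤ I := integral_nonneg fun y => abs_nonneg _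
  have hcl : ∀ y, |lap χ y| ≤ δ⁻¹ ^ 2 * Q := fun y => by
    rw [hχ, lap_cutoffAt, abs_mul, abs_of_nonneg (by positivity)]
    gcongr; exact hQ2 _
  have hcd : ∀ i y, |partialD i χ y| ≤ δ⁻¹ * Q := fun i y => by
    rw [hχ, partialD_cutoffAt, abs_mul, abs_of_nonneg (by positivity)]
    gcongr; exact hQ1 i _
  have e1 : ∀ y, ‖y - x‖ < δ → |χ y * lap Ψ y| ≤ L := fun y hy => by
    rw [abs_mul]
    calc _ ≤ 1 * L := mul_le_mul (hχ1 y) (hlap y hy) (abs_nonneg _) zero_le_one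
      _ = L := one_mul L
  have t1 := abs_integral_newtonKer_mul_le (m := m) none (x := x) (g := Ψ)
    (f := fun y => χ y * lap Ψ y - lap χ y * Ψ y) (B' := δ⁻¹ ^ 2 * Q) hδ hδ1 hL (by positivity)
    hintg
    (fun y hy => by
      rw [hχ, cutoffAt_eq_zero hδ (by linarith), lap_cutoffAt_eq_zero hδ (Or.inr hy)]; ring)
    (fun y hy => by
      rw [hχ, lap_cutoffAt_eq_zero hδ (Or.inl hy), zero_mul, sub_zero]
      exact e1 y (by linarith))
    (fun y hy => by
      refine (abs_sub _ _).trans (add_le_add (e1 y hy) ?_)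
      rw [abs_mul]
      gcongr; exact hcl y)
  have t2 : ∀ i, |∫ y, newtonKer m (some i) (x - y) * (2 * partialD i χ y * Ψ y)| ≤
      2 * (2 / δ) ^ (m + 1) * (2 * (δ⁻¹ * Q)) * I := fun i => by
    have := abs_integral_newtonKer_mul_le (m := m) (some i) (x := x) (g := Ψ)
      (f := fun y => 2 * partialD i χ y * Ψ y) (B' := 2 * (δ⁻¹ * Q)) hδ hδ1 le_rfl (by positivity)
      hintg
      (fun y hy => by rw [hχ, partialD_cutoffAt_eq_zero hδ (Or.inr hy)]; ring)
      (fun y hy => by rw [hχ, partialD_cutoffAt_eq_zero hδ (Or.inl hy)]; simp)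
      (fun y hy => by
        rw [zero_add, abs_mul, abs_mul, abs_two]
        gcongr; exact hcd i y)
    simpa using this
  have hM := newtonMass_pos m
  have hl : (m + 2) * newtonMass m * |Ψ x| = |(m + 2) * newtonMass m * Ψ x| := by
    rw [abs_mul, abs_of_nonneg (a := (m + 2) * newtonMass m) (by positivity)]
  rw [hl, hrep]
  refine (abs_add_le _ _).trans ((add_le_add t1 ((Finset.abs_sum_le_sum_abs _ _).trans
    (Finset.sum_le_sum fun i _ => t2 i))).trans ?_)
  rw [Finset.sum_const, Finset.card_univ, Fintype.card_fin, nsmul_eq_mul, add_assoc]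
  have p1 : (2 / δ) ^ (m + 1) * (δ⁻¹ ^ 2 * Q) = 2 ^ (m + 1) * Q * (δ ^ (m + 3))⁻¹ := by
    rw [div_pow, pow_add δ m 3, pow_add δ m 1]; field_simp
  have p2 : (2 / δ) ^ (m + 1) * (δ⁻¹ * Q) ≤ 2 ^ (m + 1) * Q * (δ ^ (m + 3))⁻¹ := by
    rw [← p1]
    have : δ⁻¹ ≤ δ⁻¹ ^ 2 := by
      rw [sq]; exact le_mul_of_one_le_left (by positivity) ((one_le_inv₀ hδ).2 hδ1)
    gcongr
  have p3 : 0 ≤ 2 ^ (m + 1) * Q * (δ ^ (m + 3))⁻¹ := by positivity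
  refine add_le_add le_rfl ?_
  calc 2 * (2 / δ) ^ (m + 1) * (δ⁻¹ ^ 2 * Q) * I
        + (m + 2 : ℕ) * (2 * (2 / δ) ^ (m + 1) * (2 * (δ⁻¹ * Q)) * I)
      = (2 * ((2 / δ) ^ (m + 1) * (δ⁻¹ ^ 2 * Q))
        + (m + 2 : ℕ) * (4 * ((2 / δ) ^ (m + 1) * (δ⁻¹ * Q)))) * I := by ring
    _ ≤ (2 * (2 ^ (m + 1) * Q * (δ ^ (m + 3))⁻¹)
        + (m + 2 : ℕ) * (4 * (2 ^ (m + 1) * Q * (δ ^ (m + 3))⁻¹))) * I := by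
        rw [p1]; gcongr
    _ ≤ (4 * (2 ^ (m + 1) * Q * (δ ^ (m + 3))⁻¹)
        + (m + 2 : ℕ) * (4 * (2 ^ (m + 1) * Q * (δ ^ (m + 3))⁻¹))) * I := by
        gcongr; norm_num
    _ = (m + 3) * 2 ^ (m + 3) * Q * (δ ^ (m + 3))⁻¹ * I := by push_cast; ring

theorem exists_sup_bound (m : ℕ) {V r : ℝ} (hV : 0 ≤ V) (hr : 0 < r) (hr1 : r ≤ 1)
    (hrV : 2 ^ (m + 5) * kapMass m * r * (V + 1) ≤ (m + 2) * newtonMass m) :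
    ∃ A : ℝ, 1 ≤ A ∧ ∀ Ψ : EuclideanSpace ℝ (Fin (m + 2)) → ℝ, ContDiff ℝ 2 Ψ → ∀ G S : ℝ, 0 ≤ G →
      (∀ y, ‖y‖ < r → |lap Ψ y| ≤ V * |Ψ y| + G) → ∫ y in Metric.ball 0 r, |Ψ y| ≤ S →
      ∀ x, ‖x‖ ≤ r / 2 → |Ψ x| ≤ A * S + G / 2 := by
  obtain ⟨Q, hQ, hloc⟩ := exists_local_bound m
  have hK := kapMass_pos m
  have hM := newtonMass_pos m
  set c := (m + 2) * newtonMass m with hc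
  set K := kapMass m with hKdef
  have hc0 : 0 < c := by positivity
  refine ⟨1 + (4 / r) ^ (m + 3) * (2 / c) * Q, by
    have : 0 ≤ (4 / r) ^ (m + 3) * (2 / c) * Q := by positivity
    linarith, ?_⟩
  intro Ψ hΨ G S hG hlap hI x hx
  have hS : 0 ≤ S := (integral_nonneg fun y => abs_nonneg _).trans hI
  have hcont : Continuous fun y => (r - ‖y‖) ^ (m + 3) * |Ψ y| := by
    have := hΨ.continuous
    fun_prop
  obtain ⟨z, hz, hmax⟩ := (isCompact_closedBall (0 : EuclideanSpace ℝ (Fin (m + 2))) r).exists_isMaxOn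
    ⟨0, by simp [hr.le]⟩ hcont.continuousOn
  rw [mem_closedBall_zero_iff] at hz
  have hmax' : ∀ y : EuclideanSpace ℝ (Fin (m + 2)), ‖y‖ ≤ r →
      (r - ‖y‖) ^ (m + 3) * |Ψ y| ≤ (r - ‖z‖) ^ (m + 3) * |Ψ z| := fun y hy =>
    hmax (mem_closedBall_zero_iff.2 hy)
  have hx2 : (r / 2) ^ (m + 3) * |Ψ x| ≤ (r - ‖z‖) ^ (m + 3) * |Ψ z| := by
    refine le_trans ?_ (hmax' x (by linarith))
    gcongr; linarith
  rcases hz.eq_or_lt with hz | hz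
  · rw [hz, sub_self, zero_pow (by lia), zero_mul] at hx2
    have h0 : |Ψ x| ≤ 0 := by
      by_contra! h
      have : 0 < (r / 2) ^ (m + 3) * |Ψ x| := by positivity
      linarith
    refine h0.trans ?_
    positivity
  set δ := (r - ‖z‖) / 2 with hδ
  have hδ0 : 0 < δ := by rw [hδ]; linarith
  have hδr : 2 * δ ≤ r := by rw [hδ]; linarith [norm_nonneg z]
  have hrz : r - ‖z‖ = 2 * δ := by rw [hδ]; ring
  rw [hrz] at hmax' hx2
  set t := |Ψ z| with ht
  have ht0 : 0 ≤ t := abs_nonneg _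
  have hin : ∀ y, ‖y - z‖ < δ → ‖y‖ ≤ r - δ := fun y hy => by
    have := norm_le_norm_add_norm_sub' y z
    linarith
  have hy2 : ∀ y, ‖y - z‖ < δ → |Ψ y| ≤ 2 ^ (m + 3) * t := fun y hy => by
    have h1 := hin y hy
    have h2 : δ ^ (m + 3) * |Ψ y| ≤ (2 * δ) ^ (m + 3) * t := by
      refine le_trans ?_ (hmax' y (by linarith))
      gcongr; linarith
    rw [mul_pow, mul_comm (2 ^ (m + 3)), mul_assoc] at h2
    exact le_of_mul_le_mul_left h2 (by positivity)
  have key := hloc Ψ hΨ z δ (V * (2 ^ (m + 3) * t) + G) hδ0 (by linarith) (by positivity)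
    (fun y hy => (hlap y (by linarith [hin y hy])).trans (by
      have := hy2 y hy
      gcongr))
  have hIS : ∫ y in Metric.ball z δ, |Ψ y| ≤ S := by
    refine le_trans (setIntegral_mono_set ?_ (Filter.Eventually.of_forall fun y => abs_nonneg _)
      (Filter.Eventually.of_forall fun y hy => ?_)) hI
    · exact (hΨ.continuous.abs.continuousOn.integrableOn_compact
        (isCompact_closedBall 0 r)).mono_set Metric.ball_subset_closedBall
    · have h1 := hin y (mem_ball_iff_norm.1 hy)
      exact mem_ball_zero_iff.2 (by linarith)
  have hKV : 2 * K * δ * (V * (2 ^ (m + 3) * t)) ≤ c / 2 * t := by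
    have h1 : 2 * δ * (K * V * 2 ^ (m + 3)) ≤ r * (K * V * 2 ^ (m + 3)) := by gcongr
    have h2 : r * (K * V * 2 ^ (m + 3)) * 4 ≤ 2 ^ (m + 5) * K * r * (V + 1) := by
      have : 0 ≤ 2 ^ (m + 3) * K * r := by positivity
      rw [show (2 : ℝ) ^ (m + 5) = 4 * 2 ^ (m + 3) by ring]
      linarith
    have h3 : 2 * K * δ * (V * 2 ^ (m + 3)) ≤ c / 2 := by linarith
    calc _ = 2 * K * δ * (V * 2 ^ (m + 3)) * t := by ring
      _ ≤ _ := by gcongr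
  have hKG : 2 ^ (m + 3) * (2 / c) * (K * r * G) ≤ G / 2 := by
    have h2 : 2 ^ (m + 5) * K * r ≤ c := by
      refine le_trans (le_mul_of_one_le_right (by positivity) (by linarith)) hrV
    calc _ = (2 ^ (m + 5) * K * r) * (G / (2 * c)) := by field_simp; ring
      _ ≤ c * (G / (2 * c)) := by gcongr
      _ = G / 2 := by field_simp
  have ht1 : t ≤ 2 / c * (2 * K * δ * G + Q * (δ ^ (m + 3))⁻¹ * S) := by
    have h1 : Q * (δ ^ (m + 3))⁻¹ * ∫ y in Metric.ball z δ, |Ψ y| ≤ Q * (δ ^ (m + 3))⁻¹ * S := by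
      gcongr
    have h2 : c / 2 * t ≤ 2 * K * δ * G + Q * (δ ^ (m + 3))⁻¹ * S := by
      rw [mul_add] at key
      linarith
    calc t = 2 / c * (c / 2 * t) := by field_simp
      _ ≤ _ := by gcongr
  have hx3 : |Ψ x| ≤ (4 * δ / r) ^ (m + 3) * t := by
    have h1 : (r / 2) ^ (m + 3) * ((4 * δ / r) ^ (m + 3) * t) = (2 * δ) ^ (m + 3) * t := by
      rw [← mul_assoc, ← mul_pow]; congr 2; field_simp; ring
    rw [← h1] at hx2
    exact le_of_mul_le_mul_left hx2 (by positivity)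
  have h4 : (4 * δ / r) ^ (m + 3) ≤ 2 ^ (m + 3) := by
    gcongr
    rw [div_le_iff₀ hr]; linarith
  have h5 : (4 * δ / r) ^ (m + 3) * (δ ^ (m + 3))⁻¹ = (4 / r) ^ (m + 3) := by
    rw [← inv_pow, ← mul_pow]; congr 1; field_simp
  calc |Ψ x| ≤ (4 * δ / r) ^ (m + 3) * t := hx3
    _ ≤ (4 * δ / r) ^ (m + 3) * (2 / c * (2 * K * δ * G + Q * (δ ^ (m + 3))⁻¹ * S)) := by gcongr
    _ = (4 * δ / r) ^ (m + 3) * (2 / c) * (K * (2 * δ) * G)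
        + ((4 * δ / r) ^ (m + 3) * (δ ^ (m + 3))⁻¹) * (2 / c) * Q * S := by ring
    _ ≤ 2 ^ (m + 3) * (2 / c) * (K * r * G) + (4 / r) ^ (m + 3) * (2 / c) * Q * S := by
      rw [h5]; gcongr
    _ ≤ G / 2 + (4 / r) ^ (m + 3) * (2 / c) * Q * S := by gcongr
    _ ≤ _ := by linarith

section Neumann

variable {X : Type*} [MeasurableSpace X] {μ : Measure X} {k : X → X → ℝ}

theorem abs_integral_mul_le_of_integral_abs_le {h v : X → ℝ} {q β : ℝ} (hh : Integrable h μ)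
    (hq : ∫ y, |h y| ∂μ ≤ q) (hv : ∀ y, |v y| ≤ β) (hβ : 0 ≤ β) :
    |∫ y, h y * v y ∂μ| ≤ q * β := by
  rw [← Real.norm_eq_abs]
  refine (norm_integral_le_of_norm_le (hh.abs.mul_const β) (Filter.Eventually.of_forall
    fun y => ?_)).trans ?_
  · rw [norm_mul, Real.norm_eq_abs, Real.norm_eq_abs]
    exact mul_le_mul_of_nonneg_left (hv y) (abs_nonneg _)
  · rw [integral_mul_const]
    gcongr

theorem exists_solution_of_integral_abs_le_half [SFinite μ]
    (hkm : Measurable (Function.uncurry k)) (hki : ∀ x, Integrable (k x) μ)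
    (hk : ∀ x, ∫ y, |k x y| ∂μ ≤ 1 / 2) {b : X → ℝ} {β : ℝ} (hbm : Measurable b)
    (hβ : 0 ≤ β) (hb : ∀ x, |b x| ≤ β) :
    ∃ w : X → ℝ, Measurable w ∧ (∀ x, |w x| ≤ 2 * β) ∧
      ∀ x, w x = b x + ∫ y, k x y * w y ∂μ := by
  let v : ℕ → X → ℝ := fun n => Nat.rec b (fun _ u x => ∫ y, k x y * u y ∂μ) n
  have hv1 : ∀ n x, v (n + 1) x = ∫ y, k x y * v n y ∂μ := fun n x => rfl
  have hvm : ∀ n, Measurable (v n) := by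
    intro n
    induction n with
    | zero => exact hbm
    | succ n ih =>
      have h : StronglyMeasurable (Function.uncurry fun x y => k x y * v n y) :=
        (hkm.mul (ih.comp measurable_snd)).stronglyMeasurable
      exact h.integral_prod_right.measurable
  have hvb : ∀ n x, |v n x| ≤ (1 / 2) ^ n * β := by
    intro n
    induction n with
    | zero => intro x; rw [pow_zero, one_mul]; exact hb x
    | succ n ih =>
      intro x
      rw [hv1, pow_succ', mul_assoc]
      exact abs_integral_mul_le_of_integral_abs_le (hki x) (hk x) ih (by positivity)
  have hgeo : HasSum (fun n : ℕ => (1 / 2 : ℝ) ^ n * β) (2 * β) :=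
    hasSum_geometric_two.mul_right β
  have hsum : ∀ x, Summable fun n => v n x := fun x =>
    Summable.of_norm_bounded hgeo.summable fun n => hvb n x
  refine ⟨fun x => ∑' n, v n x, ?_, fun x => ?_, fun x => ?_⟩
  · refine measurable_of_tendsto_metrizable (fun n => Finset.measurable_fun_sum (Finset.range n)
      fun i _ => hvm i) (tendsto_pi_nhds.2 fun x => (hsum x).hasSum.tendsto_sum_nat)
  · exact tsum_of_norm_bounded (f := fun n => v n x) hgeo fun n => hvb n x
  · have hi : ∀ n, Integrable (fun y => k x y * v n y) μ := fun n =>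
      (hki x).mul_bdd (c := (1 / 2) ^ n * β) (hvm n).aestronglyMeasurable
        (Filter.Eventually.of_forall fun y => hvb n y)
    have hs : Summable fun n => ∫ y, ‖k x y * v n y‖ ∂μ := by
      refine Summable.of_nonneg_of_le (fun n => integral_nonneg fun y => norm_nonneg _)
        (fun n => ?_) (hgeo.summable.mul_left (1 / 2))
      calc _ ≤ ∫ y, |k x y| * ((1 / 2) ^ n * β) ∂μ := by
            refine integral_mono (hi n).norm ((hki x).abs.mul_const _) fun y => ?_
            simp only [norm_mul, Real.norm_eq_abs]
            exact mul_le_mul_of_nonneg_left (hvb n y) (abs_nonneg _)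
        _ ≤ _ := by
            rw [integral_mul_const]
            exact mul_le_mul_of_nonneg_right (hk x) (by positivity)
    have h1 := hasSum_integral_of_summable_integral_norm hi hs
    simp only [tsum_mul_left] at h1
    show ∑' n, v n x = _
    rw [(hsum x).tsum_eq_zero_add, ← h1.tsum_eq]
    rfl

theorem abs_le_of_eq_add_integral [Nonempty X] (hki : ∀ x, Integrable (k x) μ)
    (hk : ∀ x, ∫ y, |k x y| ∂μ ≤ 1 / 2) {b w : X → ℝ} {β B : ℝ} (hb : ∀ x, |b x| ≤ β)
    (hwB : ∀ x, |w x| ≤ B) (hw : ∀ x, w x = b x + ∫ y, k x y * w y ∂μ) (x : X) :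
    |w x| ≤ 2 * β := by
  have hbd : BddAbove (Set.range fun x => |w x|) := ⟨B, by rintro _ ⟨x, rfl⟩; exact hwB x⟩
  have h1 : ∀ x, |w x| ≤ ⨆ x, |w x| := fun x => le_ciSup hbd x
  have h2 : ⨆ x, |w x| ≤ β + 1 / 2 * ⨆ x, |w x| := ciSup_le fun x => by
    rw [hw x]
    exact (abs_add_le _ _).trans (add_le_add (hb x) (abs_integral_mul_le_of_integral_abs_le (hki x)
      (hk x) h1 ((abs_nonneg _).trans (h1 x))))
  linarith [h1 x]

end Neumann

section Step

variable {m k : ℕ} {A Q M ρ n : ℝ} {f : Option (Fin (m + 2)) → EuclideanSpace ℝ (Fin (m + 2)) → ℝ}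
  {u : EuclideanSpace ℝ (Fin (m + 2)) → ℝ}

theorem one_le_two_div_mul_pow {ρ t : ℝ} (hρ : 0 < ρ) (ht : ρ / 2 ≤ t) (j : ℕ) :
    1 ≤ (2 / ρ) ^ j * t ^ j := by
  rw [← mul_pow]
  apply one_le_pow₀
  rw [div_mul_eq_mul_div, le_div_iff₀ hρ]; linarith

theorem abs_density_some_le (hρ : 0 < ρ) (hQ : 1 ≤ Q) (hn : 0 ≤ n)
    (hfs : ∀ i y, ‖y‖ < ρ / 2 → f (some i) y = 0) (hfn : ∀ o y, |f o y| ≤ Q * n) (j : ℕ)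
    (i : Fin (m + 2)) (y : EuclideanSpace ℝ (Fin (m + 2))) :
    |f (some i) y| ≤ Q * (2 / ρ) ^ j * n * ‖y‖ ^ j := by
  rcases lt_or_ge ‖y‖ (ρ / 2) with h | h
  · rw [hfs i y h, abs_zero]; positivity
  · calc _ ≤ Q * n * 1 := by rw [mul_one]; exact hfn _ y
      _ ≤ Q * n * ((2 / ρ) ^ j * ‖y‖ ^ j) := by
        gcongr; exact one_le_two_div_mul_pow hρ h j
      _ = _ := by ring

theorem abs_density_le (hρ : 0 < ρ) (hρ1 : ρ ≤ 1 / 2) (hQ : 1 ≤ Q) (hM : 0 ≤ M) (hn : 0 ≤ n)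
    (hfu : ∀ y, ‖y‖ < ρ / 2 → |f none y| ≤ Q * |u y|)
    (hfs : ∀ i y, ‖y‖ < ρ / 2 → f (some i) y = 0) (hfn : ∀ o y, |f o y| ≤ Q * n)
    (hu : ∀ y, ‖y‖ < ρ / 2 → |u y| ≤ M * n * ‖y‖ ^ k) (o : Option (Fin (m + 2)))
    (y : EuclideanSpace ℝ (Fin (m + 2))) :
    |f o y| ≤ Q * (M + (2 / ρ) ^ (k + 1)) * n * ‖y‖ ^ k := by
  rcases lt_or_ge ‖y‖ (ρ / 2) with h | h
  · cases o with
    | some i => rw [hfs i y h, abs_zero]; positivity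
    | none =>
      calc _ ≤ Q * (M * n * ‖y‖ ^ k) := (hfu y h).trans (by gcongr; exact hu y h)
        _ = Q * (M + 0) * n * ‖y‖ ^ k := by ring
        _ ≤ _ := by gcongr; positivity
  · have h1 : (2 / ρ) ^ k ≤ (2 / ρ) ^ (k + 1) :=
      pow_le_pow_right₀ (by rw [le_div_iff₀ hρ]; linarith) (Nat.le_succ k)
    calc _ ≤ Q * n * 1 := by rw [mul_one]; exact hfn _ y
      _ ≤ Q * n * ((2 / ρ) ^ k * ‖y‖ ^ k) := by
        gcongr; exact one_le_two_div_mul_pow hρ h k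
      _ = Q * (0 + (2 / ρ) ^ k) * n * ‖y‖ ^ k := by ring
      _ ≤ _ := by gcongr

theorem inv_pow_mul_pow_le {s t : ℝ} (ht : 0 < t) (hst : t ≤ 2 * s) (a b : ℕ) :
    (s ^ (a + b))⁻¹ * t ^ b ≤ 2 ^ (a + b) * (t ^ a)⁻¹ := by
  have hs : 0 < s := by linarith
  rw [← div_eq_mul_inv, ← div_eq_inv_mul, div_le_div_iff₀ (by positivity) (by positivity),
    ← pow_add, ← mul_pow, add_comm b a]
  gcongr

theorem abs_sum_integral_newtonKer_mul_le (hA : 1 ≤ A)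
    (hsome : ∀ j : ℕ, ∀ z : EuclideanSpace ℝ (Fin (m + 2)), z ≠ 0 → ∀ i,
      ‖iteratedFDeriv ℝ j (newtonKer m (some i)) z‖
        ≤ A ^ (j + 1) * j.factorial * (‖z‖ ^ (m + 1 + j))⁻¹)
    (hnone : ∀ j : ℕ, 1 ≤ j → ∀ z : EuclideanSpace ℝ (Fin (m + 2)), z ≠ 0 →
      ‖iteratedFDeriv ℝ j (newtonKer m none) z‖
        ≤ A ^ (j + 1) * j.factorial * (‖z‖ ^ (m + j))⁻¹)
    (hall : ∀ j : ℕ, ∀ z : EuclideanSpace ℝ (Fin (m + 2)), z ≠ 0 → ‖z‖ ≤ 1 → ∀ o,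
      ‖iteratedFDeriv ℝ j (newtonKer m o) z‖
        ≤ A ^ (j + 1) * j.factorial * (‖z‖ ^ (m + 1 + j))⁻¹)
    (hfm : ∀ o, AEStronglyMeasurable (f o) volume)
    (hρ : 0 < ρ) (hρ1 : ρ ≤ 1 / 2) (hQ : 1 ≤ Q) (hM : 0 ≤ M) (hn : 0 ≤ n)
    (hf0 : ∀ o y, ρ ≤ ‖y‖ → f o y = 0)
    (hfu : ∀ y, ‖y‖ < ρ / 2 → |f none y| ≤ Q * |u y|)
    (hfs : ∀ i y, ‖y‖ < ρ / 2 → f (some i) y = 0) (hfn : ∀ o y, |f o y| ≤ Q * n)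
    (hu : ∀ y, ‖y‖ < ρ / 2 → |u y| ≤ M * n * ‖y‖ ^ k)
    (hmom : ∀ j ≤ k, ∀ l : Fin j → Fin (m + 2), ∑ o, kerMoment m o (f o) l = 0)
    {x : EuclideanSpace ℝ (Fin (m + 2))} (hx : ‖x‖ ≤ ρ) :
    |∑ o, ∫ y, newtonKer m o (x - y) * f o y| ≤
      (m + 3) * (kapMass m * (8 * A) ^ (k + 1) * (Q * (M + (2 / ρ) ^ (k + 1)) *
        (1 + A ^ (k + 2) * 2 ^ (m + k + 2)))) * n * ‖x‖ ^ (k + 1) := by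
  have hK := kapMass_pos m
  set D : ℝ := Q * (M + (2 / ρ) ^ (k + 1)) with hD
  have hD0 : 0 ≤ D := by positivity
  have hbound : ∀ o, |(∫ y, newtonKer m o (x - y) * f o y) - ∑ j ∈ Finset.range (k + 1),
      (j.factorial : ℝ)⁻¹ * ∑ l : Fin j → Fin (m + 2), (∏ i, x (l i)) * kerMoment m o (f o) l|
      ≤ kapMass m * (8 * A) ^ (k + 1) * (D * n + A ^ (k + 2) * 2 ^ (m + k + 2) * (D * n))
        * ‖x‖ ^ (k + 1) := by
    intro o
    refine abs_integral_newtonKer_sub_moments_le hA (fun j z hz hz1 => hall j z hz hz1 o) (hfm o)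
      hρ1 (by positivity) (by positivity)
      (abs_density_le hρ hρ1 hQ hM hn hfu hfs hfn hu o) (hf0 o) (fun y z hz hz1 hyz hy => ?_) hx
    have hy0 : 0 < ‖y‖ := norm_pos_iff.2 hy
    cases o with
    | none =>
      calc _ ≤ A ^ (k + 1 + 1) * (k + 1).factorial * (‖z‖ ^ (m + (k + 1)))⁻¹ *
            (D * n * ‖y‖ ^ k) := by
            gcongr
            · exact hnone (k + 1) (by lia) z hz
            · exact abs_density_le hρ hρ1 hQ hM hn hfu hfs hfn hu none y
        _ = A ^ (k + 2) * (k + 1).factorial * (D * n) * ((‖z‖ ^ (m + 1 + k))⁻¹ * ‖y‖ ^ k) := by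
            rw [show m + 1 + k = m + (k + 1) by lia]; ring
        _ ≤ A ^ (k + 2) * (k + 1).factorial * (D * n) *
            (2 ^ (m + k + 2) * (‖y‖ ^ (m + 1))⁻¹) := by
            refine mul_le_mul_of_nonneg_left ((inv_pow_mul_pow_le hy0 hyz _ _).trans ?_)
              (by positivity)
            exact mul_le_mul_of_nonneg_right
              (pow_le_pow_right₀ one_le_two (by lia)) (by positivity)
        _ = _ := by rw [kap]; ring
    | some i =>
      calc _ ≤ A ^ (k + 1 + 1) * (k + 1).factorial * (‖z‖ ^ (m + 1 + (k + 1)))⁻¹ *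
            (Q * (0 + (2 / ρ) ^ (k + 1)) * n * ‖y‖ ^ (k + 1)) := by
            gcongr
            · exact hsome (k + 1) z hz i
            · rw [zero_add]; exact abs_density_some_le hρ hQ hn hfs hfn (k + 1) i y
        _ ≤ A ^ (k + 1 + 1) * (k + 1).factorial * (‖z‖ ^ (m + 1 + (k + 1)))⁻¹ *
            (D * n * ‖y‖ ^ (k + 1)) := by rw [hD]; gcongr
        _ = A ^ (k + 2) * (k + 1).factorial * (D * n) *
            ((‖z‖ ^ (m + 1 + (k + 1)))⁻¹ * ‖y‖ ^ (k + 1)) := by ring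
        _ ≤ A ^ (k + 2) * (k + 1).factorial * (D * n) *
            (2 ^ (m + k + 2) * (‖y‖ ^ (m + 1))⁻¹) := by
            refine mul_le_mul_of_nonneg_left ((inv_pow_mul_pow_le hy0 hyz _ _).trans ?_)
              (by positivity)
            rw [show m + 1 + (k + 1) = m + k + 2 by lia]
        _ = _ := by rw [kap]; ring
  have hpoly : ∑ o, ∑ j ∈ Finset.range (k + 1), (j.factorial : ℝ)⁻¹ *
      ∑ l : Fin j → Fin (m + 2), (∏ i, x (l i)) * kerMoment m o (f o) l = 0 := by
    rw [Finset.sum_comm]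
    refine Finset.sum_eq_zero fun j hj => ?_
    rw [← Finset.mul_sum, Finset.sum_comm]
    refine mul_eq_zero_of_right _ (Finset.sum_eq_zero fun l _ => ?_)
    rw [← Finset.mul_sum, hmom j (by simpa [Nat.lt_succ_iff] using hj) l, mul_zero]
  calc _ = |∑ o, ((∫ y, newtonKer m o (x - y) * f o y) - ∑ j ∈ Finset.range (k + 1),
      (j.factorial : ℝ)⁻¹ *
        ∑ l : Fin j → Fin (m + 2), (∏ i, x (l i)) * kerMoment m o (f o) l)| := by
        rw [Finset.sum_sub_distrib, hpoly, sub_zero]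
    _ ≤ _ := (Finset.abs_sum_le_sum_abs _ _).trans (Finset.sum_le_card_nsmul _ _ _ fun o _ =>
        hbound o)
    _ = _ := by
      rw [Finset.card_univ, Fintype.card_option, Fintype.card_fin, nsmul_eq_mul]
      push_cast; ring

end Step

theorem exists_growth_constant (m : ℕ) (K A Q P A₀ : ℝ) (hK : 0 ≤ K) (hA : 1 ≤ A) (hQ : 1 ≤ Q)
    (hP : 1 ≤ P) (hA₀ : 0 ≤ A₀) :
    ∃ T : ℝ, 1 ≤ T ∧ A₀ ≤ T ∧ (∀ k : ℕ, A₀ * P ^ (k + 1) ≤ T ^ ((k + 1) ^ 2 + 1)) ∧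
      ∀ k : ℕ, (m + 3) * (K * (8 * A) ^ (k + 1) * (Q * (T ^ (k ^ 2 + 1) + P ^ (k + 1)) *
        (1 + A ^ (k + 2) * 2 ^ (m + k + 2)))) ≤ T ^ ((k + 1) ^ 2 + 1) := by
  set τ : ℝ := m + 3 + K + 8 * A + Q + P + A₀ + 2 ^ m with hτ
  have h2m : (0 : ℝ) < 2 ^ m := by positivity
  have hm0 : (0 : ℝ) ≤ m := m.cast_nonneg
  have hτ1 : 1 ≤ τ := by linarith
  have hτ0 : 0 ≤ τ := by linarith
  have e1 : (m : ℝ) + 3 ≤ τ := by linarith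
  have e2 : K ≤ τ := by linarith
  have e3 : 8 * A ≤ τ := by linarith
  have e4 : Q ≤ τ := by linarith
  have e5 : P ≤ τ := by linarith
  have e6 : A₀ ≤ τ := by linarith
  have e7 : (2 : ℝ) ^ m ≤ τ := by linarith
  have e8 : A ≤ τ := by linarith
  have e9 : 2 ≤ τ := by linarith
  clear_value τ
  refine ⟨τ ^ 11, one_le_pow₀ hτ1, e6.trans (le_self_pow₀ hτ1 (by norm_num)), fun k => ?_,
    fun k => ?_⟩
  · calc _ ≤ τ * τ ^ (k + 1) := by gcongr
      _ = τ ^ (k + 2) := by ring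
      _ ≤ _ := by
        rw [← pow_mul]; exact pow_le_pow_right₀ hτ1 (by nlinarith)
  · have a1 : P ^ (k + 1) ≤ (τ ^ 11) ^ (k ^ 2 + 1) := by
      calc _ ≤ τ ^ (k + 1) := by gcongr
        _ ≤ _ := by rw [← pow_mul]; exact pow_le_pow_right₀ hτ1 (by nlinarith)
    have a2 : 1 + A ^ (k + 2) * 2 ^ (m + k + 2) ≤ τ * (τ ^ (k + 2) * (τ * τ ^ (k + 2))) := by
      have b1 : A ^ (k + 2) * 2 ^ (m + k + 2) ≤ τ ^ (k + 2) * (τ * τ ^ (k + 2)) := by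
        rw [add_assoc m, pow_add 2 m]
        gcongr
      have b2 : 1 ≤ τ ^ (k + 2) * (τ * τ ^ (k + 2)) := by
        have := one_le_pow₀ hτ1 (n := k + 2)
        exact one_le_mul_of_one_le_of_one_le this (one_le_mul_of_one_le_of_one_le hτ1 this)
      nlinarith
    have a3 : (τ ^ 11) ^ (k ^ 2 + 1) + P ^ (k + 1) ≤ τ * (τ ^ 11) ^ (k ^ 2 + 1) := by
      have : 0 ≤ (τ ^ 11) ^ (k ^ 2 + 1) := by positivity
      nlinarith
    calc _ ≤ τ * (τ * τ ^ (k + 1) * (τ * (τ * (τ ^ 11) ^ (k ^ 2 + 1)) *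
          (τ * (τ ^ (k + 2) * (τ * τ ^ (k + 2)))))) := by gcongr
      _ = τ ^ (3 * k + 11 + 11 * (k ^ 2 + 1)) := by
        rw [← pow_mul, pow_add τ (3 * k + 11)]
        generalize τ ^ (11 * (k ^ 2 + 1)) = Z
        ring
      _ ≤ _ := by
        rw [← pow_mul]; exact pow_le_pow_right₀ hτ1 (by nlinarith)

theorem kerMoment_comp_perm (m : ℕ) (o : Option (Fin (m + 2)))
    (f : EuclideanSpace ℝ (Fin (m + 2)) → ℝ) {k : ℕ} (l : Fin k → Fin (m + 2))
    (σ : Equiv.Perm (Fin k)) : kerMoment m o f (l ∘ σ) = kerMoment m o f l := by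
  refine integral_congr_ae ?_
  filter_upwards [ae_ne (0 : EuclideanSpace ℝ (Fin (m + 2)))] with y hy
  rw [kerEntry_comp_perm m o l σ (by simpa using hy)]

theorem sum_kerMoment_snoc_snoc {m : ℕ} {o : Option (Fin (m + 2))}
    {f : EuclideanSpace ℝ (Fin (m + 2)) → ℝ} {k : ℕ}
    (hf : ∀ l : Fin k → Fin (m + 2), Integrable fun y => kerEntry m o l (0 - y) * f y)
    (k' : ℕ) (hk : k = k' + 2) (l : Fin k' → Fin (m + 2)) :
    ∑ a, kerMoment m o f (fun i => Fin.snoc (α := fun _ => Fin (m + 2))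
      (Fin.snoc (α := fun _ => Fin (m + 2)) l a) a (Fin.cast hk i)) = 0 := by
  subst hk
  simp only [Fin.cast_refl, id_eq]
  unfold kerMoment
  rw [← integral_finsetSum _ fun a _ => hf _]
  refine integral_eq_zero_of_ae ?_
  filter_upwards [ae_ne (0 : EuclideanSpace ℝ (Fin (m + 2)))] with y hy
  rw [← Finset.sum_mul, sum_kerEntry_snoc_snoc m o l (by simpa using hy), zero_mul, Pi.zero_apply]

/-- The linear map of evaluation of the total moments on a space of densities. -/
noncomputable def momentMap {X ι : Type*} [AddCommGroup X] [Module ℝ X] (m k : ℕ)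
    (f : Option (Fin (m + 2)) → X →ₗ[ℝ] (EuclideanSpace ℝ (Fin (m + 2)) → ℝ))
    (rep : ι → Fin k → Fin (m + 2))
    (hf : ∀ o v (l : Fin k → Fin (m + 2)), Integrable fun y => kerEntry m o l (0 - y) * f o v y) :
    X →ₗ[ℝ] (ι → ℝ) where
  toFun v κ := ∑ o, kerMoment m o (f o v) (rep κ)
  map_add' v w := by
    ext κ
    simp only [Pi.add_apply, ← Finset.sum_add_distrib]
    refine Finset.sum_congr rfl fun o _ => ?_
    unfold kerMoment
    rw [← integral_add (hf o v _) (hf o w _)]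
    simp only [map_add, Pi.add_apply, mul_add]
  map_smul' c v := by
    ext κ
    simp only [Pi.smul_apply, smul_eq_mul, RingHom.id_apply, Finset.mul_sum]
    refine Finset.sum_congr rfl fun o _ => ?_
    unfold kerMoment
    rw [← integral_const_mul]
    simp only [map_smul, Pi.smul_apply, smul_eq_mul]
    congr 1; ext y; ring

theorem finrank_le_finrank_ker_add {X ι : Type*} [AddCommGroup X] [Module ℝ X]
    [FiniteDimensional ℝ X] [Fintype ι] (L : X →ₗ[ℝ] (ι → ℝ)) :
    Module.finrank ℝ X ≤ Module.finrank ℝ (LinearMap.ker L) + Fintype.card ι := by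
  rw [← L.finrank_range_add_finrank_ker, add_comm]
  gcongr
  exact (Submodule.finrank_le _).trans_eq (Module.finrank_fintype_fun_eq_card ℝ)

theorem exists_submodule_abs_le {X : Type*} [AddCommGroup X] [Module ℝ X]
    [FiniteDimensional ℝ X] {m : ℕ} {A Q ρ A₀ T : ℝ} {n : X → ℝ}
    (u : X →ₗ[ℝ] (EuclideanSpace ℝ (Fin (m + 2)) → ℝ))
    (f : Option (Fin (m + 2)) → X →ₗ[ℝ] (EuclideanSpace ℝ (Fin (m + 2)) → ℝ))
    (hA : 1 ≤ A)
    (hsome : ∀ j : ℕ, ∀ z : EuclideanSpace ℝ (Fin (m + 2)), z ≠ 0 → ∀ i,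
      ‖iteratedFDeriv ℝ j (newtonKer m (some i)) z‖
        ≤ A ^ (j + 1) * j.factorial * (‖z‖ ^ (m + 1 + j))⁻¹)
    (hnone : ∀ j : ℕ, 1 ≤ j → ∀ z : EuclideanSpace ℝ (Fin (m + 2)), z ≠ 0 →
      ‖iteratedFDeriv ℝ j (newtonKer m none) z‖
        ≤ A ^ (j + 1) * j.factorial * (‖z‖ ^ (m + j))⁻¹)
    (hall : ∀ j : ℕ, ∀ z : EuclideanSpace ℝ (Fin (m + 2)), z ≠ 0 → ‖z‖ ≤ 1 → ∀ o,
      ‖iteratedFDeriv ℝ j (newtonKer m o) z‖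
        ≤ A ^ (j + 1) * j.factorial * (‖z‖ ^ (m + 1 + j))⁻¹)
    (hρ : 0 < ρ) (hρ1 : ρ ≤ 1 / 2) (hQ : 1 ≤ Q) (hn : ∀ v, 0 ≤ n v)
    (hfm : ∀ o v, AEStronglyMeasurable (f o v) volume)
    (hf0 : ∀ o v y, ρ ≤ ‖y‖ → f o v y = 0)
    (hfu : ∀ v y, ‖y‖ < ρ / 2 → |f none v y| ≤ Q * |u v y|)
    (hfs : ∀ i v y, ‖y‖ < ρ / 2 → f (some i) v y = 0) (hfn : ∀ o v y, |f o v y| ≤ Q * n v)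
    (hu : ∀ v y, ‖y‖ < ρ → |u v y| ≤ A₀ * n v)
    (hrep : ∀ v x, ‖x‖ < ρ / 2 → u v x = ∑ o, ∫ y, newtonKer m o (x - y) * f o v y)
    (hT1 : 1 ≤ T) (hT0 : A₀ ≤ T)
    (hT : ∀ k : ℕ, A₀ * (2 / ρ) ^ (k + 1) ≤ T ^ ((k + 1) ^ 2 + 1))
    (hTs : ∀ k : ℕ, (m + 3) * (kapMass m * (8 * A) ^ (k + 1) *
      (Q * (T ^ (k ^ 2 + 1) + (2 / ρ) ^ (k + 1)) *
        (1 + A ^ (k + 2) * 2 ^ (m + k + 2)))) ≤ T ^ ((k + 1) ^ 2 + 1)) (k : ℕ) :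
    ∃ S : Submodule ℝ X,
      Module.finrank ℝ X ≤ Module.finrank ℝ S + ∑ j ∈ Finset.range k, 2 * (j + 1) ^ m ∧
      (∀ v ∈ S, ∀ y, ‖y‖ < ρ → |u v y| ≤ T ^ (k ^ 2 + 1) * n v * ‖y‖ ^ k) ∧
      ∀ v ∈ S, ∀ j < k, ∀ l : Fin j → Fin (m + 2), ∑ o, kerMoment m o (f o v) l = 0 := by
  induction k with
  | zero =>
    refine ⟨⊤, by simp, fun v _ y hy => ?_, fun v _ j hj => absurd hj (Nat.not_lt_zero j)⟩
    refine (hu v y hy).trans ?_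
    have := hn v
    simpa using mul_le_mul_of_nonneg_right hT0 this
  | succ k ih =>
    obtain ⟨S, hS, hb, hmom⟩ := ih
    have hT0' : 0 ≤ T := by linarith
    have hb2 : ∀ v ∈ S, ∀ y, ‖y‖ < ρ / 2 → |u v y| ≤ T ^ (k ^ 2 + 1) * n v * ‖y‖ ^ k :=
      fun v hv y hy => hb v hv y (by linarith)
    have hintg : ∀ o (v : S) (l : Fin k → Fin (m + 2)),
        Integrable fun y => kerEntry m o l (0 - y) * (f o ∘ₗ S.subtype) v y := fun o v l =>
      integrable_kerEntry_mul hA (fun j z hz hz1 => hall j z hz hz1 o) (hfm o v) hρ1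
        (M := Q * (T ^ (k ^ 2 + 1) + (2 / ρ) ^ (k + 1)) * n v)
        (mul_nonneg (by positivity) (hn v))
        (abs_density_le (f := fun o => f o v) hρ hρ1 hQ (by positivity) (hn v) (hfu v)
          (fun i y => hfs i v y) (fun o y => hfn o v y) (hb2 v v.2) o)
        (hf0 o v) le_rfl l
    obtain ⟨rep, hrep'⟩ := exists_determining_entries m k
    set Λ := momentMap m k (fun o => f o ∘ₗ S.subtype) rep hintg with hΛ
    have hmem : ∀ v ∈ (LinearMap.ker Λ).map S.subtype, v ∈ S ∧
        ∀ l : Fin k → Fin (m + 2), ∑ o, kerMoment m o (f o v) l = 0 := by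
      rintro _ ⟨v, hv, rfl⟩
      refine ⟨v.2, hrep' _ (fun l σ => ?_) (fun k' hk l => ?_) fun κ => ?_⟩
      · exact Finset.sum_congr rfl fun o _ => kerMoment_comp_perm m o _ l σ
      · rw [Finset.sum_comm]
        exact Finset.sum_eq_zero fun o _ => sum_kerMoment_snoc_snoc (hintg o v) k' hk l
      · exact congrFun (LinearMap.mem_ker.1 hv) κ
    have hmom' : ∀ v ∈ (LinearMap.ker Λ).map S.subtype, ∀ j ≤ k, ∀ l : Fin j → Fin (m + 2),
        ∑ o, kerMoment m o (f o v) l = 0 := by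
      intro v hv j hj
      rcases hj.lt_or_eq with h | rfl
      · exact hmom v (hmem v hv).1 j h
      · exact (hmem v hv).2
    refine ⟨(LinearMap.ker Λ).map S.subtype, ?_, fun v hv y hy => ?_,
      fun v hv j hj => hmom' v hv j (Nat.lt_succ_iff.1 hj)⟩
    · have h1 := finrank_le_finrank_ker_add Λ
      rw [Fintype.card_prod, Fintype.card_fun, Fintype.card_fin, Fintype.card_fin,
        Fintype.card_fin] at h1
      rw [Finset.sum_range_succ, Submodule.finrank_map_subtype_eq]
      lia
    · rcases lt_or_ge ‖y‖ (ρ / 2) with h | h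
      · rw [hrep v y h]
        refine (abs_sum_integral_newtonKer_mul_le (f := fun o => f o v) hA hsome hnone hall
          (fun o => hfm o v) hρ hρ1 hQ (by positivity) (hn v) (fun o => hf0 o v) (hfu v)
          (fun i => hfs i v) (fun o => hfn o v) (hb2 v (hmem v hv).1) (hmom' v hv) hy.le).trans ?_
        have := hn v
        gcongr
        exact hTs k
      · have := hn v
        have hA₀ : 0 ≤ A₀ * n v := (abs_nonneg _).trans (hu v y hy)
        calc _ ≤ A₀ * n v * 1 := by rw [mul_one]; exact hu v y hy
          _ ≤ A₀ * n v * ((2 / ρ) ^ (k + 1) * ‖y‖ ^ (k + 1)) := by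
            gcongr; exact one_le_two_div_mul_pow hρ h _
          _ = A₀ * (2 / ρ) ^ (k + 1) * n v * ‖y‖ ^ (k + 1) := by ring
          _ ≤ _ := by gcongr; exact hT k

section Correction

variable {m : ℕ} {V G ρ : ℝ} {W : EuclideanSpace ℝ (Fin (m + 2)) → ℝ}

theorem measurable_newton (m : ℕ) (ε : ℝ) : Measurable (newton m ε) := by
  unfold newton
  refine Measurable.comp (g := newtonProfile m) ?_ (by fun_prop)
  unfold newtonProfile
  by_cases hm : m = 0
  · simp only [hm, if_true]; fun_prop
  · simp only [hm, if_false]; fun_prop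

theorem abs_newton_mul_cutoffAt_le (hρ : 0 < ρ) (hρ1 : ρ ≤ 1 / 2)
    {h : EuclideanSpace ℝ (Fin (m + 2)) → ℝ} (hb : ∀ y, |h y| ≤ G)
    {x : EuclideanSpace ℝ (Fin (m + 2))} (hx : ‖x‖ < ρ) (y : EuclideanSpace ℝ (Fin (m + 2)))
    (hy : y ≠ x) : |newton m 0 (x - y) * (cutoffAt 0 ρ y * h y)| ≤ 2 * G * kap m (x - y) := by
  have hG : 0 ≤ G := (abs_nonneg _).trans (hb y)
  have hκ := kap_nonneg m (x - y)
  rcases le_or_gt ρ ‖y‖ with h1 | h1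
  · rw [cutoffAt_eq_zero hρ (by rw [sub_zero]; linarith), zero_mul, mul_zero, abs_zero]
    positivity
  · have h2 : |newton m 0 (x - y)| ≤ 2 * kap m (x - y) :=
      abs_newtonKer_le m none (sub_ne_zero.2 hy.symm) ((norm_sub_le x y).trans (by linarith))
    have h3 : |cutoffAt 0 ρ y| ≤ 1 := by
      rw [abs_of_nonneg (cutoffAt_nonneg _ _ _)]; exact cutoffAt_le_one _ _ _
    calc _ = |newton m 0 (x - y)| * (|cutoffAt 0 ρ y| * |h y|) := by rw [abs_mul, abs_mul]
      _ ≤ 2 * kap m (x - y) * (1 * G) := by gcongr; exact hb y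
      _ = _ := by ring

theorem integrable_newton_mul_cutoffAt (hρ : 0 < ρ) (hρ1 : ρ ≤ 1 / 2)
    {h : EuclideanSpace ℝ (Fin (m + 2)) → ℝ} (hm : Measurable h) (hb : ∀ y, |h y| ≤ G)
    {x : EuclideanSpace ℝ (Fin (m + 2))} (hx : ‖x‖ < ρ) :
    Integrable fun y => newton m 0 (x - y) * (cutoffAt 0 ρ y * h y) := by
  have hc := (contDiff_cutoffAt (0 : EuclideanSpace ℝ (Fin (m + 2))) ρ).continuous.measurable
  refine integrable_of_abs_le_kap
    (((measurable_newton m 0).comp (measurable_const.sub measurable_id)).mul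
      (hc.mul hm)).aestronglyMeasurable x (2 * G) ρ
    (abs_newton_mul_cutoffAt_le hρ hρ1 hb hx) fun y hy => ?_
  rw [cutoffAt_eq_zero hρ (by rw [sub_zero]; linarith), zero_mul, mul_zero]

theorem integral_abs_newton_mul_cutoffAt_le (hρ : 0 < ρ) (hρ1 : ρ ≤ 1 / 2)
    {h : EuclideanSpace ℝ (Fin (m + 2)) → ℝ} (hm : Measurable h) (hb : ∀ y, |h y| ≤ G)
    {x : EuclideanSpace ℝ (Fin (m + 2))} (hx : ‖x‖ < ρ) :
    ∫ y, |newton m 0 (x - y) * (cutoffAt 0 ρ y * h y)| ≤ 4 * kapMass m * ρ * G := by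
  have hG : 0 ≤ G := (abs_nonneg _).trans (hb 0)
  have hs : ∀ y, y ∉ Metric.ball (0 : EuclideanSpace ℝ (Fin (m + 2))) ρ →
      |newton m 0 (x - y) * (cutoffAt 0 ρ y * h y)| = 0 := by
    intro y hy
    rw [mem_ball_zero_iff, not_lt] at hy
    rw [cutoffAt_eq_zero hρ (by rw [sub_zero]; linarith), zero_mul, mul_zero, abs_zero]
  rw [← setIntegral_eq_integral_of_forall_compl_eq_zero hs]
  calc _ ≤ ∫ y in Metric.ball 0 ρ, 2 * G * kap m (x - y) := by
        refine integral_mono_ae (integrable_newton_mul_cutoffAt hρ hρ1 hm hb hx).abs.integrableOn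
          ((integrableOn_kap_sub_ball_zero m x ρ).const_mul _) ?_
        filter_upwards [ae_restrict_of_ae (ae_ne x)] with y hy using
          abs_newton_mul_cutoffAt_le hρ hρ1 hb hx y hy
    _ ≤ 2 * G * (kapMass m * (ρ + ρ)) := by
        rw [integral_const_mul]
        have := kapMass_pos m
        gcongr
        exact (setIntegral_kap_sub_ball_zero_le m x hρ.le).trans (by gcongr)
    _ = _ := by ring

/-- The kernel of the integral operator inverting the potential term near the origin. -/
noncomputable def corrKer (m : ℕ) (ρ : ℝ) (W : EuclideanSpace ℝ (Fin (m + 2)) → ℝ)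
    (x y : EuclideanSpace ℝ (Fin (m + 2))) : ℝ :=
  (Metric.ball 0 ρ).indicator (fun x => ((m + 2) * newtonMass m)⁻¹ *
    (newton m 0 (x - y) * (cutoffAt 0 ρ y * W y))) x

theorem measurable_corrKer (hWm : Measurable W) :
    Measurable (Function.uncurry (corrKer m ρ W)) := by
  have hc := (contDiff_cutoffAt (0 : EuclideanSpace ℝ (Fin (m + 2))) ρ).continuous.measurable
  have h1 : Measurable fun p : EuclideanSpace ℝ (Fin (m + 2)) × EuclideanSpace ℝ (Fin (m + 2)) =>
      ((m + 2) * newtonMass m)⁻¹ * (newton m 0 (p.1 - p.2) * (cutoffAt 0 ρ p.2 * W p.2)) :=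
    measurable_const.mul (((measurable_newton m 0).comp
      (measurable_fst.sub measurable_snd)).mul ((hc.mul hWm).comp measurable_snd))
  exact h1.indicator (s := Prod.fst ⁻¹' Metric.ball 0 ρ) (measurable_fst measurableSet_ball)

theorem integrable_corrKer (hρ : 0 < ρ) (hρ1 : ρ ≤ 1 / 2) (hWm : Measurable W)
    (hW : ∀ y, |W y| ≤ V) (x : EuclideanSpace ℝ (Fin (m + 2))) :
    Integrable (corrKer m ρ W x) := by
  by_cases hx : x ∈ Metric.ball 0 ρ
  · have h := (integrable_newton_mul_cutoffAt hρ hρ1 hWm hW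
      (mem_ball_zero_iff.1 hx)).const_mul ((m + 2) * newtonMass m)⁻¹
    refine h.congr (Filter.Eventually.of_forall fun y => ?_)
    simp only [corrKer, Set.indicator_of_mem hx]
  · have : corrKer m ρ W x = 0 := by
      ext y; simp only [corrKer, Set.indicator_of_notMem hx, Pi.zero_apply]
    rw [this]; exact integrable_zero _ _ _

theorem integral_abs_corrKer_le (hρ : 0 < ρ) (hρ1 : ρ ≤ 1 / 2)
    (hs : 8 * kapMass m * ρ * (V + 1) ≤ (m + 2) * newtonMass m) (hWm : Measurable W)
    (hW : ∀ y, |W y| ≤ V) (x : EuclideanSpace ℝ (Fin (m + 2))) :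
    ∫ y, |corrKer m ρ W x y| ≤ 1 / 2 := by
  have hc : 0 < (m + 2) * newtonMass m := mul_pos (by positivity) (newtonMass_pos m)
  by_cases hx : x ∈ Metric.ball 0 ρ
  · simp only [corrKer, Set.indicator_of_mem hx, abs_mul ((m + 2) * newtonMass m)⁻¹,
      integral_const_mul]
    rw [abs_of_pos (by positivity), inv_mul_le_iff₀ hc]
    refine (integral_abs_newton_mul_cutoffAt_le hρ hρ1 hWm hW (mem_ball_zero_iff.1 hx)).trans ?_
    have := mul_pos (kapMass_pos m) hρ
    nlinarith
  · simp only [corrKer, Set.indicator_of_notMem hx, abs_zero, integral_zero]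
    norm_num

theorem mul_integral_corrKer_mul {x : EuclideanSpace ℝ (Fin (m + 2))} (hx : ‖x‖ < ρ)
    (w : EuclideanSpace ℝ (Fin (m + 2)) → ℝ) :
    (m + 2) * newtonMass m * ∫ y, corrKer m ρ W x y * w y
      = ∫ y, newton m 0 (x - y) * (cutoffAt 0 ρ y * (W y * w y)) := by
  have hc : 0 < (m + 2) * newtonMass m := mul_pos (by positivity) (newtonMass_pos m)
  rw [← integral_const_mul]
  congr 1; ext y
  rw [corrKer, Set.indicator_of_mem (mem_ball_zero_iff.2 hx), mul_assoc _⁻¹, mul_inv_cancel_left₀ hc.ne']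
  ring

theorem exists_correction (hρ : 0 < ρ) (hρ1 : ρ ≤ 1 / 2) (hV : 0 ≤ V)
    (hs : 8 * kapMass m * ρ * (V + 1) ≤ (m + 2) * newtonMass m) (hWm : Measurable W)
    (hW : ∀ y, |W y| ≤ V) {g : EuclideanSpace ℝ (Fin (m + 2)) → ℝ} (hgm : Measurable g)
    (hg : ∀ y, |g y| ≤ G) :
    ∃ w : EuclideanSpace ℝ (Fin (m + 2)) → ℝ, Measurable w ∧ (∀ x, |w x| ≤ G) ∧
      (∀ x, ρ ≤ ‖x‖ → w x = 0) ∧ ∀ x, ‖x‖ < ρ → (m + 2) * newtonMass m * w x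
        = ∫ y, newton m 0 (x - y) * (cutoffAt 0 ρ y * (W y * w y - g y)) := by
  have hc : 0 < (m + 2) * newtonMass m := mul_pos (by positivity) (newtonMass_pos m)
  have hG : 0 ≤ G := (abs_nonneg _).trans (hg 0)
  have hKρ := mul_pos (kapMass_pos m) hρ
  set b : EuclideanSpace ℝ (Fin (m + 2)) → ℝ := (Metric.ball 0 ρ).indicator fun x =>
    -(((m + 2) * newtonMass m)⁻¹ * ∫ y, newton m 0 (x - y) * (cutoffAt 0 ρ y * g y)) with hb
  have hcut := (contDiff_cutoffAt (0 : EuclideanSpace ℝ (Fin (m + 2))) ρ).continuous.measurable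
  have hbm : Measurable b := by
    refine Measurable.indicator ?_ measurableSet_ball
    have h : StronglyMeasurable (Function.uncurry fun x y : EuclideanSpace ℝ (Fin (m + 2)) =>
        newton m 0 (x - y) * (cutoffAt 0 ρ y * g y)) :=
      (((measurable_newton m 0).comp (measurable_fst.sub measurable_snd)).mul
        ((hcut.mul hgm).comp measurable_snd)).stronglyMeasurable
    exact (h.integral_prod_right.measurable.const_mul _).neg
  have hbb : ∀ x, |b x| ≤ G / 2 := by
    intro x
    by_cases hx : x ∈ Metric.ball 0 ρ
    · rw [hb, Set.indicator_of_mem hx, abs_neg, abs_mul, abs_of_pos (by positivity),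
        inv_mul_le_iff₀ hc]
      refine (abs_integral_le_integral_abs).trans ((integral_abs_newton_mul_cutoffAt_le hρ hρ1
        hgm hg (mem_ball_zero_iff.1 hx)).trans ?_)
      nlinarith [mul_nonneg (mul_nonneg hKρ.le hV) hG]
    · rw [hb, Set.indicator_of_notMem hx, abs_zero]; positivity
  obtain ⟨w, hwm, hwb, hw⟩ := exists_solution_of_integral_abs_le_half
    (measurable_corrKer hWm) (integrable_corrKer hρ hρ1 hWm hW)
    (integral_abs_corrKer_le hρ hρ1 hs hWm hW) hbm (by positivity) hbb
  have hwb' : ∀ x, |w x| ≤ G := fun x => (hwb x).trans_eq (by ring)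
  refine ⟨w, hwm, hwb', fun x hx => ?_, fun x hx => ?_⟩
  · have hx' : x ∉ Metric.ball 0 ρ := by simpa using hx
    rw [hw x, hb, Set.indicator_of_notMem hx']
    simp only [corrKer, Set.indicator_of_notMem hx', zero_mul, integral_zero, add_zero]
  · have hi1 : Integrable fun y => newton m 0 (x - y) * (cutoffAt 0 ρ y * (W y * w y)) :=
      integrable_newton_mul_cutoffAt hρ hρ1 (hWm.mul hwm) (G := V * G) (fun y => by
        rw [Pi.mul_apply, abs_mul]
        exact mul_le_mul (hW y) (hwb' y) (abs_nonneg _) hV) hx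
    have hi2 := integrable_newton_mul_cutoffAt hρ hρ1 hgm hg hx
    rw [hw x, mul_add, mul_integral_corrKer_mul hx, hb,
      Set.indicator_of_mem (mem_ball_zero_iff.2 hx), mul_neg, mul_inv_cancel_left₀ hc.ne',
      neg_add_eq_sub, ← integral_sub hi1 hi2]
    congr 1; ext y; ring

theorem eq_zero_of_correction_equation (hρ : 0 < ρ) (hρ1 : ρ ≤ 1 / 2)
    (hs : 8 * kapMass m * ρ * (V + 1) ≤ (m + 2) * newtonMass m) (hWm : Measurable W)
    (hW : ∀ y, |W y| ≤ V) {w : EuclideanSpace ℝ (Fin (m + 2)) → ℝ} (hwb : ∀ x, |w x| ≤ G)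
    (hw0 : ∀ x, ρ ≤ ‖x‖ → w x = 0) (hw : ∀ x, ‖x‖ < ρ → (m + 2) * newtonMass m * w x
        = ∫ y, newton m 0 (x - y) * (cutoffAt 0 ρ y * (W y * w y))) : w = 0 := by
  have hc : 0 < (m + 2) * newtonMass m := mul_pos (by positivity) (newtonMass_pos m)
  ext x
  have := abs_le_of_eq_add_integral (integrable_corrKer hρ hρ1 hWm hW)
    (integral_abs_corrKer_le hρ hρ1 hs hWm hW) (b := 0) (β := 0) (by simp) hwb (fun x => ?_) x
  · rwa [mul_zero, abs_nonpos_iff] at this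
  · rw [Pi.zero_apply, zero_add]
    rcases lt_or_ge ‖x‖ ρ with hx | hx
    · rw [← mul_right_inj' hc.ne', hw x hx, mul_integral_corrKer_mul hx]
    · have hx' : x ∉ Metric.ball 0 ρ := by simpa using hx
      rw [hw0 x hx]
      simp only [corrKer, Set.indicator_of_notMem hx', zero_mul, integral_zero]

theorem exists_linear_correction (hρ : 0 < ρ) (hρ1 : ρ ≤ 1 / 2) (hV : 0 ≤ V)
    (hs : 8 * kapMass m * ρ * (V + 1) ≤ (m + 2) * newtonMass m) (hWm : Measurable W)
    (hW : ∀ y, |W y| ≤ V) {X : Type*} [AddCommGroup X] [Module ℝ X]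
    (g : X →ₗ[ℝ] (EuclideanSpace ℝ (Fin (m + 2)) → ℝ)) {N : X → ℝ}
    (hgm : ∀ v, Measurable (g v)) (hg : ∀ v y, |g v y| ≤ N v) :
    ∃ w : X →ₗ[ℝ] (EuclideanSpace ℝ (Fin (m + 2)) → ℝ), (∀ v, Measurable (w v)) ∧
      (∀ v x, |w v x| ≤ N v) ∧ ∀ v x, ‖x‖ < ρ → (m + 2) * newtonMass m * w v x
        = ∫ y, newton m 0 (x - y) * (cutoffAt 0 ρ y * (W y * w v y - g v y)) := by
  choose w hwm hwb hw0 hw using fun v => exists_correction hρ hρ1 hV hs hWm hW (hgm v) (hg v)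
  have hi : ∀ v x, ‖x‖ < ρ → Integrable fun y =>
      newton m 0 (x - y) * (cutoffAt 0 ρ y * (W y * w v y - g v y)) := fun v x hx =>
    integrable_newton_mul_cutoffAt hρ hρ1 ((hWm.mul (hwm v)).sub (hgm v)) (G := V * N v + N v)
      (fun y => by
        simp only [Pi.mul_apply, Pi.sub_apply]
        refine (abs_sub _ _).trans (add_le_add ?_ (hg v y))
        rw [abs_mul]
        exact mul_le_mul (hW y) (hwb v y) (abs_nonneg _) hV) hx
  refine ⟨⟨⟨w, fun a b => ?_⟩, fun t a => ?_⟩, hwm, hwb, hw⟩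
  · rw [← sub_eq_zero]
    refine eq_zero_of_correction_equation hρ hρ1 hs hWm hW (G := N (a + b) + (N a + N b))
      (fun x => ?_) (fun x hx => ?_) fun x hx => ?_
    · exact (abs_sub _ _).trans (add_le_add (hwb _ x) ((abs_add_le _ _).trans
        (add_le_add (hwb a x) (hwb b x))))
    · simp only [Pi.sub_apply, Pi.add_apply, hw0 _ x hx]; ring
    · simp only [Pi.sub_apply, Pi.add_apply, mul_sub, mul_add]
      have hab : Integrable fun y => newton m 0 (x - y) * (cutoffAt 0 ρ y * (W y * w a y - g a y))
          + newton m 0 (x - y) * (cutoffAt 0 ρ y * (W y * w b y - g b y)) :=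
        (hi a x hx).add (hi b x hx)
      rw [hw _ x hx, hw _ x hx, hw _ x hx, ← integral_add (hi a x hx) (hi b x hx),
        ← integral_sub (hi (a + b) x hx) hab]
      congr 1; ext y
      simp only [map_add, Pi.add_apply]; ring
  · rw [← sub_eq_zero]
    refine eq_zero_of_correction_equation hρ hρ1 hs hWm hW (G := N (t • a) + |t| * N a)
      (fun x => ?_) (fun x hx => ?_) fun x hx => ?_
    · refine (abs_sub _ _).trans (add_le_add (hwb _ x) ?_)
      rw [RingHom.id_apply, Pi.smul_apply, smul_eq_mul, abs_mul]
      exact mul_le_mul_of_nonneg_left (hwb a x) (abs_nonneg t)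
    · simp only [Pi.sub_apply, Pi.smul_apply, RingHom.id_apply, smul_eq_mul, hw0 _ x hx]; ring
    · simp only [Pi.sub_apply, Pi.smul_apply, RingHom.id_apply, smul_eq_mul, mul_sub]
      rw [hw _ x hx, mul_left_comm, hw _ x hx, ← integral_const_mul,
        ← integral_sub (hi (t • a) x hx) ((hi a x hx).const_mul t)]
      congr 1; ext y
      simp only [map_smul, Pi.smul_apply, smul_eq_mul]; ring

end Correction

theorem lap_add {d : ℕ} {f g : EuclideanSpace ℝ (Fin d) → ℝ} (hf : ContDiff ℝ 2 f)
    (hg : ContDiff ℝ 2 g) : lap (f + g) = lap f + lap g := by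
  ext x
  have h1 : ∀ {h : EuclideanSpace ℝ (Fin d) → ℝ}, ContDiff ℝ 2 h → ∀ i,
      Differentiable ℝ (partialD i h) := fun hh i =>
    (ContDiff.partialD (n := 1) (by simpa [one_add_one_eq_two] using hh) i).differentiable
      (by norm_num)
  have h0 : ∀ i, partialD i (f + g) = partialD i f + partialD i g := fun i => by
    ext y
    simp [partialD, fderiv_add (hf.differentiable (by norm_num) y)
      (hg.differentiable (by norm_num) y)]
  simp only [lap_eq_sum_partialD, Pi.add_apply, h0, ← Finset.sum_add_distrib]
  refine Finset.sum_congr rfl fun i _ => ?_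
  simp [partialD, fderiv_add (h1 hf i x) (h1 hg i x)]

theorem lap_smul {d : ℕ} (t : ℝ) {f : EuclideanSpace ℝ (Fin d) → ℝ} (hf : ContDiff ℝ 2 f) :
    lap (t • f) = t • lap f := by
  ext x
  have h1 : ∀ i, Differentiable ℝ (partialD i f) := fun i =>
    (ContDiff.partialD (n := 1) (by simpa [one_add_one_eq_two] using hf) i).differentiable
      (by norm_num)
  have h0 : ∀ i, partialD i (t • f) = t • partialD i f := fun i => by
    ext y
    simp [partialD, fderiv_const_smul (hf.differentiable (by norm_num) y)]
  simp only [lap_eq_sum_partialD, Pi.smul_apply, h0, Finset.smul_sum]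
  refine Finset.sum_congr rfl fun i _ => ?_
  simp [partialD, fderiv_const_smul (h1 i x)]

theorem exists_density {m : ℕ} {V ρ A₀ G Q : ℝ} (hρ : 0 < ρ) (hρ1 : ρ ≤ 1 / 2) (hV : 0 ≤ V)
    (hs : 8 * kapMass m * ρ * (V + 1) ≤ (m + 2) * newtonMass m) (hA₀ : 0 ≤ A₀)
    (hQ1 : ∀ i (y : EuclideanSpace ℝ (Fin (m + 2))), |partialD i cutoff y| ≤ Q)
    (hQ2 : ∀ y : EuclideanSpace ℝ (Fin (m + 2)), |lap cutoff y| ≤ Q)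
    {W : EuclideanSpace ℝ (Fin (m + 2)) → ℝ} (hWm : Measurable W) (hW : ∀ y, |W y| ≤ V)
    {X : Type*} [AddCommGroup X] [Module ℝ X]
    (Ψ : X →ₗ[ℝ] (EuclideanSpace ℝ (Fin (m + 2)) → ℝ)) {n : X → ℝ} (hn : ∀ v, 0 ≤ n v)
    (hG0 : 0 ≤ G) (hG : G ≤ A₀) (hΨ : ∀ v, ContDiff ℝ 2 (Ψ v))
    (hΨG : ∀ v y, ‖y‖ < ρ → |W y * Ψ v y - lap (Ψ v) y| ≤ G * n v)
    (hΨA : ∀ v y, ‖y‖ < ρ → |Ψ v y| ≤ A₀ * n v) :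
    ∃ (u : X →ₗ[ℝ] (EuclideanSpace ℝ (Fin (m + 2)) → ℝ))
      (f : Option (Fin (m + 2)) → X →ₗ[ℝ] (EuclideanSpace ℝ (Fin (m + 2)) → ℝ)),
      (∀ v y, |Ψ v y - u v y| ≤ G * n v) ∧ (∀ o v, Measurable (f o v)) ∧
      (∀ o v y, ρ ≤ ‖y‖ → f o v y = 0) ∧
      (∀ v y, ‖y‖ < ρ / 2 → |f none v y| ≤ V / ((m + 2) * newtonMass m) * |u v y|) ∧
      (∀ i v y, ‖y‖ < ρ / 2 → f (some i) v y = 0) ∧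
      (∀ o v y, |f o v y| ≤
        (2 * V + ρ⁻¹ ^ 2 * Q + 2 * ρ⁻¹ * Q) * A₀ / ((m + 2) * newtonMass m) * n v) ∧
      ∀ v x, ‖x‖ < ρ / 2 → u v x = ∑ o, ∫ y, newtonKer m o (x - y) * f o v y := by
  have hc : 0 < (m + 2) * newtonMass m := mul_pos (by positivity) (newtonMass_pos m)
  have hQ0 : 0 ≤ Q := (abs_nonneg _).trans (hQ2 0)
  set c := (m + 2) * newtonMass m with hcdef
  set χ : EuclideanSpace ℝ (Fin (m + 2)) → ℝ := cutoffAt 0 ρ with hχ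
  have hχC : ContDiff ℝ 2 χ := contDiff_cutoffAt 0 ρ
  let g : X →ₗ[ℝ] (EuclideanSpace ℝ (Fin (m + 2)) → ℝ) :=
    { toFun := fun v => (Metric.ball 0 ρ).indicator fun y => W y * Ψ v y - lap (Ψ v) y
      map_add' := fun a b => by
        rw [← Set.indicator_add', map_add, lap_add (hΨ a) (hΨ b)]
        congr 1; ext y; simp only [Pi.add_apply]; ring
      map_smul' := fun t a => by
        ext y
        rw [RingHom.id_apply, map_smul, lap_smul t (hΨ a), Pi.smul_apply, smul_eq_mul,
          ← Set.indicator_const_mul]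
        refine congrFun (congrArg _ (funext fun y => ?_)) y
        simp only [Pi.smul_apply, smul_eq_mul]; ring }
  have hgin : ∀ v y, ‖y‖ < ρ → g v y = W y * Ψ v y - lap (Ψ v) y := fun v y hy =>
    Set.indicator_of_mem (mem_ball_zero_iff.2 hy) fun y => W y * Ψ v y - lap (Ψ v) y
  have hgm : ∀ v, Measurable (g v) := fun v =>
    ((hWm.mul (hΨ v).continuous.measurable).sub (hΨ v).continuous_lap.measurable).indicator
      measurableSet_ball
  have hgb : ∀ v y, |g v y| ≤ G * n v := by
    intro v y
    rcases lt_or_ge ‖y‖ ρ with hy | hy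
    · rw [hgin v y hy]; exact hΨG v y hy
    · have : g v y = 0 := 
        Set.indicator_of_notMem (s := Metric.ball 0 ρ) (by simpa using hy)
          fun y => W y * Ψ v y - lap (Ψ v) y
      rw [this, abs_zero]; exact mul_nonneg hG0 (hn v)
  obtain ⟨w, hwm, hwb, hw⟩ := exists_linear_correction hρ hρ1 hV hs hWm hW g hgm hgb
  have hub : ∀ v y, ‖y‖ < ρ → |Ψ v y - w v y| ≤ 2 * A₀ * n v := fun v y hy => by
    have h1 := hwb v y
    have h2 := hΨA v y hy
    have h3 := mul_le_mul_of_nonneg_right hG (hn v)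
    exact (abs_sub _ _).trans (by linarith)
  let f : Option (Fin (m + 2)) → X →ₗ[ℝ] (EuclideanSpace ℝ (Fin (m + 2)) → ℝ) := fun o =>
    match o with
    | none =>
      { toFun := fun v y => c⁻¹ * (χ y * (W y * (Ψ v y - w v y)) - lap χ y * Ψ v y)
        map_add' := fun a b => by ext y; simp only [map_add, Pi.add_apply]; ring
        map_smul' := fun t a => by
          ext y; simp only [map_smul, Pi.smul_apply, smul_eq_mul, RingHom.id_apply]; ring }
    | some i =>
      { toFun := fun v y => c⁻¹ * (2 * partialD i χ y * Ψ v y)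
        map_add' := fun a b => by ext y; simp only [map_add, Pi.add_apply]; ring
        map_smul' := fun t a => by
          ext y; simp only [map_smul, Pi.smul_apply, smul_eq_mul, RingHom.id_apply]; ring }
  have hfn : ∀ v y, f none v y = c⁻¹ * (χ y * (W y * (Ψ v y - w v y)) - lap χ y * Ψ v y) :=
    fun v y => rfl
  have hfs : ∀ i v y, f (some i) v y = c⁻¹ * (2 * partialD i χ y * Ψ v y) := fun i v y => rfl
  have hfm : ∀ o v, Measurable (f o v) := by
    rintro (_ | i) v
    · exact measurable_const.mul ((hχC.continuous.measurable.mul (hWm.mul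
        ((hΨ v).continuous.measurable.sub (hwm v)))).sub (hχC.continuous_lap.measurable.mul
          (hΨ v).continuous.measurable))
    · have := (ContDiff.partialD (n := 1)
        (by simpa [one_add_one_eq_two] using hχC) i).continuous.measurable
      exact measurable_const.mul ((measurable_const.mul this).mul (hΨ v).continuous.measurable)
  have hf0 : ∀ o v y, ρ ≤ ‖y‖ → f o v y = 0 := by
    intro o v y hy
    have hy' : ρ ≤ ‖y - 0‖ := by rwa [sub_zero]
    rcases o with _ | i
    · rw [hfn, hχ, cutoffAt_eq_zero hρ (by linarith), lap_cutoffAt_eq_zero hρ (Or.inr hy')]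
      ring
    · rw [hfs, hχ, partialD_cutoffAt_eq_zero hρ (Or.inr hy')]; ring
  have hχ1 : ∀ y, |χ y| ≤ 1 := fun y => by
    rw [abs_of_nonneg (cutoffAt_nonneg _ _ _)]; exact cutoffAt_le_one _ _ _
  have hlχ : ∀ y, |lap χ y| ≤ ρ⁻¹ ^ 2 * Q := fun y => by
    rw [hχ, lap_cutoffAt, abs_mul, abs_of_pos (by positivity)]
    gcongr; exact hQ2 _
  have hpχ : ∀ i y, |partialD i χ y| ≤ ρ⁻¹ * Q := fun i y => by
    rw [hχ, partialD_cutoffAt, abs_mul, abs_of_pos (by positivity)]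
    gcongr; exact hQ1 _ _
  have hfb : ∀ o v y, |f o v y| ≤
      (2 * V + ρ⁻¹ ^ 2 * Q + 2 * ρ⁻¹ * Q) * A₀ / c * n v := by
    intro o v y
    have hnv := hn v
    rcases le_or_gt ρ ‖y‖ with hy | hy
    · rw [hf0 o v y hy, abs_zero]; positivity
    · have hρi : 0 < ρ⁻¹ := inv_pos.2 hρ
      rcases o with _ | i
      · rw [hfn, abs_mul, abs_of_pos (inv_pos.2 hc)]
        calc _ ≤ c⁻¹ * (1 * (V * (2 * A₀ * n v)) + ρ⁻¹ ^ 2 * Q * (A₀ * n v)) := by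
              gcongr
              refine (abs_sub _ _).trans ?_
              rw [abs_mul, abs_mul, abs_mul]
              gcongr
              · exact hχ1 y
              · exact hW y
              · exact hub v y hy
              · exact hlχ y
              · exact hΨA v y hy
          _ = (2 * V + ρ⁻¹ ^ 2 * Q + 0) * A₀ / c * n v := by ring
          _ ≤ _ := by gcongr; positivity
      · rw [hfs, abs_mul, abs_of_pos (inv_pos.2 hc), abs_mul, abs_mul, abs_two]
        calc _ ≤ c⁻¹ * (2 * (ρ⁻¹ * Q) * (A₀ * n v)) := by
              gcongr
              · exact hpχ i y
              · exact hΨA v y hy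
          _ = (0 + 2 * ρ⁻¹ * Q) * A₀ / c * n v := by ring
          _ ≤ _ := by gcongr; positivity
  refine ⟨Ψ - w, f, fun v y => ?_, hfm, hf0, fun v y hy => ?_, fun i v y hy => ?_, hfb,
    fun v x hx => ?_⟩
  · simpa using hwb v y
  · have hy' : ‖y - 0‖ < ρ / 2 := by rwa [sub_zero]
    rw [hfn, hχ, lap_cutoffAt_eq_zero hρ (Or.inl hy'), cutoffAt_eq_one hρ hy'.le, one_mul,
      zero_mul, sub_zero, abs_mul, abs_mul, abs_of_pos (inv_pos.2 hc), div_eq_inv_mul, mul_assoc]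
    exact mul_le_mul_of_nonneg_left (mul_le_mul_of_nonneg_right (hW y) (abs_nonneg _))
      (inv_nonneg.2 hc.le)
  · have hy' : ‖y - 0‖ < ρ / 2 := by rwa [sub_zero]
    rw [hfs, hχ, partialD_cutoffAt_eq_zero hρ (Or.inl hy')]; ring
  · have hxρ : ‖x‖ < ρ := by linarith
    obtain ⟨A, hA, -, -, hall⟩ := exists_norm_iteratedFDeriv_newtonKer_le m
    have hrep := newton_representation hχC (hΨ v) (hasCompactSupport_cutoffAt hρ) (x := x)
      (fun y hy => cutoffAt_eq_zero hρ (by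
        rw [sub_zero]; linarith [norm_sub_le x y]))
    have hi1 : Integrable fun y => newtonKer m none (x - y) * (c * f none v y) := by
      have := (integrable_newtonKer_mul (fun j z hz hz1 => hall j z hz hz1 none) hA
        (hfm none v).aestronglyMeasurable hρ1 (by have := hn v; positivity)
        (hfb none v) (hf0 none v) hxρ.le).const_mul c
      refine this.congr (Filter.Eventually.of_forall fun y => ?_)
      simp only; ring
    have hi2 : Integrable fun y => newton m 0 (x - y) * (χ y * (W y * w v y - g v y)) :=
      integrable_newton_mul_cutoffAt hρ hρ1 ((hWm.mul (hwm v)).sub (hgm v))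
        (G := V * (G * n v) + G * n v) (fun y => by
          simp only [Pi.mul_apply, Pi.sub_apply]
          refine (abs_sub _ _).trans (add_le_add ?_ (hgb v y))
          rw [abs_mul]
          exact mul_le_mul (hW y) (hwb v y) (abs_nonneg _) hV) hxρ
    have hx1 : χ x = 1 := cutoffAt_eq_one hρ (by rw [sub_zero]; exact hx.le)
    have hsplit : ∫ y, newtonKer m none (x - y) * (χ y * lap (Ψ v) y - lap χ y * Ψ v y)
        = (∫ y, newton m 0 (x - y) * (χ y * (W y * w v y - g v y)))
          + ∫ y, newtonKer m none (x - y) * (c * f none v y) := by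
      rw [← integral_add hi2 hi1]
      congr 1; ext y
      rw [hfn, mul_inv_cancel_left₀ hc.ne']
      change newton m 0 (x - y) * _ = newton m 0 (x - y) * _ + newton m 0 (x - y) * _
      rcases lt_or_ge ‖y‖ ρ with hy | hy
      · rw [hgin v y hy]; ring
      · have : χ y = 0 := cutoffAt_eq_zero hρ (by rw [sub_zero]; linarith)
        rw [this]; ring
    rw [hsplit, ← hw v x hxρ, hx1, one_mul] at hrep
    have hsum : c * ∑ o, ∫ y, newtonKer m o (x - y) * f o v y
        = (∫ y, newtonKer m none (x - y) * (c * f none v y))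
          + ∑ i, ∫ y, newtonKer m (some i) (x - y) * (2 * partialD i χ y * Ψ v y) := by
      rw [Fintype.sum_option, mul_add, Finset.mul_sum, ← integral_const_mul]
      congr 1
      · congr 1; ext y; ring
      · refine Finset.sum_congr rfl fun i _ => ?_
        rw [← integral_const_mul]
        congr 1; ext y
        rw [hfs, mul_left_comm, mul_inv_cancel_left₀ hc.ne']
    refine mul_left_cancel₀ hc.ne' ?_
    rw [hsum]
    change c * (Ψ v x - w v x) = _
    rw [mul_sub]
    linarith

theorem exists_local_behavior_constant (m : ℕ) {V ρ A₀ : ℝ} (hρ : 0 < ρ) (hρ1 : ρ ≤ 1 / 2)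
    (hV : 0 ≤ V) (hs : 8 * kapMass m * ρ * (V + 1) ≤ (m + 2) * newtonMass m) (hA₀ : 0 ≤ A₀) :
    ∃ C : ℝ, 1 ≤ C ∧ ∀ W : EuclideanSpace ℝ (Fin (m + 2)) → ℝ, Measurable W →
      (∀ y, |W y| ≤ V) → ∀ (X : Type) [AddCommGroup X] [Module ℝ X] [FiniteDimensional ℝ X]
      (Ψ : X →ₗ[ℝ] (EuclideanSpace ℝ (Fin (m + 2)) → ℝ)) (n : X → ℝ), (∀ v, 0 ≤ n v) →
      ∀ G, 0 ≤ G → G ≤ A₀ → (∀ v, ContDiff ℝ 2 (Ψ v)) →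
      (∀ v y, ‖y‖ < ρ → |W y * Ψ v y - lap (Ψ v) y| ≤ G * n v) →
      (∀ v y, ‖y‖ < ρ → |Ψ v y| ≤ A₀ * n v) → ∀ N : ℕ, 1 ≤ N →
      ∃ S : Submodule ℝ X, Module.finrank ℝ X ≤
          Module.finrank ℝ S + ∑ j ∈ Finset.range (N + 1), 2 * (j + 1) ^ m ∧
        ∀ v ∈ S, ∀ y, ‖y‖ < ρ → |Ψ v y| ≤ (C ^ (N ^ 2) * ‖y‖ ^ (N + 1) + G) * n v := by
  have hc : 0 < (m + 2) * newtonMass m := mul_pos (by positivity) (newtonMass_pos m)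
  obtain ⟨A, hA, hsome, hnone, hall⟩ := exists_norm_iteratedFDeriv_newtonKer_le m
  obtain ⟨Q, hQ, hQ1, hQ2⟩ := exists_cutoff_bound (m + 2)
  set q₁ := V / ((m + 2) * newtonMass m) with hq₁
  set q₂ := (2 * V + ρ⁻¹ ^ 2 * Q + 2 * ρ⁻¹ * Q) * A₀ / ((m + 2) * newtonMass m) with hq₂
  have hq₁0 : 0 ≤ q₁ := by positivity
  have hq₂0 : 0 ≤ q₂ := by positivity
  obtain ⟨T, hT1, hT0, hT, hTs⟩ := exists_growth_constant m (kapMass m) A (1 + q₁ + q₂) (2 / ρ)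
    (2 * A₀) (kapMass_pos m).le hA (by linarith) (by rw [le_div_iff₀ hρ]; linarith)
    (by positivity)
  refine ⟨T ^ 5, one_le_pow₀ hT1, fun W hWm hW X _ _ _ Ψ n hn G hG0 hG hΨ hΨG hΨA N hN => ?_⟩
  obtain ⟨u, f, huΨ, hfm, hf0, hfu, hfs, hfb, hrep⟩ :=
    exists_density hρ hρ1 hV hs hA₀ hQ1 hQ2 hWm hW Ψ hn hG0 hG hΨ hΨG hΨA
  obtain ⟨S, hS, hb, -⟩ := exists_submodule_abs_le u f hA hsome hnone hall hρ hρ1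
    (Q := 1 + q₁ + q₂) (by linarith) hn (fun o v => (hfm o v).aestronglyMeasurable) hf0
    (fun v y hy => (hfu v y hy).trans (by gcongr; linarith)) hfs
    (fun o v y => (hfb o v y).trans (by have := hn v; gcongr; linarith))
    (A₀ := 2 * A₀) (fun v y hy => by
      have h1 := huΨ v y
      have h2 := hΨA v y hy
      have h3 := mul_le_mul_of_nonneg_right hG (hn v)
      have h4 : u v y = Ψ v y - (Ψ v y - u v y) := by ring
      rw [h4]
      exact (abs_sub _ _).trans (by linarith)) hrep hT1 hT0 hT hTs (N + 1)
  refine ⟨S, hS, fun v hv y hy => ?_⟩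
  have hnv := hn v
  have h1 : T ^ ((N + 1) ^ 2 + 1) ≤ (T ^ 5) ^ (N ^ 2) := by
    rw [← pow_mul]; exact pow_le_pow_right₀ hT1 (by nlinarith)
  calc |Ψ v y| = |u v y + (Ψ v y - u v y)| := by ring_nf
    _ ≤ T ^ ((N + 1) ^ 2 + 1) * n v * ‖y‖ ^ (N + 1) + G * n v :=
      (abs_add_le _ _).trans (add_le_add (hb v hv y hy) (huΨ v y))
    _ ≤ (T ^ 5) ^ (N ^ 2) * n v * ‖y‖ ^ (N + 1) + G * n v := by gcongr
    _ = _ := by ring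

/-- The function `y ↦ ψ (x₀ - y)` cut off to the ball of radius `δ`, linearly in `ψ`. -/
noncomputable def localize {d : ℕ} (x₀ : EuclideanSpace ℝ (Fin d)) (δ : ℝ) :
    (EuclideanSpace ℝ (Fin d) → ℝ) →ₗ[ℝ] (EuclideanSpace ℝ (Fin d) → ℝ) where
  toFun ψ y := cutoffAt 0 δ y * ψ (x₀ - y)
  map_add' a b := by ext y; simp [mul_add]
  map_smul' t a := by ext y; simp [mul_left_comm]

section Localize

variable {d : ℕ} {x₀ : EuclideanSpace ℝ (Fin d)} {δ : ℝ} {ψ : EuclideanSpace ℝ (Fin d) → ℝ}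
  {Ω : Set (EuclideanSpace ℝ (Fin d))}

theorem sub_mem_of_ball_subset (hΩ : Metric.ball x₀ δ ⊆ Ω) {y : EuclideanSpace ℝ (Fin d)}
    (hy : ‖y‖ < δ) : x₀ - y ∈ Ω :=
  hΩ (by rwa [mem_ball_iff_norm, sub_sub_cancel_left, norm_neg])

theorem localize_apply (y : EuclideanSpace ℝ (Fin d)) :
    localize x₀ δ ψ y = cutoffAt 0 δ y * ψ (x₀ - y) := rfl

theorem localize_eq (hδ : 0 < δ) {y : EuclideanSpace ℝ (Fin d)} (hy : ‖y‖ ≤ δ / 2) :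
    localize x₀ δ ψ y = ψ (x₀ - y) := by
  rw [localize_apply, cutoffAt_eq_one hδ (by rwa [sub_zero]), one_mul]

theorem lap_localize (hδ : 0 < δ) {y : EuclideanSpace ℝ (Fin d)} (hy : ‖y‖ < δ / 2) :
    lap (localize x₀ δ ψ) y = lap ψ (x₀ - y) := by
  rw [← lap_comp_sub]
  refine lap_congr ?_
  filter_upwards [Metric.isOpen_ball.mem_nhds (mem_ball_zero_iff.2 hy)] with z hz
  exact localize_eq hδ (mem_ball_zero_iff.1 hz).le

theorem contDiff_localize (hδ : 0 < δ) (hΩo : IsOpen Ω) (hΩ : Metric.ball x₀ δ ⊆ Ω)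
    (hψ : ContDiffOn ℝ 2 ψ Ω) : ContDiff ℝ 2 (localize x₀ δ ψ) := by
  rw [contDiff_iff_contDiffAt]
  intro y
  rcases lt_or_ge ‖y‖ δ with hy | hy
  · have h := (hψ.contDiffAt (hΩo.mem_nhds (sub_mem_of_ball_subset hΩ hy)))
    exact (contDiff_cutoffAt 0 δ).contDiffAt.mul
      (h.comp y (contDiff_const.sub contDiff_id).contDiffAt)
  · refine contDiffAt_const (c := (0 : ℝ)) |>.congr_of_eventuallyEq ?_
    filter_upwards [(isOpen_lt continuous_const continuous_norm).mem_nhds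
      (show 3 / 4 * δ < ‖y‖ by linarith)] with z hz
    rw [localize_apply, cutoffAt_eq_zero hδ (by rw [sub_zero]; exact le_of_lt hz), zero_mul]

theorem hasCompactSupport_localize (hδ : 0 < δ) : HasCompactSupport (localize x₀ δ ψ) :=
  (hasCompactSupport_cutoffAt hδ).mul_right (f' := fun y => ψ (x₀ - y))

theorem Continuous.integrable_sq_of_hasCompactSupport {f : EuclideanSpace ℝ (Fin d) → ℝ}
    (hf : Continuous f) (hs : HasCompactSupport f) : Integrable fun y => f y ^ 2 := by
  have h : HasCompactSupport fun y => f y ^ 2 := by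
    simp only [sq]
    exact hs.mul_right (f' := f)
  exact (hf.pow 2).integrable_of_hasCompactSupport h

theorem integral_localize_sq_le (hδ : 0 < δ) (hΩo : IsOpen Ω) (hΩ : Metric.ball x₀ δ ⊆ Ω)
    (hψ : ContDiffOn ℝ 2 ψ Ω) (hψi : IntegrableOn (fun x => ψ x ^ 2) Ω) :
    ∫ y, localize x₀ δ ψ y ^ 2 ≤ ∫ x in Ω, ψ x ^ 2 := by
  have hintg : Integrable fun y => localize x₀ δ ψ y ^ 2 :=
    (contDiff_localize hδ hΩo hΩ hψ).continuous.integrable_sq_of_hasCompactSupport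
      (hasCompactSupport_localize hδ)
  rw [← integral_indicator hΩo.measurableSet, 
    ← integral_sub_left_eq_self (Ω.indicator fun x => ψ x ^ 2) volume x₀]
  refine integral_mono hintg ((hψi.integrable_indicator hΩo.measurableSet).comp_sub_left x₀)
    fun y => ?_
  rcases lt_or_ge ‖y‖ δ with hy | hy
  · have h0 := cutoffAt_nonneg 0 δ y
    have h1 := cutoffAt_le_one 0 δ y
    rw [Set.indicator_of_mem (sub_mem_of_ball_subset hΩ hy)]
    simp only [localize_apply, mul_pow]
    exact mul_le_of_le_one_left (sq_nonneg _) (pow_le_one₀ h0 h1)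
  · simp only [localize_apply]
    rw [cutoffAt_eq_zero hδ (by rw [sub_zero]; linarith), zero_mul, zero_pow two_ne_zero]
    exact Set.indicator_nonneg (fun _ _ => sq_nonneg _) _

end Localize

theorem sq_setIntegral_abs_le {α : Type*} [MeasurableSpace α] {μ : Measure α} {f : α → ℝ}
    {s : Set α} (hs : μ s ≠ ⊤) (hf : Integrable f μ) (hf2 : Integrable (fun x => f x ^ 2) μ) :
    (∫ x in s, |f x| ∂μ) ^ 2 ≤ μ.real s * ∫ x, f x ^ 2 ∂μ := by
  have : IsFiniteMeasure (μ.restrict s) := ⟨by simpa using hs.lt_top⟩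
  have hi1 : Integrable (fun x => |f x|) (μ.restrict s) := hf.abs.restrict
  have hi2 : Integrable (fun x => f x ^ 2) (μ.restrict s) := hf2.restrict
  have hle : ∫ x in s, f x ^ 2 ∂μ ≤ ∫ x, f x ^ 2 ∂μ :=
    setIntegral_le_integral hf2 (Filter.Eventually.of_forall fun _ => sq_nonneg _)
  set I := ∫ x in s, |f x| ∂μ with hI
  have key : ∀ t : ℝ, 0 ≤ (μ.real s) * (t * t) + (-2 * I) * t + ∫ x, f x ^ 2 ∂μ := by
    intro t
    have h : ∫ x in s, (|f x| - t) ^ 2 ∂μ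
        = ∫ x in s, f x ^ 2 ∂μ - 2 * t * I + t ^ 2 * μ.real s := by
      have h1 : ∀ x, (|f x| - t) ^ 2 = f x ^ 2 - 2 * t * |f x| + t ^ 2 := fun x => by
        rw [sub_sq, sq_abs]; ring
      simp only [h1]
      have hi3 : Integrable (fun x => f x ^ 2 - 2 * t * |f x|) (μ.restrict s) :=
        hi2.sub (hi1.const_mul _)
      rw [integral_add hi3 (integrable_const _),
        integral_sub hi2 (hi1.const_mul _), integral_const_mul, setIntegral_const, smul_eq_mul]
      ring
    have h0 : 0 ≤ ∫ x in s, (|f x| - t) ^ 2 ∂μ := integral_nonneg fun _ => sq_nonneg _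
    rw [h] at h0
    linarith
  have := discrim_le_zero key
  rw [discrim] at this
  linarith

theorem setIntegral_abs_localize_le {d : ℕ} {x₀ : EuclideanSpace ℝ (Fin d)} {δ r : ℝ}
    {ψ : EuclideanSpace ℝ (Fin d) → ℝ} {Ω : Set (EuclideanSpace ℝ (Fin d))} (hδ : 0 < δ)
    (hΩo : IsOpen Ω) (hΩ : Metric.ball x₀ δ ⊆ Ω) (hψ : ContDiffOn ℝ 2 ψ Ω)
    (hψi : IntegrableOn (fun x => ψ x ^ 2) Ω) :
    ∫ y in Metric.ball 0 r, |localize x₀ δ ψ y| ≤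
      √(volume.real (Metric.ball (0 : EuclideanSpace ℝ (Fin d)) r)) * √(∫ x in Ω, ψ x ^ 2) := by
  have hc := (contDiff_localize hδ hΩo hΩ hψ).continuous
  have hs := hasCompactSupport_localize (x₀ := x₀) (ψ := ψ) hδ
  rw [← Real.sqrt_mul measureReal_nonneg]
  refine Real.le_sqrt_of_sq_le ((sq_setIntegral_abs_le measure_ball_lt_top.ne
    (hc.integrable_of_hasCompactSupport hs)
    (hc.integrable_sq_of_hasCompactSupport hs)).trans ?_)
  exact mul_le_mul_of_nonneg_left (integral_localize_sq_le hδ hΩo hΩ hψ hψi) measureReal_nonneg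

theorem sum_range_two_mul_pow_le (m : ℕ) {N : ℕ} (hN : 1 ≤ N) :
    ∑ j ∈ Finset.range (N + 1), 2 * (j + 1) ^ m ≤ 2 ^ (m + 2) * N ^ (m + 1) := by
  calc ∑ j ∈ Finset.range (N + 1), 2 * (j + 1) ^ m
      ≤ ∑ j ∈ Finset.range (N + 1), 2 * (2 * N) ^ m := by
        refine Finset.sum_le_sum fun j hj => ?_
        have : j + 1 ≤ 2 * N := by have := Finset.mem_range.1 hj; omega
        gcongr
    _ = (N + 1) * (2 * (2 * N) ^ m) := by simp
    _ ≤ (2 * N) * (2 * (2 * N) ^ m) := by gcongr; omega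
    _ = _ := by ring

/-- Local behavior of approximate solutions of the stationary Schrödinger
equation: given `d ≥ 2`, a bound `Winf` and `r₀ > 0`, there are `γ_d > 0` (depending only
on `d`), `0 < r₁ < r₀` (depending only on `d, Winf, r₀`) and `C ≥ 1` (depending only on
`d, Winf, r₁`) such that for every open `Ω ⊇ B(x₀,r₀)`, every measurable `W` with
`|W| ≤ Winf` on `Ω`, and every finite-dimensional subspace `F` of C², square-integrable
functions on `Ω` with `sup_{B(x₀,r₀)} |-Δψ + Wψ| ≤ C_F ‖ψ‖_{L²(Ω)}` for all `ψ ∈ F`,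
for every `N ∈ ℕ` there is a subspace `F_N ≤ F` with
`dim F_N ≥ dim F - γ_d N^{d-1}` such that every `ψ ∈ F_N` satisfies
`|ψ(x)| ≤ (C^{N²} |x-x₀|^{N+1} + C_F) ‖ψ‖_{L²(Ω)}` on `B(x₀,r₁)`. -/
theorem local_behavior_approximate_solutions (d : ℕ) (hd : 2 ≤ d) :
    ∃ γ > (0 : ℝ), ∀ Winf : ℝ, 0 ≤ Winf → ∀ r₀ : ℝ, 0 < r₀ →
      ∃ r₁ : ℝ, 0 < r₁ ∧ r₁ < r₀ ∧ ∃ C : ℝ, 1 ≤ C ∧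
        ∀ Ω : Set (EuclideanSpace ℝ (Fin d)), IsOpen Ω →
        ∀ x₀ : EuclideanSpace ℝ (Fin d), Metric.ball x₀ r₀ ⊆ Ω →
        ∀ W : EuclideanSpace ℝ (Fin d) → ℝ, Measurable W → (∀ x ∈ Ω, |W x| ≤ Winf) →
        ∀ F : Submodule ℝ (EuclideanSpace ℝ (Fin d) → ℝ), FiniteDimensional ℝ F →
          (∀ ψ ∈ F, ContDiffOn ℝ 2 ψ Ω) →
          (∀ ψ ∈ F, IntegrableOn (fun x => ψ x ^ 2) Ω) →
          ∀ C_F : ℝ, 0 ≤ C_F →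
          (∀ ψ ∈ F, ∀ x ∈ Metric.ball x₀ r₀,
            |(-(lap ψ x) + W x * ψ x)| ≤ C_F * Real.sqrt (∫ y in Ω, ψ y ^ 2)) →
          ∀ N : ℕ, 1 ≤ N →
            ∃ F_N : Submodule ℝ (EuclideanSpace ℝ (Fin d) → ℝ), F_N ≤ F ∧
              (Module.finrank ℝ F : ℝ) - γ * (N : ℝ) ^ (d - 1) ≤
                (Module.finrank ℝ F_N : ℝ) ∧
              ∀ ψ ∈ F_N, ∀ x ∈ Metric.ball x₀ r₁,
                |ψ x| ≤ (C ^ (N ^ 2) * ‖x - x₀‖ ^ (N + 1) + C_F) *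
                  Real.sqrt (∫ y in Ω, ψ y ^ 2) := by
  obtain ⟨m, rfl⟩ := Nat.exists_eq_add_of_le' hd
  refine ⟨2 ^ (m + 2), by positivity, fun V hV r₀ hr₀ => ?_⟩
  have hK := kapMass_pos m
  have hc : 0 < (m + 2) * newtonMass m := mul_pos (by positivity) (newtonMass_pos m)
  set D := 2 ^ (m + 6) * kapMass m * (V + 1) with hD
  have hD0 : 0 < D := by positivity
  obtain ⟨ρ, hρ, hρ1, hρr, hρD⟩ : ∃ ρ : ℝ, 0 < ρ ∧ ρ ≤ 1 / 2 ∧ 4 * ρ ≤ r₀ ∧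
      D * ρ ≤ (m + 2) * newtonMass m := by
    refine ⟨min (1 / 2) (min (r₀ / 4) ((m + 2) * newtonMass m / D)), by positivity,
      min_le_left _ _, ?_, ?_⟩
    · have := (min_le_right (1 / 2) _).trans
        (min_le_left (r₀ / 4) ((m + 2) * newtonMass m / D))
      linarith
    · rw [mul_comm, ← le_div_iff₀ hD0]
      exact (min_le_right _ _).trans (min_le_right _ _)
  have hs1 : 2 ^ (m + 5) * kapMass m * (2 * ρ) * (V + 1) ≤ (m + 2) * newtonMass m := by
    refine le_trans (le_of_eq ?_) hρD
    rw [hD]; ring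
  have hs2 : 8 * kapMass m * ρ * (V + 1) ≤ (m + 2) * newtonMass m := by
    refine le_trans ?_ hρD
    have h2 : (8 : ℝ) ≤ 2 ^ (m + 6) :=
      (show (8 : ℝ) = 2 ^ 3 by norm_num) ▸ pow_le_pow_right₀ one_le_two (by omega)
    calc 8 * kapMass m * ρ * (V + 1) ≤ 2 ^ (m + 6) * kapMass m * ρ * (V + 1) := by gcongr
      _ = D * ρ := by rw [hD]; ring
  obtain ⟨A, hA1, hA⟩ := exists_sup_bound m hV (r := 2 * ρ) (by linarith) (by linarith) hs1
  set A₀ := 2 * (A * √(volume.real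
    (Metric.ball (0 : EuclideanSpace ℝ (Fin (m + 2))) (2 * ρ)))) with hA₀
  have hA₀0 : 0 ≤ A₀ := by positivity
  obtain ⟨C, hC1, hC⟩ := exists_local_behavior_constant m hρ hρ1 hV hs2 hA₀0
  refine ⟨ρ, hρ, by linarith, C, hC1,
    fun Ω hΩo x₀ hΩ W hWm hW F hF hF2 hFi CF hCF hFW N hN => ?_⟩
  have hδ : 0 < 4 * ρ := by linarith
  have hΩ' : Metric.ball x₀ (4 * ρ) ⊆ Ω := (Metric.ball_subset_ball hρr).trans hΩ
  set n : F → ℝ := fun ψ => √(∫ y in Ω, ψ.1 y ^ 2) with hn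
  have hn0 : ∀ ψ, 0 ≤ n ψ := fun ψ => Real.sqrt_nonneg _
  let Ψ : F →ₗ[ℝ] (EuclideanSpace ℝ (Fin (m + 2)) → ℝ) := localize x₀ (4 * ρ) ∘ₗ F.subtype
  have hΨ2 : ∀ ψ, ContDiff ℝ 2 (Ψ ψ) := fun ψ => contDiff_localize hδ hΩo hΩ' (hF2 ψ ψ.2)
  have hΨe : ∀ ψ y, ‖y‖ < 2 * ρ → Ψ ψ y = ψ.1 (x₀ - y) := fun ψ y hy =>
    localize_eq hδ (by linarith)
  set W' : EuclideanSpace ℝ (Fin (m + 2)) → ℝ :=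
    (Metric.ball 0 r₀).indicator fun y => W (x₀ - y) with hW'
  have hW'm : Measurable W' :=
    (hWm.comp (measurable_const.sub measurable_id)).indicator measurableSet_ball
  have hW'e : ∀ y, ‖y‖ < r₀ → W' y = W (x₀ - y) := fun y hy =>
    Set.indicator_of_mem (mem_ball_zero_iff.2 hy) fun y => W (x₀ - y)
  have hW'b : ∀ y, |W' y| ≤ V := by
    intro y
    rcases lt_or_ge ‖y‖ r₀ with hy | hy
    · rw [hW'e y hy]; exact hW _ (sub_mem_of_ball_subset hΩ hy)
    · have : W' y = 0 := Set.indicator_of_notMem (s := Metric.ball 0 r₀) (by simpa using hy)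
        fun y => W (x₀ - y)
      rwa [this, abs_zero]
  have hΨW : ∀ ψ y, ‖y‖ < 2 * ρ → |W' y * Ψ ψ y - lap (Ψ ψ) y| ≤ CF * n ψ := by
    intro ψ y hy
    have hl : lap (Ψ ψ) y = lap ψ.1 (x₀ - y) := lap_localize hδ (by linarith)
    have := hFW ψ ψ.2 (x₀ - y) (sub_mem_of_ball_subset subset_rfl (by linarith))
    rwa [hW'e y (by linarith), hΨe ψ y hy, hl, sub_eq_neg_add]
  have hsup : ∀ ψ y, ‖y‖ < ρ → |Ψ ψ y| ≤ (A₀ + CF) / 2 * n ψ := by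
    intro ψ y hy
    refine (hA (Ψ ψ) (hΨ2 ψ) (CF * n ψ) _ (mul_nonneg hCF (hn0 ψ)) (fun z hz => ?_)
      (setIntegral_abs_localize_le (ψ := ψ.1) hδ hΩo hΩ' (hF2 ψ ψ.2) (hFi ψ ψ.2)) y
      (by linarith)).trans (le_of_eq ?_)
    · have h1 := hΨW ψ z hz
      have h2 : lap (Ψ ψ) z = W' z * Ψ ψ z - (W' z * Ψ ψ z - lap (Ψ ψ) z) := by ring
      have h3 : |W' z * Ψ ψ z| ≤ V * |Ψ ψ z| := by
        rw [abs_mul]; exact mul_le_mul_of_nonneg_right (hW'b z) (abs_nonneg _)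
      rw [h2]
      exact (abs_sub _ _).trans (add_le_add h3 h1)
    · simp only [hA₀, hn]; ring
  have hball : ∀ x ∈ Metric.ball x₀ ρ, ‖x₀ - x‖ < ρ := fun x hx => by
    rwa [norm_sub_rev, ← mem_ball_iff_norm]
  rcases le_total A₀ CF with hle | hle
  · refine ⟨F, le_rfl, sub_le_self _ (by positivity), fun ψ hψ x hx => ?_⟩
    have hx' := hball x hx
    have h := hsup ⟨ψ, hψ⟩ (x₀ - x) hx'
    rw [hΨe _ _ (by linarith), sub_sub_cancel] at h
    refine h.trans (mul_le_mul_of_nonneg_right ?_ (hn0 _))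
    have : 0 ≤ C ^ N ^ 2 * ‖x - x₀‖ ^ (N + 1) := by positivity
    linarith
  · obtain ⟨S, hS, hb⟩ := hC W' hW'm hW'b F Ψ n hn0 CF hCF hle hΨ2
      (fun ψ y hy => hΨW ψ y (by linarith))
      (fun ψ y hy => (hsup ψ y hy).trans
        (mul_le_mul_of_nonneg_right (by linarith) (hn0 ψ))) N hN
    refine ⟨S.map F.subtype, Submodule.map_subtype_le F S, ?_, ?_⟩
    · rw [Submodule.finrank_map_subtype_eq, sub_le_iff_le_add]
      exact_mod_cast hS.trans (Nat.add_le_add_left (sum_range_two_mul_pow_le m hN) _)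
    · rintro _ ⟨ψ, hψ, rfl⟩ x hx
      have hx' := hball x hx
      have h := hb ψ hψ (x₀ - x) hx'
      rwa [hΨe _ _ (by linarith), sub_sub_cancel, norm_sub_rev] at h
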